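/- Assume the standing assumptions in dimension n = 3 and let Ω′ be an open set compactly contained in Ω \ spt(μ). Then for every τ > 0 there exists c̄_τ > 0 such that if α({x}) < c̄_τ for every x ∈ closure(Ω′) (i.e. α has no atoms of size at least c̄_τ in closure(Ω′)), then for all sufficiently large k one has | |u_k(x)| − 1 | < τ for all x ∈ Ω′. -/

import Mathlib

open MeasureTheory Filter Metric Set

noncomputable section

abbrev E (n : ℕ) : Type := EuclideanSpace ℝ (Fin n)

def W (t : ℝ) : ℝ := (t ^ 2 - 1) ^ 2 / 4

def W' (t : ℝ) : ℝ := t ^ 3 - t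

def c0 : ℝ := 2 * Real.sqrt 2 / 3

def lap {n : ℕ} (u : E n → ℝ) (x : E n) : ℝ :=
  ∑ i, (fderiv ℝ (fderiv ℝ u) x) (EuclideanSpace.single i 1) (EuclideanSpace.single i 1)

def areaDensity {n : ℕ} (ev : ℝ) (u : E n → ℝ) (x : E n) : ℝ :=
  ev / 2 * ‖fderiv ℝ u x‖ ^ 2 + (1 / ev) * W (u x)

def willDensity {n : ℕ} (ev : ℝ) (u : E n → ℝ) (x : E n) : ℝ :=
  (ev * lap u x - (1 / ev) * W' (u x)) ^ 2

def Se {n : ℕ} (ev : ℝ) (Ω : Set (E n)) (u : E n → ℝ) : ℝ :=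
  (1 / c0) * ∫ x in Ω, areaDensity ev u x

def We {n : ℕ} (ev : ℝ) (Ω : Set (E n)) (u : E n → ℝ) : ℝ :=
  (1 / (c0 * ev)) * ∫ x in Ω, willDensity ev u x

def mue {n : ℕ} (ev : ℝ) (Ω : Set (E n)) (u : E n → ℝ) (U : Set (E n)) : ℝ :=
  (1 / c0) * ∫ x in U ∩ Ω, areaDensity ev u x

def ale {n : ℕ} (ev : ℝ) (Ω : Set (E n)) (u : E n → ℝ) (U : Set (E n)) : ℝ :=
  (1 / (c0 * ev)) * ∫ x in U ∩ Ω, willDensity ev u x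

def xiPlus {n : ℕ} (ev : ℝ) (Ω : Set (E n)) (u : E n → ℝ) (U : Set (E n)) : ℝ :=
  ∫ x in U ∩ Ω, max (ev / 2 * ‖fderiv ℝ u x‖ ^ 2 - (1 / ev) * W (u x)) 0

def sptM {n : ℕ} (μ : Measure (E n)) : Set (E n) :=
  {x | ∀ r > 0, 0 < μ (ball x r)}

def weakConvA {n : ℕ} (Ω : Set (E n)) (ε : ℕ → ℝ) (u : ℕ → E n → ℝ)
    (μ : Measure (E n)) : Prop :=
  ∀ φ : BoundedContinuousFunction (E n) ℝ,
    Tendsto (fun k => (1 / c0) * ∫ x in Ω, φ x * areaDensity (ε k) (u k) x) atTop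
      (nhds (∫ x, φ x ∂μ))

def weakConvW {n : ℕ} (Ω : Set (E n)) (ε : ℕ → ℝ) (u : ℕ → E n → ℝ)
    (α : Measure (E n)) : Prop :=
  ∀ φ : BoundedContinuousFunction (E n) ℝ,
    Tendsto (fun k => (1 / (c0 * ε k)) * ∫ x in Ω, φ x * willDensity (ε k) (u k) x) atTop
      (nhds (∫ x, φ x ∂α))

/-- The `i`-th partial derivative. -/
def pd (i : Fin 3) (u : E 3 → ℝ) (x : E 3) : ℝ := fderiv ℝ u x (EuclideanSpace.single i 1)

/-- The squared length of the gradient. -/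
def gradSq (u : E 3 → ℝ) (x : E 3) : ℝ := ∑ i, pd i u x ^ 2

lemma pd_add {f g : E 3 → ℝ} {x : E 3} (i : Fin 3) (hf : DifferentiableAt ℝ f x)
    (hg : DifferentiableAt ℝ g x) :
    pd i (fun y => f y + g y) x = pd i f x + pd i g x := by
  simp only [pd]
  rw [fderiv_fun_add hf hg]; rfl

lemma pd_sub {f g : E 3 → ℝ} {x : E 3} (i : Fin 3) (hf : DifferentiableAt ℝ f x)
    (hg : DifferentiableAt ℝ g x) :
    pd i (fun y => f y - g y) x = pd i f x - pd i g x := by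
  simp only [pd]
  rw [fderiv_fun_sub hf hg]; rfl

lemma pd_mul {f g : E 3 → ℝ} {x : E 3} (i : Fin 3) (hf : DifferentiableAt ℝ f x)
    (hg : DifferentiableAt ℝ g x) :
    pd i (fun y => f y * g y) x = pd i f x * g x + f x * pd i g x := by
  simp only [pd]
  rw [fderiv_fun_mul hf hg]
  simp; ring

lemma pd_sum {ι : Type*} {s : Finset ι} {f : ι → E 3 → ℝ} {x : E 3} (i : Fin 3)
    (hf : ∀ j ∈ s, DifferentiableAt ℝ (f j) x) :
    pd i (fun y => ∑ j ∈ s, f j y) x = ∑ j ∈ s, pd i (f j) x := by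
  simp only [pd]
  rw [fderiv_fun_sum hf]; simp

lemma pd_const_mul {f : E 3 → ℝ} {x : E 3} (i : Fin 3) (c : ℝ) (hf : DifferentiableAt ℝ f x) :
    pd i (fun y => c * f y) x = c * pd i f x := by
  simp only [pd]
  rw [fderiv_const_mul hf]; rfl

lemma pd_const (i : Fin 3) (c : ℝ) (x : E 3) : pd i (fun _ => c) x = 0 := by
  simp [pd]

/-- Chain rule for an outer function of one variable. -/
lemma pd_comp {φ : ℝ → ℝ} {f : E 3 → ℝ} {x : E 3} {φ' : ℝ} (i : Fin 3)
    (hφ : HasDerivAt φ φ' (f x)) (hf : DifferentiableAt ℝ f x) :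
    pd i (fun y => φ (f y)) x = φ' * pd i f x := by
  have h := (hφ.comp_hasFDerivAt x hf.hasFDerivAt).fderiv
  simp only [pd]
  change (fderiv ℝ (φ ∘ f) x) _ = _
  rw [h]; rfl

/-- Partial derivatives of an affine substitution. -/
lemma pd_comp_affine {f : E 3 → ℝ} (i : Fin 3) (c : ℝ) (a y : E 3)
    (hf : DifferentiableAt ℝ f (a + c • y)) :
    pd i (fun y => f (a + c • y)) y = c * pd i f (a + c • y) := by
  have h1 : HasFDerivAt (fun y : E 3 => a + c • y) (c • ContinuousLinearMap.id ℝ (E 3)) y :=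
    ((hasFDerivAt_id y).const_smul c).const_add a
  have h := (HasFDerivAt.comp y hf.hasFDerivAt h1).fderiv
  simp only [pd]
  change (fderiv ℝ (f ∘ fun y : E 3 => a + c • y) y) _ = _
  rw [h]; simp

lemma pd_coord (i j : Fin 3) (x : E 3) :
    pd i (fun y : E 3 => y j) x = if i = j then 1 else 0 := by
  have h : HasFDerivAt (fun y : E 3 => y j) (EuclideanSpace.proj j : E 3 →L[ℝ] ℝ) x :=
    (EuclideanSpace.proj j : E 3 →L[ℝ] ℝ).hasFDerivAt
  simp only [pd]
  rw [h.fderiv]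
  simp [eq_comm]

lemma contDiff_coord (j : Fin 3) {n : WithTop ℕ∞} : ContDiff ℝ n (fun y : E 3 => y j) :=
  (EuclideanSpace.proj j : E 3 →L[ℝ] ℝ).contDiff

lemma contDiff_pd {u : E 3 → ℝ} {m n : WithTop ℕ∞} (i : Fin 3) (hu : ContDiff ℝ n u)
    (hmn : m + 1 ≤ n) : ContDiff ℝ m (pd i u) :=
  (hu.fderiv_right hmn).clm_apply contDiff_const

lemma continuous_pd {u : E 3 → ℝ} (i : Fin 3) (hu : ContDiff ℝ 1 u) : Continuous (pd i u) :=
  (contDiff_pd i hu (m := 0) (by norm_num)).continuous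

lemma contDiff_one_pd {u : E 3 → ℝ} (i : Fin 3) (hu : ContDiff ℝ 2 u) : ContDiff ℝ 1 (pd i u) :=
  contDiff_pd i hu (by norm_num)

lemma contDiff_two_pd {u : E 3 → ℝ} (i : Fin 3) (hu : ContDiff ℝ 3 u) : ContDiff ℝ 2 (pd i u) :=
  contDiff_pd i hu (by norm_num)

lemma hasCompactSupport_pd {u : E 3 → ℝ} (i : Fin 3) (hu : HasCompactSupport u) :
    HasCompactSupport (pd i u) :=
  (hu.fderiv ℝ).comp_left (g := fun l : E 3 →L[ℝ] ℝ => l (EuclideanSpace.single i 1)) (by simp)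

lemma pd_pd_eq {u : E 3 → ℝ} (hu : ContDiff ℝ 2 u) (i j : Fin 3) (x : E 3) :
    pd i (pd j u) x =
      fderiv ℝ (fderiv ℝ u) x (EuclideanSpace.single i 1) (EuclideanSpace.single j 1) := by
  have hd : DifferentiableAt ℝ (fderiv ℝ u) x :=
    (hu.fderiv_right (m := 1) (by norm_num)).differentiable (by norm_num) x
  have h := (hd.hasFDerivAt.clm_apply
    (hasFDerivAt_const (EuclideanSpace.single j (1 : ℝ)) x)).fderiv
  change fderiv ℝ (fun y => fderiv ℝ u y (EuclideanSpace.single j 1)) x _ = _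
  rw [h]; simp

lemma pd_comm {u : E 3 → ℝ} (hu : ContDiff ℝ 2 u) (i j : Fin 3) (x : E 3) :
    pd i (pd j u) x = pd j (pd i u) x := by
  rw [pd_pd_eq hu, pd_pd_eq hu]
  exact (hu.contDiffAt.isSymmSndFDerivAt (by simp)) _ _

lemma lap_eq {u : E 3 → ℝ} (hu : ContDiff ℝ 2 u) (x : E 3) : lap u x = ∑ i, pd i (pd i u) x := by
  simp only [lap, pd_pd_eq hu]

lemma continuous_lap {u : E 3 → ℝ} (hu : ContDiff ℝ 2 u) : Continuous (lap u) := by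
  rw [show lap u = fun x => ∑ i, pd i (pd i u) x from funext (lap_eq hu)]
  exact continuous_finsetSum _ fun i _ => continuous_pd i (contDiff_one_pd i hu)

lemma eq_sum_single (v : E 3) : v = ∑ i, v i • EuclideanSpace.single i (1 : ℝ) := by
  ext j
  simp [Pi.single_apply]

lemma fderiv_apply_eq_sum (u : E 3 → ℝ) (x v : E 3) : fderiv ℝ u x v = ∑ i, v i * pd i u x := by
  conv_lhs => rw [eq_sum_single v]
  simp [pd, map_sum]

lemma norm_fderiv_sq (u : E 3 → ℝ) (x : E 3) : ‖fderiv ℝ u x‖ ^ 2 = gradSq u x := by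
  set v := (InnerProductSpace.toDual ℝ (E 3)).symm (fderiv ℝ u x) with hv
  have h1 : ‖fderiv ℝ u x‖ = ‖v‖ := by simp [hv]
  have h2 : ∀ i, pd i u x = v i := by
    intro i
    have : fderiv ℝ u x = InnerProductSpace.toDual ℝ (E 3) v := by simp [hv]
    rw [pd, this, InnerProductSpace.toDual_apply_apply]
    simp [PiLp.inner_apply]
  rw [h1, EuclideanSpace.norm_sq_eq, gradSq]
  simp [h2]

lemma gradSq_nonneg (u : E 3 → ℝ) (x : E 3) : 0 ≤ gradSq u x :=
  Finset.sum_nonneg fun _ _ => sq_nonneg _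

lemma pd_sq_le_gradSq (u : E 3 → ℝ) (i : Fin 3) (x : E 3) : pd i u x ^ 2 ≤ gradSq u x :=
  Finset.single_le_sum (f := fun i => pd i u x ^ 2) (fun _ _ => sq_nonneg _) (Finset.mem_univ i)

lemma continuous_gradSq {u : E 3 → ℝ} (hu : ContDiff ℝ 1 u) : Continuous (gradSq u) :=
  continuous_finsetSum _ fun i _ => (continuous_pd i hu).pow 2

lemma norm_sq_eq_sum (x : E 3) : ‖x‖ ^ 2 = ∑ i, x i ^ 2 := by
  rw [EuclideanSpace.norm_sq_eq]; simp

lemma pd_norm_sq (i : Fin 3) (x : E 3) : pd i (fun y : E 3 => ‖y‖ ^ 2) x = 2 * x i := by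
  have : (fun y : E 3 => ‖y‖ ^ 2) = fun y : E 3 => ∑ j, y j ^ 2 := funext norm_sq_eq_sum
  have hd : ∀ j, DifferentiableAt ℝ (fun y : E 3 => y j) x := fun j =>
    (contDiff_coord j (n := 1)).differentiable (by norm_num) x
  rw [this, pd_sum (f := fun j (y : E 3) => y j ^ 2) i fun j _ => (hd j).pow 2]
  have : ∀ j, pd i (fun y : E 3 => y j ^ 2) x = 2 * x j * (if i = j then 1 else 0) := by
    intro j
    rw [← pd_coord i j x]
    refine pd_comp (φ := fun t => t ^ 2) i ?_ (hd j)
    simpa using hasDerivAt_pow 2 (x j)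
  simp [this]

/-- The integral of a partial derivative of a compactly supported function vanishes. -/
lemma integral_pd_eq_zero {φ : E 3 → ℝ} (hφ : ContDiff ℝ 1 φ) (hc : HasCompactSupport φ)
    (i : Fin 3) : ∫ x, pd i φ x = 0 := by
  have h := integral_mul_fderiv_eq_neg_fderiv_mul_of_integrable (μ := (volume : Measure (E 3)))
    (f := fun _ : E 3 => (1 : ℝ)) (g := φ) (v := EuclideanSpace.single i 1)
    (by simp) (by
      simp only [one_mul]
      exact (continuous_pd i hφ).integrable_of_hasCompactSupport (hasCompactSupport_pd i hc)) (by
      simpa using hφ.continuous.integrable_of_hasCompactSupport hc)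
    (by simp) (fun x _ => hφ.differentiable (by norm_num) x)
  simpa [pd] using h

/-- Integration by parts for a product one factor of which has compact support. -/
lemma integral_pd_mul {φ ψ : E 3 → ℝ} (hφ : ContDiff ℝ 1 φ) (hψ : ContDiff ℝ 1 ψ)
    (hc : HasCompactSupport φ) (i : Fin 3) :
    ∫ x, pd i φ x * ψ x = -∫ x, φ x * pd i ψ x := by
  have h := integral_pd_eq_zero (hφ.mul hψ) (hc.mul_right (f' := ψ)) i
  have e : ∀ x, pd i (fun y => φ y * ψ y) x = pd i φ x * ψ x + φ x * pd i ψ x := fun x =>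
    pd_mul i (hφ.differentiable (by norm_num) x) (hψ.differentiable (by norm_num) x)
  simp only [e] at h
  rw [integral_add] at h
  · linarith
  · exact ((continuous_pd i hφ).mul hψ.continuous).integrable_of_hasCompactSupport
      ((hasCompactSupport_pd i hc).mul_right)
  · exact (hφ.continuous.mul (continuous_pd i hψ)).integrable_of_hasCompactSupport hc.mul_right

/-- The average of `F` around `x` at scale `t` with weight `κ`. -/
def avg (κ : E 3 → ℝ) (t : ℝ) (F : E 3 → ℝ) (x : E 3) : ℝ := ∫ y, κ y * F (x - t • y)

lemma cauchy_schwarz_integral {α : Type*} [MeasurableSpace α] {μ : Measure α} {a b : α → ℝ}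
    (ha : Integrable (fun x => a x ^ 2) μ) (hb : Integrable (fun x => b x ^ 2) μ)
    (hab : Integrable (fun x => a x * b x) μ) :
    (∫ x, a x * b x ∂μ) ^ 2 ≤ (∫ x, a x ^ 2 ∂μ) * ∫ x, b x ^ 2 ∂μ := by
  have key : ∀ t : ℝ, 0 ≤ (∫ x, b x ^ 2 ∂μ) * (t * t) + (2 * ∫ x, a x * b x ∂μ) * t
      + ∫ x, a x ^ 2 ∂μ := by
    intro t
    have h : 0 ≤ ∫ x, (a x + t * b x) ^ 2 ∂μ := integral_nonneg fun x => sq_nonneg _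
    have e : (fun x => (a x + t * b x) ^ 2)
        = fun x => a x ^ 2 + ((2 * t) * (a x * b x) + t ^ 2 * b x ^ 2) := by
      ext x; ring
    have h1 : Integrable (fun x => (2 * t) * (a x * b x) + t ^ 2 * b x ^ 2) μ :=
      (hab.const_mul _).add (hb.const_mul _)
    rw [e, integral_add ha h1,
      integral_add (hab.const_mul _) (hb.const_mul _), integral_const_mul,
      integral_const_mul] at h
    linarith
  have := discrim_le_zero key
  rw [discrim] at this
  linarith

section avg

variable {κ F : E 3 → ℝ} {t : ℝ} {x : E 3}

lemma integrable_avg (hκ : Continuous κ) (hc : HasCompactSupport κ) (hF : Continuous F)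
    (t : ℝ) (x : E 3) : Integrable (fun y => κ y * F (x - t • y)) :=
  (hκ.mul (hF.comp (by fun_prop))).integrable_of_hasCompactSupport hc.mul_right

lemma avg_add {G : E 3 → ℝ} (hκ : Continuous κ) (hc : HasCompactSupport κ) (hF : Continuous F)
    (hG : Continuous G) :
    avg κ t (fun y => F y + G y) x = avg κ t F x + avg κ t G x := by
  simp only [avg, mul_add]
  exact integral_add (integrable_avg hκ hc hF t x) (integrable_avg hκ hc hG t x)

lemma avg_sum {ι : Type*} (s : Finset ι) {G : ι → E 3 → ℝ} (hκ : Continuous κ)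
    (hc : HasCompactSupport κ) (hG : ∀ j ∈ s, Continuous (G j)) :
    avg κ t (fun y => ∑ j ∈ s, G j y) x = ∑ j ∈ s, avg κ t (G j) x := by
  simp only [avg, Finset.mul_sum]
  exact integral_finsetSum s fun j hj => integrable_avg hκ hc (hG j hj) t x

lemma avg_const_mul (c : ℝ) : avg κ t (fun y => c * F y) x = c * avg κ t F x := by
  simp only [avg, ← integral_const_mul]
  congr 1; ext y; ring

lemma avg_const (c : ℝ) : avg κ t (fun _ => c) x = (∫ y, κ y) * c := by
  simp only [avg, integral_mul_const]

lemma avg_mono {G : E 3 → ℝ} (hκ : Continuous κ) (hc : HasCompactSupport κ)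
    (h0 : ∀ y, 0 ≤ κ y) (hκ1 : ∀ y, 1 < ‖y‖ → κ y = 0) (ht : 0 ≤ t) (hF : Continuous F)
    (hG : Continuous G) (h : ∀ z ∈ closedBall x t, F z ≤ G z) : avg κ t F x ≤ avg κ t G x := by
  refine integral_mono (integrable_avg hκ hc hF t x) (integrable_avg hκ hc hG t x) fun y => ?_
  by_cases hy : 1 < ‖y‖
  · simp [hκ1 y hy]
  · refine mul_le_mul_of_nonneg_left (h _ ?_) (h0 y)
    rw [mem_closedBall, dist_eq_norm, sub_sub_cancel_left, norm_neg, norm_smul, Real.norm_eq_abs,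
      abs_of_nonneg ht]
    nlinarith

lemma abs_avg_le {S : ℝ} (hκ : Continuous κ) (hc : HasCompactSupport κ)
    (hκ1 : ∀ y, 1 < ‖y‖ → κ y = 0) (ht : 0 ≤ t)
    (h : ∀ z ∈ closedBall x t, |F z| ≤ S) : |avg κ t F x| ≤ (∫ y, |κ y|) * S := by
  rw [← integral_mul_const, avg, ← Real.norm_eq_abs]
  refine norm_integral_le_of_norm_le ((hκ.abs.integrable_of_hasCompactSupport
    (hc.comp_left abs_zero)).mul_const S) (Eventually.of_forall fun y => ?_)
  rw [Real.norm_eq_abs, abs_mul]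
  by_cases hy : 1 < ‖y‖
  · simp [hκ1 y hy]
  · refine mul_le_mul_of_nonneg_left (h _ ?_) (abs_nonneg _)
    rw [mem_closedBall, dist_eq_norm, sub_sub_cancel_left, norm_neg, norm_smul, Real.norm_eq_abs,
      abs_of_nonneg ht]
    nlinarith

/-- Rescaling a ball to the unit ball. -/
lemma setIntegral_closedBall_rescale (G : E 3 → ℝ) (ht : 0 < t) (x : E 3) :
    ∫ y in closedBall (0 : E 3) 1, G (x - t • y) = (t ^ 3)⁻¹ * ∫ z in closedBall x t, G z := by
  rw [← integral_indicator measurableSet_closedBall, ← integral_indicator measurableSet_closedBall]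
  have e1 : (closedBall (0 : E 3) 1).indicator (fun y => G (x - t • y))
      = fun y => (fun z => (closedBall x t).indicator G (x - z)) (t • y) := by
    ext y
    have : y ∈ closedBall (0 : E 3) 1 ↔ x - t • y ∈ closedBall x t := by
      rw [mem_closedBall, mem_closedBall, dist_zero_right, dist_eq_norm, sub_sub_cancel_left,
        norm_neg, norm_smul, Real.norm_eq_abs, abs_of_pos ht]
      constructor
      · intro h; nlinarith
      · intro h; nlinarith
    by_cases hy : y ∈ closedBall (0 : E 3) 1
    · rw [indicator_of_mem hy]
      exact (indicator_of_mem (this.1 hy) G).symm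
    · rw [indicator_of_notMem hy]
      exact (indicator_of_notMem (fun h => hy (this.2 h)) G).symm
  rw [e1, Measure.integral_comp_smul_of_nonneg volume (fun z => (closedBall x t).indicator G (x - z))
    t (hR := ht.le), integral_sub_left_eq_self (fun z => (closedBall x t).indicator G z)]
  simp

lemma avg_sq_le_unit (hκ : Continuous κ) (hκ1 : ∀ y, 1 < ‖y‖ → κ y = 0)
    (hF : Continuous F) (t : ℝ) (x : E 3) :
    avg κ t F x ^ 2 ≤ (∫ y, κ y ^ 2) * ∫ y in closedBall (0 : E 3) 1, F (x - t • y) ^ 2 := by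
  have hcF : Continuous fun y : E 3 => F (x - t • y) := hF.comp (by fun_prop)
  have hcK : IsCompact (closedBall (0 : E 3) 1) := isCompact_closedBall 0 1
  have e : avg κ t F x = ∫ y in closedBall (0 : E 3) 1, κ y * F (x - t • y) := by
    rw [avg, setIntegral_eq_integral_of_forall_compl_eq_zero]
    intro y hy
    rw [hκ1 y (by simpa using hy), zero_mul]
  have e2 : ∫ y, κ y ^ 2 = ∫ y in closedBall (0 : E 3) 1, κ y ^ 2 := by
    rw [setIntegral_eq_integral_of_forall_compl_eq_zero]
    intro y hy
    rw [hκ1 y (by simpa using hy)]; norm_num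
  rw [e, e2]
  exact cauchy_schwarz_integral ((hκ.pow 2).continuousOn.integrableOn_compact hcK)
    ((hcF.pow 2).continuousOn.integrableOn_compact hcK)
    ((hκ.mul hcF).continuousOn.integrableOn_compact hcK)

lemma avg_sq_le (hκ : Continuous κ)
    (hκ1 : ∀ y, 1 < ‖y‖ → κ y = 0) (hF : Continuous F) (ht : 0 < t) (x : E 3) :
    avg κ t F x ^ 2 ≤ (∫ y, κ y ^ 2) * ((t ^ 3)⁻¹ * ∫ z in closedBall x t, F z ^ 2) := by
  rw [← setIntegral_closedBall_rescale (fun z => F z ^ 2) ht x]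
  exact avg_sq_le_unit hκ hκ1 hF t x

lemma exists_abs_le_of_hasCompactSupport {F : E 3 → ℝ} (hF : Continuous F)
    (hc : HasCompactSupport F) : ∃ C, 0 ≤ C ∧ ∀ x, |F x| ≤ C := by
  obtain ⟨C, hC⟩ := hc.exists_bound_of_continuous hF
  exact ⟨C, (norm_nonneg _).trans (hC 0), hC⟩

/-- Differentiating an average with respect to the scale. -/
lemma hasDerivAt_avg (hκ : Continuous κ) (hc : HasCompactSupport κ) (hF : ContDiff ℝ 1 F)
    (hcF : HasCompactSupport F) (t : ℝ) (x : E 3) :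
    HasDerivAt (fun t => avg κ t F x) (-∑ i, avg (fun y => y i * κ y) t (pd i F) x) t := by
  choose C hC0 hC using fun i =>
    exists_abs_le_of_hasCompactSupport (continuous_pd i hF) (hasCompactSupport_pd i hcF)
  have hci : ∀ i, Continuous fun y : E 3 => y i * κ y := fun i =>
    (contDiff_coord i (n := 0)).continuous.mul hκ
  have hsi : ∀ i : Fin 3, HasCompactSupport fun y : E 3 => y i * κ y := fun i => hc.mul_left
  have h := hasDerivAt_integral_of_dominated_loc_of_deriv_le (μ := (volume : Measure (E 3)))
    (F := fun t y => κ y * F (x - t • y))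
    (F' := fun t y => -∑ i, (y i * κ y) * pd i F (x - t • y)) (x₀ := t) (s := univ)
    (bound := fun y => ∑ i, |y i * κ y| * C i) univ_mem
    (Eventually.of_forall fun s => (integrable_avg hκ hc hF.continuous s x).aestronglyMeasurable)
    (integrable_avg hκ hc hF.continuous t x)
    (integrable_finsetSum _ fun i _ =>
      integrable_avg (hci i) (hsi i) (continuous_pd i hF) t x).neg.aestronglyMeasurable
    (Eventually.of_forall fun y s _ => by
      rw [norm_neg]
      refine (norm_sum_le _ _).trans (Finset.sum_le_sum fun i _ => ?_)
      rw [Real.norm_eq_abs, abs_mul]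
      exact mul_le_mul_of_nonneg_left (hC i _) (abs_nonneg _))
    (integrable_finsetSum _ fun i _ => ((hci i).abs.integrable_of_hasCompactSupport
      ((hsi i).comp_left abs_zero)).mul_const _)
    (Eventually.of_forall fun y s _ => by
      have h1 : HasDerivAt (fun t : ℝ => x - t • y) (-y) s := by
        simpa using ((hasDerivAt_id s).smul_const y).const_sub x
      have h2 := ((hF.differentiable (by norm_num) (x - s • y)).hasFDerivAt.comp_hasDerivAt s
        h1).const_mul (κ y)
      refine h2.congr_deriv ?_
      rw [fderiv_apply_eq_sum, Finset.mul_sum, ← Finset.sum_neg_distrib]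
      refine Finset.sum_congr rfl fun i _ => ?_
      simp; ring)
  refine h.2.congr_deriv ?_
  rw [integral_neg, integral_finsetSum _ fun i _ =>
    integrable_avg (hci i) (hsi i) (continuous_pd i hF) t x]
  rfl

/-- Integration by parts inside an average. -/
lemma avg_pd_left (hκ : ContDiff ℝ 1 κ) (hc : HasCompactSupport κ) (hF : ContDiff ℝ 1 F)
    (i : Fin 3) (t : ℝ) (x : E 3) : avg (pd i κ) t F x = t * avg κ t (pd i F) x := by
  have e : (fun y : E 3 => F (x - t • y)) = fun y => F (x + (-t) • y) := by
    ext y; rw [neg_smul, sub_eq_add_neg]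
  have hc2 : ContDiff ℝ 1 fun y : E 3 => F (x + (-t) • y) := hF.comp (by fun_prop)
  have h := integral_pd_mul hκ hc2 hc i
  simp only [avg]
  have e' : ∀ y, F (x - t • y) = F (x + (-t) • y) := fun y => congrFun e y
  have e'' : ∀ y, pd i F (x - t • y) = pd i F (x + (-t) • y) := fun y => by
    rw [neg_smul, sub_eq_add_neg]
  simp only [e', e'']
  rw [h, ← integral_neg, ← integral_const_mul]
  congr 1; ext y
  rw [pd_comp_affine i (-t) x y (hF.differentiable (by norm_num) _)]
  ring

lemma avg_eq_convolution (ht : 0 < t) (κ F : E 3 → ℝ) :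
    avg κ t F = convolution F (fun z => (t ^ 3)⁻¹ * κ (t⁻¹ • z)) (ContinuousLinearMap.mul ℝ ℝ) := by
  ext x
  rw [convolution_def]
  have e : ∀ z : E 3, (ContinuousLinearMap.mul ℝ ℝ) (F z) ((t ^ 3)⁻¹ * κ (t⁻¹ • (x - z)))
      = (fun w => F (x - w) * ((t ^ 3)⁻¹ * κ (t⁻¹ • w))) (x - z) := by
    intro z; simp
  simp only [e]
  rw [integral_sub_left_eq_self (fun w => F (x - w) * ((t ^ 3)⁻¹ * κ (t⁻¹ • w)))]
  have e2 : (fun w => F (x - w) * ((t ^ 3)⁻¹ * κ (t⁻¹ • w)))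
      = fun w => (fun y => (t ^ 3)⁻¹ * (κ y * F (x - t • y))) (t⁻¹ • w) := by
    ext w
    simp only [smul_smul, mul_inv_cancel₀ ht.ne', one_smul]; ring
  rw [e2, Measure.integral_comp_inv_smul_of_nonneg volume
    (fun y => (t ^ 3)⁻¹ * (κ y * F (x - t • y))) (hR := ht.le), integral_const_mul]
  simp only [finrank_euclideanSpace, Fintype.card_fin, smul_eq_mul, avg]
  field_simp

lemma hasCompactSupport_rescale (hc : HasCompactSupport κ) (ht : 0 < t) (c : ℝ) :
    HasCompactSupport fun z => c * κ (t⁻¹ • z) :=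
  (hc.comp_homeomorph (Homeomorph.smulOfNeZero t⁻¹ (inv_ne_zero ht.ne'))).mul_left

lemma contDiff_avg {n : ℕ∞} (hκ : ContDiff ℝ n κ) (hc : HasCompactSupport κ) (hF : Continuous F)
    (ht : 0 < t) : ContDiff ℝ n (avg κ t F) := by
  rw [avg_eq_convolution ht]
  exact (hasCompactSupport_rescale hc ht _).contDiff_convolution_right _ hF.locallyIntegrable
    (contDiff_const.mul (hκ.comp (by fun_prop)))

/-- Partial derivatives of an average fall on the weight. -/
lemma pd_avg (hκ : ContDiff ℝ 1 κ) (hc : HasCompactSupport κ) (hF : Continuous F)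
    (ht : 0 < t) (i : Fin 3) (x : E 3) : pd i (avg κ t F) x = t⁻¹ * avg (pd i κ) t F x := by
  have hd : ContDiff ℝ 1 fun z : E 3 => (t ^ 3)⁻¹ * κ (t⁻¹ • z) :=
    contDiff_const.mul (hκ.comp (by fun_prop))
  have hcs := hasCompactSupport_rescale hc ht (t ^ 3)⁻¹
  have h := hcs.hasFDerivAt_convolution_right
    (ContinuousLinearMap.mul ℝ ℝ) (μ := volume) hF.locallyIntegrable hd x
  rw [avg_eq_convolution ht, pd, h.fderiv, convolution_precompR_apply _ hF.locallyIntegrable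
    (hcs.fderiv ℝ) (hd.continuous_fderiv (by norm_num)), avg_eq_convolution ht, ← smul_eq_mul,
    ← Pi.smul_apply, ← convolution_smul]
  congr 1
  ext z
  have h1 := pd_comp_affine i t⁻¹ 0 z (hκ.differentiable (by norm_num) (0 + t⁻¹ • z))
  simp only [zero_add] at h1
  have h2 := pd_const_mul i (t ^ 3)⁻¹ (f := fun z : E 3 => κ (t⁻¹ • z)) (x := z)
    ((hκ.comp (by fun_prop : ContDiff ℝ 1 fun z : E 3 => t⁻¹ • z)).differentiable (by norm_num) z)
  rw [h1] at h2
  change pd i _ z = _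
  rw [h2]
  simp; ring

lemma pd_avg_right (hκ : ContDiff ℝ 1 κ) (hc : HasCompactSupport κ) (hF : ContDiff ℝ 1 F)
    (ht : 0 < t) (i : Fin 3) (x : E 3) : pd i (avg κ t F) x = avg κ t (pd i F) x := by
  rw [pd_avg hκ hc hF.continuous ht, avg_pd_left hκ hc hF, inv_mul_cancel_left₀ ht.ne']

lemma lap_avg (hκ : ContDiff ℝ 2 κ) (hc : HasCompactSupport κ) (hF : ContDiff ℝ 2 F)
    (ht : 0 < t) (x : E 3) : lap (avg κ t F) x = avg κ t (lap F) x := by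
  have hκ1 : ContDiff ℝ 1 κ := hκ.of_le (by norm_num)
  rw [lap_eq (contDiff_avg (n := 2) hκ hc hF.continuous ht),
    show lap F = fun x => ∑ i, pd i (pd i F) x from funext (lap_eq hF),
    avg_sum _ hκ.continuous hc fun i _ => continuous_pd i (contDiff_one_pd i hF)]
  refine Finset.sum_congr rfl fun i _ => ?_
  rw [show pd i (avg κ t F) = avg κ t (pd i F) from
    funext (pd_avg_right hκ1 hc (hF.of_le (by norm_num)) ht i),
    pd_avg_right hκ1 hc (contDiff_one_pd i hF) ht]

end avg

/-- The radial profile from which the averaging kernels are built. -/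
def profile (t : ℝ) : ℝ := expNegInvGlue (1 - t)

lemma contDiff_profile {n : ℕ∞} : ContDiff ℝ n profile :=
  expNegInvGlue.contDiff.comp (contDiff_const.sub contDiff_id)

lemma profile_eq_zero {t : ℝ} (ht : 1 ≤ t) : profile t = 0 :=
  expNegInvGlue.zero_of_nonpos (by linarith)

lemma deriv_profile_nonpos (t : ℝ) : deriv profile t ≤ 0 := by
  have h : Antitone profile := fun a b hab => by
    unfold profile
    rcases le_or_gt (1 - b) 0 with h | h
    · rw [expNegInvGlue.zero_of_nonpos h]; exact expNegInvGlue.nonneg _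
    · have h' : 0 < 1 - a := by linarith
      simp only [expNegInvGlue, not_le.2 h, not_le.2 h', if_false]
      refine Real.exp_le_exp.2 (neg_le_neg ?_)
      exact inv_anti₀ h (by linarith)
  exact h.deriv_nonpos

lemma deriv_profile_eq_zero {t : ℝ} (ht : 1 < t) : deriv profile t = 0 := by
  have : profile =ᶠ[nhds t] fun _ => (0 : ℝ) := by
    filter_upwards [lt_mem_nhds ht] with s hs using profile_eq_zero hs.le
  rw [this.deriv_eq]; simp

lemma exists_deriv_profile_neg : ∃ t, 0 < t ∧ deriv profile t < 0 := by
  have hd : Differentiable ℝ profile := (contDiff_profile (n := 1)).differentiable (by norm_num)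
  obtain ⟨t, ht, h⟩ := exists_deriv_eq_slope profile zero_lt_one hd.continuous.continuousOn
    hd.differentiableOn
  refine ⟨t, ht.1, ?_⟩
  rw [h, profile_eq_zero le_rfl]
  have : 0 < profile 0 := expNegInvGlue.pos_of_pos (by norm_num)
  norm_num [this]

/-- A smooth probability kernel `k` on the unit ball together with a potential `q` with
`∇q = - y k`. -/
lemma exists_kernel : ∃ k q : E 3 → ℝ, ContDiff ℝ 3 k ∧ ContDiff ℝ 3 q ∧ (∀ y, 0 ≤ k y) ∧
    (∀ y, 0 ≤ q y) ∧ (∀ y, 1 < ‖y‖ → k y = 0) ∧ (∀ y, 1 < ‖y‖ → q y = 0) ∧ ∫ y, k y = 1 ∧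
    ∀ i y, pd i q y = -(y i * k y) := by
  have hsm : ContDiff ℝ 3 fun y : E 3 => ‖y‖ ^ 2 := contDiff_norm_sq ℝ
  have hp4 : ContDiff ℝ 4 profile := contDiff_profile (n := 4)
  have hdp : ContDiff ℝ 3 (deriv profile) :=
    ((contDiff_succ_iff_deriv (n := 3)).1 (by exact_mod_cast hp4)).2.2
  have hk0 : ContDiff ℝ 3 fun y : E 3 => -2 * deriv profile (‖y‖ ^ 2) :=
    contDiff_const.mul (hdp.comp hsm)
  have hq0 : ContDiff ℝ 3 fun y : E 3 => profile (‖y‖ ^ 2) :=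
    (hp4.of_le (by norm_num)).comp hsm
  have hk1 : ∀ y : E 3, 1 < ‖y‖ → -2 * deriv profile (‖y‖ ^ 2) = 0 := fun y hy => by
    rw [deriv_profile_eq_zero (by nlinarith), mul_zero]
  have hcs : HasCompactSupport fun y : E 3 => -2 * deriv profile (‖y‖ ^ 2) :=
    HasCompactSupport.intro (isCompact_closedBall (0 : E 3) 1) fun y hy => hk1 y (by simpa using hy)
  have hpos : 0 < ∫ y : E 3, -2 * deriv profile (‖y‖ ^ 2) := by
    obtain ⟨t, ht, htn⟩ := exists_deriv_profile_neg
    refine hk0.continuous.integral_pos_of_hasCompactSupport_nonneg_nonzero hcs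
      (fun y => by have := deriv_profile_nonpos (‖y‖ ^ 2); simp only [Pi.zero_apply]; linarith)
      (x := EuclideanSpace.single 0 (Real.sqrt t)) ?_
    rw [show ‖EuclideanSpace.single (0 : Fin 3) (Real.sqrt t)‖ = ‖Real.sqrt t‖ from
      PiLp.norm_single 2 (fun _ => ℝ) 0 _, Real.norm_eq_abs, sq_abs, Real.sq_sqrt ht.le]
    linarith
  set I := ∫ y : E 3, -2 * deriv profile (‖y‖ ^ 2) with hI
  refine ⟨fun y => I⁻¹ * (-2 * deriv profile (‖y‖ ^ 2)), fun y => I⁻¹ * profile (‖y‖ ^ 2),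
    contDiff_const.mul hk0, contDiff_const.mul hq0, fun y => ?_, fun y => ?_, fun y hy => ?_,
    fun y hy => ?_, ?_, fun i y => ?_⟩
  · have := deriv_profile_nonpos (‖y‖ ^ 2)
    exact mul_nonneg (inv_nonneg.2 hpos.le) (by linarith)
  · exact mul_nonneg (inv_nonneg.2 hpos.le) (expNegInvGlue.nonneg _)
  · simp only [hk1 y hy, mul_zero]
  · simp only [profile_eq_zero (by nlinarith : (1 : ℝ) ≤ ‖y‖ ^ 2), mul_zero]
  · rw [integral_const_mul, ← hI, inv_mul_cancel₀ hpos.ne']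
  · have hd : Differentiable ℝ profile := hp4.differentiable (by norm_num)
    rw [pd_const_mul i _ (hq0.differentiable (by norm_num) y),
      pd_comp (f := fun y : E 3 => ‖y‖ ^ 2) i (hd (‖y‖ ^ 2)).hasDerivAt (hsm.differentiable (by norm_num) y), pd_norm_sq]
    ring

/-- The averaging kernel. -/
def kerK : E 3 → ℝ := exists_kernel.choose

/-- The potential of the averaging kernel. -/
def kerQ : E 3 → ℝ := exists_kernel.choose_spec.choose

lemma contDiff_kerK : ContDiff ℝ 3 kerK := exists_kernel.choose_spec.choose_spec.1

lemma contDiff_kerQ : ContDiff ℝ 3 kerQ := exists_kernel.choose_spec.choose_spec.2.1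

lemma kerK_nonneg (y : E 3) : 0 ≤ kerK y := exists_kernel.choose_spec.choose_spec.2.2.1 y

lemma kerQ_nonneg (y : E 3) : 0 ≤ kerQ y := exists_kernel.choose_spec.choose_spec.2.2.2.1 y

lemma kerK_eq_zero (y : E 3) (hy : 1 < ‖y‖) : kerK y = 0 :=
  exists_kernel.choose_spec.choose_spec.2.2.2.2.1 y hy

lemma kerQ_eq_zero (y : E 3) (hy : 1 < ‖y‖) : kerQ y = 0 :=
  exists_kernel.choose_spec.choose_spec.2.2.2.2.2.1 y hy

lemma integral_kerK : ∫ y, kerK y = 1 := exists_kernel.choose_spec.choose_spec.2.2.2.2.2.2.1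

lemma pd_kerQ (i : Fin 3) (y : E 3) : pd i kerQ y = -(y i * kerK y) :=
  exists_kernel.choose_spec.choose_spec.2.2.2.2.2.2.2 i y

lemma hasCompactSupport_of_unit {κ : E 3 → ℝ} (h : ∀ y, 1 < ‖y‖ → κ y = 0) : HasCompactSupport κ :=
  HasCompactSupport.intro (isCompact_closedBall (0 : E 3) 1) fun y hy => h y (by simpa using hy)

lemma pd_eq_zero_of_unit {κ : E 3 → ℝ} (h : ∀ y, 1 < ‖y‖ → κ y = 0) (i : Fin 3) (y : E 3)
    (hy : 1 < ‖y‖) : pd i κ y = 0 := by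
  have : κ =ᶠ[nhds y] fun _ => (0 : ℝ) := by
    filter_upwards [(continuous_norm (E := E 3)).continuousAt.eventually (lt_mem_nhds hy)] with z hz
    exact h z hz
  rw [pd, this.fderiv_eq]; simp

lemma hasCompactSupport_kerK : HasCompactSupport kerK := hasCompactSupport_of_unit kerK_eq_zero

lemma hasCompactSupport_kerQ : HasCompactSupport kerQ := hasCompactSupport_of_unit kerQ_eq_zero

lemma avg_kerK_zero (F : E 3 → ℝ) (x : E 3) : avg kerK 0 F x = F x := by
  simp [avg, integral_mul_const, integral_kerK]

/-- The heat-type identity for averages. -/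
lemma hasDerivAt_avg_kerK {v : E 3 → ℝ} (hv : ContDiff ℝ 2 v) (hc : HasCompactSupport v) (t : ℝ)
    (x : E 3) : HasDerivAt (fun t => avg kerK t v x) (t * avg kerQ t (lap v) x) t := by
  refine (hasDerivAt_avg contDiff_kerK.continuous hasCompactSupport_kerK (hv.of_le (by norm_num))
    hc t x).congr_deriv ?_
  rw [show lap v = fun x => ∑ i, pd i (pd i v) x from funext (lap_eq hv),
    avg_sum _ contDiff_kerQ.continuous hasCompactSupport_kerQ
      fun i _ => continuous_pd i (contDiff_one_pd i hv), Finset.mul_sum, ← Finset.sum_neg_distrib]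
  refine Finset.sum_congr rfl fun i _ => ?_
  rw [← avg_pd_left (contDiff_kerQ.of_le (by norm_num)) hasCompactSupport_kerQ
    (contDiff_one_pd i hv), show pd i kerQ = _ from funext (pd_kerQ i)]
  simp only [avg, neg_mul, integral_neg]

lemma hasDerivAt_avg_kerK_pd {v : E 3 → ℝ} (hv : ContDiff ℝ 2 v) (hc : HasCompactSupport v)
    {t : ℝ} (ht : t ≠ 0) (x : E 3) (j : Fin 3) :
    HasDerivAt (fun t => avg kerK t (pd j v) x) (avg (pd j kerQ) t (lap v) x) t := by
  have hq1 : ∀ i, ContDiff ℝ 1 (pd i kerQ) := fun i =>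
    contDiff_one_pd i (contDiff_kerQ.of_le (by norm_num))
  have hqc : ∀ i, HasCompactSupport (pd i kerQ) := fun i =>
    hasCompactSupport_pd i hasCompactSupport_kerQ
  refine (hasDerivAt_avg contDiff_kerK.continuous hasCompactSupport_kerK (contDiff_one_pd j hv)
    (hasCompactSupport_pd j hc) t x).congr_deriv ?_
  rw [show lap v = fun x => ∑ i, pd i (pd i v) x from funext (lap_eq hv),
    avg_sum _ (hq1 j).continuous (hqc j)
      fun i _ => continuous_pd i (contDiff_one_pd i hv), ← Finset.sum_neg_distrib]
  refine Finset.sum_congr rfl fun i _ => ?_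
  have h1 : -avg (fun y => y i * kerK y) t (pd i (pd j v)) x
      = avg (pd i kerQ) t (pd j (pd i v)) x := by
    rw [show pd i kerQ = _ from funext (pd_kerQ i),
      show pd i (pd j v) = pd j (pd i v) from funext (pd_comm hv i j)]
    simp only [avg, neg_mul, integral_neg]
  rw [h1]
  have h2 := avg_pd_left (hq1 i) (hqc i) (contDiff_one_pd i hv) j t x
  have h3 := avg_pd_left (hq1 j) (hqc j) (contDiff_one_pd i hv) i t x
  rw [show pd j (pd i kerQ) = pd i (pd j kerQ) from
    funext (pd_comm (contDiff_kerQ.of_le (by norm_num)) j i)] at h2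
  exact mul_left_cancel₀ ht (h2.symm.trans h3)

/-- Integrating a differential inequality with an inverse square root singularity. -/
lemma le_add_of_deriv_ge {φ φ' : ℝ → ℝ} {s a b : ℝ} (hs : 0 ≤ s)
    (hφ : ∀ t, HasDerivAt φ (φ' t) t)
    (h : ∀ t, 0 < t → t < s → -(a * t + b / Real.sqrt t) ≤ φ' t) :
    φ 0 ≤ φ s + (a * s ^ 2 / 2 + 2 * b * Real.sqrt s) := by
  have hc : ContinuousOn (fun t => φ t + (a * t ^ 2 / 2 + 2 * b * Real.sqrt t)) (Icc 0 s) := by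
    refine Continuous.continuousOn ?_
    have : Continuous φ := continuous_iff_continuousAt.2 fun t => (hφ t).continuousAt
    fun_prop
  have hm : MonotoneOn (fun t => φ t + (a * t ^ 2 / 2 + 2 * b * Real.sqrt t)) (Icc 0 s) := by
    refine monotoneOn_of_hasDerivWithinAt_nonneg (convex_Icc 0 s) hc
      (f' := fun t => φ' t + (a * (2 * t) / 2 + 2 * b * (1 / (2 * Real.sqrt t)))) ?_ ?_
    · intro t ht
      rw [interior_Icc] at ht
      refine HasDerivAt.hasDerivWithinAt ?_
      refine (hφ t).add (HasDerivAt.add ?_ ((Real.hasDerivAt_sqrt ht.1.ne').const_mul _))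
      simpa using ((hasDerivAt_pow 2 t).const_mul a).div_const 2
    · intro t ht
      rw [interior_Icc] at ht
      have h1 := h t ht.1 ht.2
      have h2 : 2 * b * (1 / (2 * Real.sqrt t)) = b / Real.sqrt t := by
        have := Real.sqrt_pos.2 ht.1
        field_simp
      rw [h2]; linarith
  have := hm (left_mem_Icc.2 hs) (right_mem_Icc.2 hs) hs
  simpa using this

/-- The chemical potential at unit scale. -/
def chem (u : E 3 → ℝ) (x : E 3) : ℝ := lap u x - W' (u x)

lemma continuous_W' : Continuous W' := by unfold W'; fun_prop

lemma continuous_chem {u : E 3 → ℝ} (hu : ContDiff ℝ 2 u) : Continuous (chem u) :=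
  (continuous_lap hu).sub (continuous_W'.comp hu.continuous)

lemma setIntegral_closedBall_mono {G : E 3 → ℝ} (hG : Continuous G) (h0 : ∀ x, 0 ≤ G x)
    {x y : E 3} {r R : ℝ} (h : dist x y + r ≤ R) :
    ∫ z in closedBall x r, G z ≤ ∫ z in closedBall y R, G z := by
  refine setIntegral_mono_set (hG.continuousOn.integrableOn_compact (isCompact_closedBall y R))
    (Eventually.of_forall h0) (LE.le.eventuallyLE ?_)
  exact closedBall_subset_closedBall' (by linarith)

lemma abs_avg_le_of_sq {κ F : E 3 → ℝ} {t D : ℝ} {x : E 3} (hκ : Continuous κ)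
    (hκ1 : ∀ y, 1 < ‖y‖ → κ y = 0) (hF : Continuous F) (ht : 0 < t) (hD : 0 ≤ D)
    (h : ∫ z in closedBall x t, F z ^ 2 ≤ D ^ 2) :
    |avg κ t F x| ≤ Real.sqrt (∫ y, κ y ^ 2) * D / (t * Real.sqrt t) := by
  have h0 : 0 ≤ ∫ y, κ y ^ 2 := integral_nonneg fun _ => sq_nonneg _
  refine abs_le_of_sq_le_sq ?_ (by positivity)
  refine (avg_sq_le hκ hκ1 hF ht x).trans ?_
  rw [div_pow, mul_pow, mul_pow, Real.sq_sqrt h0, Real.sq_sqrt ht.le, mul_div_assoc]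
  refine mul_le_mul_of_nonneg_left ?_ h0
  rw [show t ^ 2 * t = t ^ 3 by ring, div_eq_inv_mul]
  exact mul_le_mul_of_nonneg_left h (by positivity)

lemma isLocalMax_pd_eq_zero {φ : E 3 → ℝ} {x : E 3} (h : IsLocalMax φ x) (i : Fin 3) :
    pd i φ x = 0 := by
  rw [pd, h.fderiv_eq_zero]; rfl

lemma isLocalMax_pd_pd_nonpos {φ : E 3 → ℝ} (hφ : ContDiff ℝ 2 φ) {x : E 3} (h : IsLocalMax φ x)
    (i : Fin 3) : pd i (pd i φ) x ≤ 0 := by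
  set e : E 3 := EuclideanSpace.single i 1 with he
  have hline : ∀ (ψ : E 3 → ℝ), ContDiff ℝ 1 ψ → ∀ t : ℝ,
      HasDerivAt (fun t : ℝ => ψ (x + t • e)) (pd i ψ (x + t • e)) t := by
    intro ψ hψ t
    have h1 : HasDerivAt (fun t : ℝ => x + t • e) e t := by
      simpa using ((hasDerivAt_id t).smul_const e).const_add x
    exact (hψ.differentiable (by norm_num) (x + t • e)).hasFDerivAt.comp_hasDerivAt t h1
  have h1 := hline φ (hφ.of_le (by norm_num))
  have h2 := hline (pd i φ) (contDiff_one_pd i hφ)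
  have hd1 : deriv (fun t : ℝ => φ (x + t • e)) = fun t => pd i φ (x + t • e) :=
    funext fun t => (h1 t).deriv
  have hd2 : deriv (deriv fun t : ℝ => φ (x + t • e)) 0 = pd i (pd i φ) x := by
    rw [hd1, (h2 0).deriv]; simp
  have hct : Tendsto (fun t : ℝ => x + t • e) (nhds 0) (nhds x) := by
    have : Continuous fun t : ℝ => x + t • e := by fun_prop
    simpa using this.tendsto 0
  have hmax : IsLocalMax (fun t : ℝ => φ (x + t • e)) 0 := by
    have := hct.eventually h
    simpa [IsLocalMax, IsMaxFilter] using this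
  by_contra hpos
  rw [not_le, ← hd2] at hpos
  have hmin : IsLocalMin (fun t : ℝ => φ (x + t • e)) 0 := by
    refine isLocalMin_of_deriv_deriv_pos hpos hmax.deriv_eq_zero (h1 0).continuousAt
  have hconst : (fun t : ℝ => φ (x + t • e)) =ᶠ[nhds 0] fun _ => φ (x + (0 : ℝ) • e) := by
    filter_upwards [hmax, hmin] with t a b using le_antisymm a b
  have : deriv (deriv fun t : ℝ => φ (x + t • e)) 0 = 0 := by
    rw [hconst.deriv.deriv_eq]; simp
  linarith

/-- A maximum principle on balls phrased through the first and second derivative tests. -/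
lemma le_of_interior_test {φ : E 3 → ℝ} (hφ : ContDiff ℝ 2 φ) {x₀ : E 3} {L B : ℝ}
    (hs : ∀ x, dist x x₀ = L → φ x ≤ B)
    (hi : ∀ x, dist x x₀ < L → (∀ i, pd i φ x = 0) → lap φ x ≤ 0 → φ x ≤ B) :
    ∀ x ∈ closedBall x₀ L, φ x ≤ B := by
  intro y hy
  obtain ⟨x, hx, hmax⟩ := (isCompact_closedBall x₀ L).exists_isMaxOn ⟨y, hy⟩
    hφ.continuous.continuousOn
  refine (hmax hy).trans ?_
  rcases (mem_closedBall.1 hx).lt_or_eq with h | h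
  · have hloc : IsLocalMax φ x := hmax.isLocalMax (closedBall_mem_nhds_of_mem h)
    refine hi x h (isLocalMax_pd_eq_zero hloc) ?_
    rw [lap_eq hφ]
    exact Finset.sum_nonpos fun i _ => isLocalMax_pd_pd_nonpos hφ hloc i
  · exact hs x h

lemma pd_comp_eq {φ φ' : ℝ → ℝ} (hφ : ∀ t, HasDerivAt φ (φ' t) t) {u : E 3 → ℝ}
    (hu : ContDiff ℝ 1 u) (i : Fin 3) (x : E 3) :
    pd i (fun y => φ (u y)) x = φ' (u x) * pd i u x :=
  pd_comp i (hφ (u x)) (hu.differentiable (by norm_num) x)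

lemma lap_comp {φ φ' φ'' : ℝ → ℝ} (hφ : ∀ t, HasDerivAt φ (φ' t) t)
    (hφ' : ∀ t, HasDerivAt φ' (φ'' t) t) (hs : ContDiff ℝ 2 φ) {u : E 3 → ℝ}
    (hu : ContDiff ℝ 2 u) (x : E 3) :
    lap (fun y => φ (u y)) x = φ' (u x) * lap u x + φ'' (u x) * gradSq u x := by
  have hu1 : ContDiff ℝ 1 u := hu.of_le (by norm_num)
  have hd : DifferentiableAt ℝ (fun y => φ' (u y)) x :=
    (hφ' (u x)).differentiableAt.comp x (hu1.differentiable (by norm_num) x)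
  rw [lap_eq (u := fun y => φ (u y)) (hs.comp hu), lap_eq hu, gradSq, Finset.mul_sum, Finset.mul_sum,
    ← Finset.sum_add_distrib]
  refine Finset.sum_congr rfl fun i _ => ?_
  rw [show pd i (fun y => φ (u y)) = fun y => φ' (u y) * pd i u y from
    funext (pd_comp_eq hφ hu1 i), pd_mul i hd ((contDiff_one_pd i hu).differentiable
      (by norm_num) x), pd_comp_eq hφ' hu1]
  ring

lemma pd_norm_sub_sq (x₀ : E 3) (i : Fin 3) (x : E 3) :
    pd i (fun y : E 3 => ‖y - x₀‖ ^ 2) x = 2 * (x i - x₀ i) := by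
  have h := pd_comp_affine (f := fun y : E 3 => ‖y‖ ^ 2) i 1 (-x₀) x
    ((contDiff_norm_sq ℝ (n := 1)).differentiable (by norm_num) _)
  simp only [one_smul, one_mul, pd_norm_sq] at h
  simpa [sub_eq_neg_add] using h

lemma contDiff_norm_sub_sq (x₀ : E 3) {n : WithTop ℕ∞} :
    ContDiff ℝ n fun y : E 3 => ‖y - x₀‖ ^ 2 :=
  (contDiff_norm_sq ℝ).comp (contDiff_id.sub contDiff_const)

lemma pd_pd_norm_sub_sq (x₀ : E 3) (i : Fin 3) (x : E 3) :
    pd i (pd i fun y : E 3 => ‖y - x₀‖ ^ 2) x = 2 := by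
  rw [show (pd i fun y : E 3 => ‖y - x₀‖ ^ 2) = fun x => 2 * (x i - x₀ i) from
    funext (pd_norm_sub_sq x₀ i)]
  have hd : DifferentiableAt ℝ (fun y : E 3 => y i) x :=
    (contDiff_coord i (n := 1)).differentiable (by norm_num) x
  rw [pd_const_mul i _ (hd.fun_sub (differentiableAt_const _)),
    pd_sub i hd (differentiableAt_const _), pd_coord, pd_const]
  simp

lemma lap_norm_sub_sq (x₀ x : E 3) : lap (fun y : E 3 => ‖y - x₀‖ ^ 2) x = 6 := by
  rw [lap_eq (contDiff_norm_sub_sq x₀)]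
  simp only [pd_pd_norm_sub_sq]
  norm_num

lemma lap_mul {f g : E 3 → ℝ} (hf : ContDiff ℝ 2 f) (hg : ContDiff ℝ 2 g) (x : E 3) :
    lap (fun y => f y * g y) x = lap f x * g x + 2 * ∑ i, pd i f x * pd i g x + f x * lap g x := by
  have d : ∀ {h : E 3 → ℝ}, ContDiff ℝ 2 h → Differentiable ℝ h := fun h =>
    h.differentiable (by norm_num)
  have d1 : ∀ {h : E 3 → ℝ}, ContDiff ℝ 2 h → ∀ i, Differentiable ℝ (pd i h) := fun h i =>
    (contDiff_one_pd i h).differentiable (by norm_num)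
  rw [lap_eq (hf.mul hg), lap_eq hf, lap_eq hg, Finset.sum_mul, Finset.mul_sum, Finset.mul_sum,
    ← Finset.sum_add_distrib, ← Finset.sum_add_distrib]
  refine Finset.sum_congr rfl fun i _ => ?_
  rw [show pd i (fun y => f y * g y) = fun y => pd i f y * g y + f y * pd i g y from
    funext fun y => pd_mul i (d hf y) (d hg y),
    pd_add i ((d1 hf i x).fun_mul (d hg x)) ((d hf x).fun_mul (d1 hg i x)),
    pd_mul i (d1 hf i x) (d hg x), pd_mul i (d hf x) (d1 hg i x)]
  ring

lemma lap_sub {f g : E 3 → ℝ} (hf : ContDiff ℝ 2 f) (hg : ContDiff ℝ 2 g) (x : E 3) :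
    lap (fun y => f y - g y) x = lap f x - lap g x := by
  have d : ∀ {h : E 3 → ℝ}, ContDiff ℝ 2 h → Differentiable ℝ h := fun h =>
    h.differentiable (by norm_num)
  have d1 : ∀ {h : E 3 → ℝ}, ContDiff ℝ 2 h → ∀ i, Differentiable ℝ (pd i h) := fun h i =>
    (contDiff_one_pd i h).differentiable (by norm_num)
  rw [lap_eq (hf.sub hg), lap_eq hf, lap_eq hg, ← Finset.sum_sub_distrib]
  refine Finset.sum_congr rfl fun i _ => ?_
  rw [show pd i (fun y => f y - g y) = fun y => pd i f y - pd i g y from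
    funext fun y => pd_sub i (d hf y) (d hg y), pd_sub i (d1 hf i x) (d1 hg i x)]

lemma lap_const_mul {f : E 3 → ℝ} (hf : ContDiff ℝ 2 f) (c : ℝ) (x : E 3) :
    lap (fun y => c * f y) x = c * lap f x := by
  have := lap_mul (f := fun _ => c) contDiff_const hf x
  have h0 : lap (fun _ : E 3 => c) x = 0 := by
    rw [lap_eq contDiff_const]
    refine Finset.sum_eq_zero fun i _ => ?_
    rw [show pd i (fun _ : E 3 => c) = fun _ => 0 from funext (pd_const i c), pd_const]
  simpa [h0, pd_const] using this

lemma lap_const_sub {f : E 3 → ℝ} (hf : ContDiff ℝ 2 f) (c : ℝ) (x : E 3) :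
    lap (fun y => c - f y) x = - lap f x := by
  have h0 : lap (fun _ : E 3 => c) x = 0 := by
    rw [lap_eq contDiff_const]
    refine Finset.sum_eq_zero fun i _ => ?_
    rw [show pd i (fun _ : E 3 => c) = fun _ => 0 from funext (pd_const i c), pd_const]
  rw [lap_sub contDiff_const hf, h0, zero_sub]

/-- A smooth convex substitute for the absolute value. -/
def softAbs (t : ℝ) : ℝ := Real.sqrt (1 + t ^ 2) - 1

lemma one_le_sqrt_one_add_sq (t : ℝ) : 1 ≤ Real.sqrt (1 + t ^ 2) := by
  rw [Real.one_le_sqrt]; nlinarith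

lemma contDiff_softAbs {n : WithTop ℕ∞} : ContDiff ℝ n softAbs :=
  ((contDiff_const.add (contDiff_id.pow 2)).sqrt fun t => by
    simp only [id]; positivity).sub contDiff_const

lemma hasDerivAt_softAbs (t : ℝ) : HasDerivAt softAbs (t / Real.sqrt (1 + t ^ 2)) t := by
  have h : HasDerivAt (fun t : ℝ => 1 + t ^ 2) (2 * t) t := by
    simpa using (hasDerivAt_pow 2 t).const_add 1
  refine ((h.sqrt (by positivity)).sub_const 1).congr_deriv ?_
  have := one_le_sqrt_one_add_sq t
  field_simp

lemma hasDerivAt_deriv_softAbs (t : ℝ) :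
    HasDerivAt (fun t => t / Real.sqrt (1 + t ^ 2)) ((Real.sqrt (1 + t ^ 2) ^ 3)⁻¹) t := by
  have h := hasDerivAt_softAbs t
  have h2 : HasDerivAt (fun t : ℝ => Real.sqrt (1 + t ^ 2)) (t / Real.sqrt (1 + t ^ 2)) t := by
    simpa [softAbs] using h.add_const 1
  have hp := one_le_sqrt_one_add_sq t
  refine ((hasDerivAt_id t).div h2 (by positivity)).congr_deriv ?_
  have hs : Real.sqrt (1 + t ^ 2) ^ 2 = 1 + t ^ 2 := Real.sq_sqrt (by positivity)
  simp only [id]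
  field_simp
  rw [hs]; ring

lemma softAbs_nonneg (t : ℝ) : 0 ≤ softAbs t := sub_nonneg.2 (one_le_sqrt_one_add_sq t)

lemma abs_le_softAbs_add_one (t : ℝ) : |t| ≤ softAbs t + 1 := by
  rw [softAbs, sub_add_cancel]
  exact Real.abs_le_sqrt (by linarith)

lemma lap_softAbs_ge {u : E 3 → ℝ} (hu : ContDiff ℝ 2 u) (x : E 3) :
    softAbs (u x) ^ 3 / 2 - 3 - |chem u x| ≤ lap (fun y => softAbs (u y)) x := by
  rw [lap_comp hasDerivAt_softAbs hasDerivAt_deriv_softAbs contDiff_softAbs hu]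
  set r := Real.sqrt (1 + u x ^ 2) with hr
  have hr1 : 1 ≤ r := one_le_sqrt_one_add_sq _
  have hr2 : r ^ 2 = 1 + u x ^ 2 := Real.sq_sqrt (by positivity)
  have hg := gradSq_nonneg u x
  have hlap : lap u x = chem u x + (u x ^ 3 - u x) := by simp [chem, W']
  have h1 : -|chem u x| ≤ u x / r * chem u x := by
    have : |u x / r * chem u x| ≤ |chem u x| := by
      rw [abs_mul, abs_div, abs_of_pos (by linarith : 0 < r)]
      refine mul_le_of_le_one_left (abs_nonneg _) ?_
      rw [div_le_one (by linarith)]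
      exact Real.abs_le_sqrt (by linarith)
    linarith [neg_abs_le (u x / r * chem u x)]
  have h2 : softAbs (u x) ^ 3 / 2 - 3 ≤ u x / r * (u x ^ 3 - u x) := by
    have e : u x / r * (u x ^ 3 - u x) = (r ^ 2 - 1) * (r ^ 2 - 2) / r := by
      rw [hr2]; ring
    rw [e, le_div_iff₀ (by linarith), softAbs, ← hr]
    have : 0 ≤ r - 1 := by linarith
    have e2 : (r ^ 2 - 1) * (r ^ 2 - 2) - ((r - 1) ^ 3 / 2 - 3) * r
        = (r - 1) ^ 4 / 2 + 7 / 2 * (r - 1) ^ 3 + 3 * (r - 1) ^ 2 + (r - 1) + 3 := by ring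
    have h3 : 0 ≤ (r - 1) ^ 4 / 2 + 7 / 2 * (r - 1) ^ 3 + 3 * (r - 1) ^ 2 + (r - 1) + 3 := by
      positivity
    linarith
  have h3 : 0 ≤ (r ^ 3)⁻¹ * gradSq u x := by positivity
  rw [hlap, mul_add]
  linarith

/-- The constant in the interior bound for the smoothed modulus. -/
def supC : ℝ := 3 + Real.sqrt (∫ y, kerK y ^ 2)

lemma three_le_supC : 3 ≤ supC := by
  have := Real.sqrt_nonneg (∫ y, kerK y ^ 2)
  unfold supC; linarith

lemma lap_avg_softAbs_ge {u : E 3 → ℝ} (hu : ContDiff ℝ 2 u) {x : E 3}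
    (h : ∫ z in closedBall x 1, chem u z ^ 2 ≤ 1) :
    avg kerK 1 (fun y => softAbs (u y)) x ^ 3 / 2 - supC ≤
      lap (avg kerK 1 fun y => softAbs (u y)) x := by
  have hk := contDiff_kerK.continuous
  have hkc := hasCompactSupport_kerK
  set v : E 3 → ℝ := fun y => softAbs (u y) with hv
  have hv2 : ContDiff ℝ 2 v := contDiff_softAbs.comp hu
  have hf := continuous_chem hu
  set z := avg kerK 1 v x with hz
  have hz0 : 0 ≤ z := integral_nonneg fun y => mul_nonneg (kerK_nonneg y) (softAbs_nonneg _)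
  rw [lap_avg (contDiff_kerK.of_le (by norm_num)) hkc hv2 one_pos]
  have h1 : avg kerK 1 (fun y => ((z ^ 3 - 3 * z ^ 2 * z) / 2 - 3) +
      (3 * z ^ 2 / 2 * v y + (-1) * |chem u y|)) x ≤ avg kerK 1 (lap v) x := by
    refine avg_mono hk hkc kerK_nonneg kerK_eq_zero zero_le_one ?_ (continuous_lap hv2) ?_
    · exact continuous_const.add ((continuous_const.mul hv2.continuous).add
        (continuous_const.mul hf.abs))
    · intro y _
      refine le_trans ?_ (lap_softAbs_ge hu y)
      have hvy : 0 ≤ softAbs (u y) := softAbs_nonneg _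
      simp only [hv]
      nlinarith [mul_nonneg (sq_nonneg (softAbs (u y) - z)) (by linarith : 0 ≤ softAbs (u y) + 2 * z)]
  have hc1 : Continuous fun y => 3 * z ^ 2 / 2 * v y := continuous_const.mul hv2.continuous
  have hc2 : Continuous fun y => (-1) * |chem u y| := continuous_const.mul hf.abs
  rw [avg_add hk hkc continuous_const (hc1.fun_add hc2), avg_const, integral_kerK,
        avg_add hk hkc hc1 hc2, avg_const_mul,
        avg_const_mul, ← hz] at h1
  have h2 : |avg kerK 1 (fun y => |chem u y|) x| ≤ Real.sqrt (∫ y, kerK y ^ 2) := by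
    have := abs_avg_le_of_sq (D := 1) hk kerK_eq_zero hf.abs one_pos zero_le_one
      (by simpa [sq_abs] using h)
    simpa using this
  have h3 := le_abs_self (avg kerK 1 (fun y => |chem u y|) x)
  unfold supC
  nlinarith

lemma avg_softAbs_le {u : E 3 → ℝ} (hu : ContDiff ℝ 2 u) {x₀ : E 3}
    (h : ∫ z in closedBall x₀ 2, chem u z ^ 2 ≤ 1) :
    avg kerK 1 (fun y => softAbs (u y)) x₀ ≤ 5 + supC := by
  have hk := contDiff_kerK
  have hkc := hasCompactSupport_kerK
  set v : E 3 → ℝ := fun y => softAbs (u y) with hv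
  have hv2 : ContDiff ℝ 2 v := contDiff_softAbs.comp hu
  set z := avg kerK 1 v with hz
  have hz2 : ContDiff ℝ 2 z := contDiff_avg (n := 2) (hk.of_le (by norm_num)) hkc hv2.continuous
    one_pos
  set d : E 3 → ℝ := fun y => 1 - ‖y - x₀‖ ^ 2 with hd
  have hn2 : ContDiff ℝ 2 fun y : E 3 => ‖y - x₀‖ ^ 2 := contDiff_norm_sub_sq x₀
  have hd2 : ContDiff ℝ 2 d := contDiff_const.sub hn2
  have hpd : ∀ i x, pd i d x = -2 * (x i - x₀ i) := fun i x => by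
    rw [hd, pd_sub i (differentiableAt_const _) (hn2.differentiable (by norm_num) x), pd_const,
      pd_norm_sub_sq]; ring
  have hC := three_le_supC
  have main := le_of_interior_test (φ := fun y => z y * d y) (x₀ := x₀) (L := 1) (B := 5 + supC)
    (hz2.mul hd2) (fun x hx => by
      rw [dist_eq_norm] at hx
      simp only [hd, hx]; norm_num; linarith) (fun x hx hgrad hlap => ?_)
  · have := main x₀ (mem_closedBall_self zero_le_one)
    simpa [hd] using this
  · rw [dist_eq_norm] at hx
    have hzx : 0 ≤ z x := integral_nonneg fun y => mul_nonneg (kerK_nonneg y) (softAbs_nonneg _)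
    have hr : ‖x - x₀‖ ^ 2 = ∑ i, (x i - x₀ i) ^ 2 := by
      rw [norm_sq_eq_sum]; simp
    have hr1 : ‖x - x₀‖ ^ 2 < 1 := by nlinarith [norm_nonneg (x - x₀)]
    have hr0 : 0 ≤ ‖x - x₀‖ ^ 2 := sq_nonneg _
    have hdx : d x = 1 - ‖x - x₀‖ ^ 2 := rfl
    have hlz := lap_avg_softAbs_ge hu (x := x) ((setIntegral_closedBall_mono
      ((continuous_chem hu).pow 2) (fun _ => sq_nonneg _) (y := x₀) (R := 2)
      (by rw [dist_eq_norm]; linarith)).trans h)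
    rw [← hv, ← hz] at hlz
    have hg : ∀ i, pd i z x * d x = 2 * (x i - x₀ i) * z x := fun i => by
      have := hgrad i
      rw [pd_mul i (hz2.differentiable (by norm_num) x) (hd2.differentiable (by norm_num) x),
        hpd] at this
      linarith
    rw [lap_mul hz2 hd2, hd, lap_const_sub hn2, lap_norm_sub_sq, ← hd] at hlap
    have hs : d x * ∑ i, pd i z x * pd i d x = -4 * ‖x - x₀‖ ^ 2 * z x := by
      rw [Finset.mul_sum, hr, Finset.mul_sum, Finset.sum_mul]
      refine Finset.sum_congr rfl fun i _ => ?_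
      rw [hpd, show d x * (pd i z x * (-2 * (x i - x₀ i)))
        = (pd i z x * d x) * (-2 * (x i - x₀ i)) by ring, hg]
      ring
    have hd0 : 0 < d x := by rw [hdx]; linarith
    have hd1 : d x ≤ 1 := by rw [hdx]; linarith
    by_contra hB
    rw [not_le] at hB
    have key : d x ^ 2 * lap z x ≤ 8 * z x := by
      have := mul_le_mul_of_nonneg_left hlap hd0.le
      have e : d x * (lap z x * d x + 2 * ∑ i, pd i z x * pd i d x + z x * -6)
          = d x ^ 2 * lap z x + 2 * (d x * ∑ i, pd i z x * pd i d x) - 6 * z x * d x := by ring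
      rw [mul_zero, e, hs] at this
      have : d x ^ 2 * lap z x ≤ z x * (8 * ‖x - x₀‖ ^ 2 + 6 * d x) := by linarith
      refine this.trans ?_
      rw [hdx]; nlinarith
    have key2 : (z x * d x) ^ 3 / 2 ≤ supC + 8 * (z x * d x) := by
      have h1 : d x ^ 3 * (z x ^ 3 / 2 - supC) ≤ d x * (8 * z x) := by
        calc d x ^ 3 * (z x ^ 3 / 2 - supC) ≤ d x ^ 3 * lap z x :=
              mul_le_mul_of_nonneg_left hlz (by positivity)
          _ = d x * (d x ^ 2 * lap z x) := by ring
          _ ≤ _ := mul_le_mul_of_nonneg_left key hd0.le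
      have h2 : d x ^ 3 * supC ≤ 1 * supC :=
        mul_le_mul_of_nonneg_right (pow_le_one₀ hd0.le hd1) (by linarith)
      nlinarith
    set ψ := z x * d x
    have h5 : 5 < ψ := by linarith
    nlinarith [mul_pos (by linarith : 0 < ψ - 5) (by linarith : (0 : ℝ) < ψ)]

/-- An interior sup bound in terms of the chemical potential alone. -/
lemma exists_sup_bound : ∃ C₀ : ℝ, 2 ≤ C₀ ∧ ∀ u : E 3 → ℝ, ContDiff ℝ 2 u → HasCompactSupport u →
    ∀ x, ∫ z in closedBall x 2, chem u z ^ 2 ≤ 1 → |u x| ≤ C₀ := by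
  have hq := contDiff_kerQ.continuous
  have hqc := hasCompactSupport_kerQ
  have hq0 : 0 ≤ ∫ y, kerQ y := integral_nonneg kerQ_nonneg
  refine ⟨(5 + supC) + ((3 * ∫ y, kerQ y) * 1 ^ 2 / 2 + 2 * Real.sqrt (∫ y, kerQ y ^ 2) *
    Real.sqrt 1) + 1, ?_, ?_⟩
  · have := three_le_supC
    have := Real.sqrt_nonneg (∫ y, kerQ y ^ 2)
    rw [Real.sqrt_one]; linarith
  intro u hu huc x h
  have hv2 : ContDiff ℝ 2 fun y => softAbs (u y) := contDiff_softAbs.comp hu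
  have hvc : HasCompactSupport fun y => softAbs (u y) := huc.comp_left (g := softAbs) (by simp [softAbs])
  have hf := continuous_chem hu
  have h1 := avg_softAbs_le hu h
  have h2 := le_add_of_deriv_ge (a := 3 * ∫ y, kerQ y) (b := Real.sqrt (∫ y, kerQ y ^ 2))
    zero_le_one (fun t => hasDerivAt_avg_kerK hv2 hvc t x) (fun t ht0 ht1 => by
      have hm : avg kerQ t (fun y => (-3) + (-1) * |chem u y|) x ≤
          avg kerQ t (lap fun y => softAbs (u y)) x := by
        refine avg_mono hq hqc kerQ_nonneg kerQ_eq_zero ht0.le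
          (continuous_const.add (continuous_const.mul hf.abs)) (continuous_lap hv2) fun y _ => ?_
        have := lap_softAbs_ge hu y
        have := pow_nonneg (softAbs_nonneg (u y)) 3
        linarith
      have hc2 : Continuous fun y => (-1) * |chem u y| := continuous_const.mul hf.abs
      rw [avg_add hq hqc continuous_const hc2, avg_const,
        avg_const_mul] at hm
      have hb := abs_avg_le_of_sq (D := 1) (x := x) hq kerQ_eq_zero hf.abs ht0 zero_le_one (by
        simp only [sq_abs, one_pow]
        exact (setIntegral_closedBall_mono (hf.pow 2) (fun _ => sq_nonneg _)
          (by rw [dist_self]; linarith)).trans h)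
      have hb' := (le_abs_self _).trans hb
      have hst := Real.sqrt_pos.2 ht0
      have : t * (Real.sqrt (∫ y, kerQ y ^ 2) * 1 / (t * Real.sqrt t))
          = Real.sqrt (∫ y, kerQ y ^ 2) / Real.sqrt t := by field_simp
      have hm' := mul_le_mul_of_nonneg_left hm ht0.le
      have hb2 := mul_le_mul_of_nonneg_left hb' ht0.le
      rw [this] at hb2
      linarith)
  rw [avg_kerK_zero] at h2
  have h3 := abs_le_softAbs_add_one (u x)
  linarith

/-- Near `x` the function is bounded by `C` and its chemical potential is small compared with
the scale `s`. -/
structure GoodAt (C s : ℝ) (u : E 3 → ℝ) (x : E 3) : Prop where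
  bound : ∀ z ∈ closedBall x 2, |u z| ≤ C
  chem_le : ∫ z in closedBall x 2, chem u z ^ 2 ≤ (s ^ 4) ^ 2

lemma abs_W'_le {C t : ℝ} (h : |t| ≤ C) : |W' t| ≤ C ^ 3 + C := by
  rw [W']
  refine (abs_sub _ _).trans ?_
  rw [abs_pow]
  gcongr

lemma pow_four_div_le {s t : ℝ} (hs : 0 < s) (hs1 : s ≤ 1) (hst : s ≤ t) :
    s ^ 4 / (t * Real.sqrt t) ≤ s ^ 2 := by
  have ht : 0 < t := hs.trans_le hst
  have h1 : s ≤ Real.sqrt t := by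
    refine Real.le_sqrt_of_sq_le ?_
    nlinarith
  rw [div_le_iff₀ (by positivity)]
  have : s * s ≤ t * Real.sqrt t := by gcongr
  nlinarith [sq_nonneg s]

section goodAt

variable {C s t : ℝ} {u κ : E 3 → ℝ} {x y : E 3}

lemma lap_eq_chem_add (u : E 3 → ℝ) : lap u = fun x => chem u x + W' (u x) := by
  ext x; simp [chem]

lemma GoodAt.abs_avg_chem_le (h : GoodAt C s u x) (hu : ContDiff ℝ 2 u) (hs : 0 < s)
    (hκ : Continuous κ) (hκ1 : ∀ y, 1 < ‖y‖ → κ y = 0) (hy : dist y x ≤ 1) (ht : 0 < t)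
    (ht1 : t ≤ 1) :
    |avg κ t (chem u) y| ≤ Real.sqrt (∫ y, κ y ^ 2) * s ^ 4 / (t * Real.sqrt t) :=
  abs_avg_le_of_sq hκ hκ1 (continuous_chem hu) ht (by positivity)
    ((setIntegral_closedBall_mono ((continuous_chem hu).pow 2) (fun _ => sq_nonneg _)
      (by linarith)).trans h.chem_le)

lemma GoodAt.abs_avg_lap_le (h : GoodAt C s u x) (hu : ContDiff ℝ 2 u) (hs : 0 < s)
    (hκ : Continuous κ) (hκ1 : ∀ y, 1 < ‖y‖ → κ y = 0) (hy : dist y x ≤ 1) (ht : 0 < t)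
    (ht1 : t ≤ 1) :
    |avg κ t (lap u) y| ≤ (∫ y, |κ y|) * (C ^ 3 + C)
      + Real.sqrt (∫ y, κ y ^ 2) * s ^ 4 / (t * Real.sqrt t) := by
  have hc := hasCompactSupport_of_unit hκ1
  have hcW : Continuous fun y => W' (u y) := continuous_W'.comp hu.continuous
  rw [lap_eq_chem_add, avg_add hκ hc (continuous_chem hu) hcW,
    add_comm]
  refine (abs_add_le _ _).trans (add_le_add ?_ (h.abs_avg_chem_le hu hs hκ hκ1 hy ht ht1))
  refine abs_avg_le hκ hc hκ1 ht.le fun z hz => abs_W'_le (h.bound z ?_)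
  rw [mem_closedBall] at hz ⊢
  linarith [dist_triangle z y x]

lemma exists_abs_sub_avg_le (C : ℝ) : ∃ A, 0 ≤ A ∧ ∀ {s : ℝ} {u : E 3 → ℝ} {x y : E 3},
    GoodAt C s u x → ContDiff ℝ 2 u → HasCompactSupport u → 0 < s → s ≤ 1 → dist y x ≤ 1 →
    |u y - avg kerK s u y| ≤ A * s ^ 2 := by
  have hq := contDiff_kerQ.continuous
  set a := (∫ y, |kerQ y|) * (C ^ 3 + C) with ha
  set b := Real.sqrt (∫ y, kerQ y ^ 2) with hb
  have hb0 : 0 ≤ b := Real.sqrt_nonneg _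
  refine ⟨|a| / 2 + 2 * b, by positivity, fun {s u x y} h hu huc hs hs1 hy => ?_⟩
  have hφ : ∀ t, HasDerivAt (fun t => avg kerK t u y) (t * avg kerQ t (lap u) y) t := fun t =>
    hasDerivAt_avg_kerK hu huc t y
  have hbd : ∀ t, 0 < t → t < s →
      |t * avg kerQ t (lap u) y| ≤ |a| * t + (b * s ^ 4) / Real.sqrt t := by
    intro t ht hts
    have h1 := h.abs_avg_lap_le hu hs hq kerQ_eq_zero hy ht (hts.le.trans hs1)
    rw [← ha, ← hb] at h1
    have hst := Real.sqrt_pos.2 ht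
    rw [abs_mul, abs_of_pos ht]
    calc t * |avg kerQ t (lap u) y| ≤ t * (a + b * s ^ 4 / (t * Real.sqrt t)) := by gcongr
      _ = a * t + b * s ^ 4 / Real.sqrt t := by field_simp
      _ ≤ _ := by gcongr; exact le_abs_self a
  have h1 := le_add_of_deriv_ge hs.le hφ fun t ht hts => (abs_le.1 (hbd t ht hts)).1
  have h2 := le_add_of_deriv_ge hs.le (fun t => (hφ t).neg) fun t ht hts =>
    neg_le_neg (abs_le.1 (hbd t ht hts)).2
  simp only [Pi.neg_apply, avg_kerK_zero] at h1 h2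
  have h3 : 2 * (b * s ^ 4) * Real.sqrt s ≤ 2 * b * s ^ 2 := by
    have : Real.sqrt s ≤ 1 := Real.sqrt_le_one.2 hs1
    have : s ^ 4 * Real.sqrt s ≤ s ^ 2 * 1 :=
      mul_le_mul (pow_le_pow_of_le_one hs.le hs1 (by norm_num)) this (Real.sqrt_nonneg _)
        (by positivity)
    nlinarith
  rw [abs_le]
  constructor <;> linarith

lemma avg_kerK_pd_eq (hu : ContDiff ℝ 2 u) (hs : 0 < s) (i : Fin 3) (x : E 3) :
    pd i (avg kerK s u) x = avg kerK s (pd i u) x :=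
  pd_avg_right (contDiff_kerK.of_le (by norm_num)) hasCompactSupport_kerK
    (hu.of_le (by norm_num)) hs i x

lemma continuous_pd_kerK (i : Fin 3) : Continuous (pd i kerK) :=
  continuous_pd i (contDiff_kerK.of_le (by norm_num))

lemma continuous_pd_kerQ (i : Fin 3) : Continuous (pd i kerQ) :=
  continuous_pd i (contDiff_kerQ.of_le (by norm_num))

lemma exists_abs_pd_avg_le (C : ℝ) : ∃ A, 0 ≤ A ∧ ∀ {s : ℝ} {u : E 3 → ℝ} {x y : E 3},
    GoodAt C s u x → ContDiff ℝ 2 u → HasCompactSupport u → 0 < s → s ≤ 1 → dist y x ≤ 1 →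
    ∀ i, |pd i (avg kerK s u) y| ≤ A := by
  set B : Fin 3 → ℝ := fun i => (∫ y, |pd i kerQ y|) * (C ^ 3 + C)
    + Real.sqrt (∫ y, pd i kerQ y ^ 2) with hB
  set D : Fin 3 → ℝ := fun i => (∫ y, |pd i kerK y|) * C with hD
  refine ⟨∑ i, (|B i| + |D i|), Finset.sum_nonneg fun i _ => by positivity,
    fun {s u x y} h hu huc hs hs1 hy i => ?_⟩
  refine le_trans ?_ (Finset.single_le_sum (f := fun i => |B i| + |D i|)
    (fun i _ => by positivity) (Finset.mem_univ i))
  have hpos : ∀ t ∈ Icc s 1, 0 < t := fun t ht => hs.trans_le ht.1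
  have hmv := (convex_Icc s (1 : ℝ)).norm_image_sub_le_of_norm_hasDerivWithin_le (C := |B i|)
    (f := fun t => avg kerK t (pd i u) y) (f' := fun t => avg (pd i kerQ) t (lap u) y)
    (fun t ht => (hasDerivAt_avg_kerK_pd hu huc (hpos t ht).ne' y i).hasDerivWithinAt)
    (fun t ht => by
      have h1 := h.abs_avg_lap_le hu hs (continuous_pd_kerQ i)
        (pd_eq_zero_of_unit kerQ_eq_zero i) hy (hpos t ht) ht.2
      refine h1.trans (le_trans ?_ (le_abs_self _))
      rw [hB, mul_div_assoc]
      refine add_le_add le_rfl (mul_le_of_le_one_right (Real.sqrt_nonneg _) ?_)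
      exact (pow_four_div_le hs hs1 ht.1).trans (pow_le_one₀ hs.le hs1))
    (left_mem_Icc.2 hs1) (right_mem_Icc.2 hs1)
  have h1 : |avg kerK 1 (pd i u) y| ≤ |D i| := by
    have := avg_pd_left (contDiff_kerK.of_le (by norm_num)) hasCompactSupport_kerK
      (hu.of_le (by norm_num) : ContDiff ℝ 1 u) i 1 y
    rw [one_mul] at this
    rw [← this]
    refine (abs_avg_le (continuous_pd_kerK i) (hasCompactSupport_pd i hasCompactSupport_kerK)
      (pd_eq_zero_of_unit kerK_eq_zero i) zero_le_one fun z hz => h.bound z ?_).trans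
      (le_abs_self _)
    rw [mem_closedBall] at hz ⊢
    linarith [dist_triangle z y x]
  rw [avg_kerK_pd_eq hu hs]
  rw [Real.norm_eq_abs, Real.norm_eq_abs] at hmv
  have h2 : |B i| * |1 - s| ≤ |B i| * 1 :=
    mul_le_mul_of_nonneg_left (abs_le.2 ⟨by linarith, by linarith⟩) (abs_nonneg _)
  have h3 := abs_le.1 hmv
  have h4 := abs_le.1 h1
  rw [abs_le]
  constructor <;> linarith

lemma contDiff_avg_kerK (hu : Continuous u) (hs : 0 < s) : ContDiff ℝ 3 (avg kerK s u) :=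
  contDiff_avg (n := 3) contDiff_kerK hasCompactSupport_kerK hu hs

lemma exists_abs_sub_avg_center_le (C : ℝ) : ∃ A, 0 ≤ A ∧ ∀ {s : ℝ} {u : E 3 → ℝ} {x y : E 3},
    GoodAt C s u x → ContDiff ℝ 2 u → HasCompactSupport u → 0 < s → s ≤ 1 → dist y x ≤ s →
    |u y - avg kerK s u x| ≤ A * s := by
  obtain ⟨A, hA0, hA⟩ := exists_abs_sub_avg_le C
  obtain ⟨B, hB0, hB⟩ := exists_abs_pd_avg_le C
  refine ⟨A + 2 * B, by positivity, fun {s u x y} h hu huc hs hs1 hy => ?_⟩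
  have h1 := hA h hu huc hs hs1 (hy.trans hs1)
  have h2 := (convex_closedBall x 1).norm_image_sub_le_of_norm_fderiv_le (𝕜 := ℝ)
    (f := avg kerK s u) (C := 2 * B)
    (fun z _ => (contDiff_avg_kerK hu.continuous hs).differentiable (by norm_num) z)
    (fun z hz => by
      refine abs_le_of_sq_le_sq' ?_ (by positivity) |>.2
      rw [norm_fderiv_sq, gradSq, Fin.sum_univ_three]
      have hz' := hB h hu huc hs hs1 (mem_closedBall.1 hz)
      have hsq : ∀ i, pd i (avg kerK s u) z ^ 2 ≤ B ^ 2 := fun i => by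
        rw [← sq_abs]; exact pow_le_pow_left₀ (abs_nonneg _) (hz' i) 2
      nlinarith [hsq 0, hsq 1, hsq 2])
    (mem_closedBall_self zero_le_one) (mem_closedBall.2 (hy.trans hs1))
  rw [Real.norm_eq_abs, ← dist_eq_norm] at h2
  have h3 : A * s ^ 2 ≤ A * s := mul_le_mul_of_nonneg_left (by nlinarith) hA0
  have h4 : 2 * B * dist y x ≤ 2 * B * s := mul_le_mul_of_nonneg_left hy (by positivity)
  have h5 := abs_le.1 h1
  have h6 := abs_le.1 h2
  rw [abs_le]
  constructor <;> linarith

lemma GoodAt.abs_avg_kerK_le (h : GoodAt C s u x) (hs : 0 < s) (hs1 : s ≤ 1) :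
    |avg kerK s u x| ≤ C := by
  have := abs_avg_le (F := u) (S := C) (x := x) contDiff_kerK.continuous hasCompactSupport_kerK
    kerK_eq_zero hs.le fun z hz => h.bound z (closedBall_subset_closedBall (by linarith) hz)
  simpa [abs_of_nonneg (kerK_nonneg _), integral_kerK] using this

lemma abs_W'_sub_le {a b : ℝ} (ha : |a| ≤ C) (hb : |b| ≤ C) :
    |W' a - W' b| ≤ (3 * C ^ 2 + 1) * |a - b| := by
  have hC : 0 ≤ C := (abs_nonneg a).trans ha
  rw [W', W', show a ^ 3 - a - (b ^ 3 - b) = (a ^ 2 + a * b + b ^ 2 - 1) * (a - b) by ring,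
    abs_mul]
  refine mul_le_mul_of_nonneg_right ?_ (abs_nonneg _)
  have h1 := abs_le.1 ha
  have h2 := abs_le.1 hb
  rw [abs_le]
  constructor <;> nlinarith [sq_nonneg (a + b), sq_nonneg a, sq_nonneg b]

lemma lap_avg_kerK_eq (hu : ContDiff ℝ 2 u) (hs : 0 < s) :
    lap (avg kerK s u) = avg kerK s (lap u) :=
  funext (lap_avg (contDiff_kerK.of_le (by norm_num)) hasCompactSupport_kerK hu hs)

lemma exists_abs_chem_avg_le (C : ℝ) : ∃ A, 0 ≤ A ∧ ∀ {s : ℝ} {u : E 3 → ℝ} {x : E 3},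
    GoodAt C s u x → ContDiff ℝ 2 u → HasCompactSupport u → 0 < s → s ≤ 1 →
    |chem (avg kerK s u) x| ≤ A * s := by
  obtain ⟨A, hA0, hA⟩ := exists_abs_sub_avg_center_le C
  have hk := contDiff_kerK.continuous
  refine ⟨Real.sqrt (∫ y, kerK y ^ 2) + (3 * C ^ 2 + 1) * A, by positivity,
    fun {s u x} h hu huc hs hs1 => ?_⟩
  have hwC := h.abs_avg_kerK_le hs hs1
  set c := avg kerK s u x with hc
  have hcW : Continuous fun y => W' (u y) := continuous_W'.comp hu.continuous
  have e : chem (avg kerK s u) x = avg kerK s (chem u) x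
      + avg kerK s (fun y => W' (u y) + (-1) * W' c) x := by
    rw [chem, lap_avg_kerK_eq hu hs, lap_eq_chem_add,
      avg_add hk hasCompactSupport_kerK (continuous_chem hu) hcW,
      avg_add hk hasCompactSupport_kerK hcW continuous_const,
      avg_const, integral_kerK]
    ring
  rw [e, add_mul]
  refine (abs_add_le _ _).trans (add_le_add ?_ ?_)
  · have h1 := h.abs_avg_chem_le hu hs hk kerK_eq_zero (y := x) (by simp) hs hs1
    refine h1.trans ?_
    rw [mul_div_assoc]
    refine mul_le_mul_of_nonneg_left ((pow_four_div_le hs hs1 le_rfl).trans ?_)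
      (Real.sqrt_nonneg _)
    nlinarith
  · have h1 := abs_avg_le (F := fun y => W' (u y) + (-1) * W' c) (x := x)
      (S := (3 * C ^ 2 + 1) * (A * s)) hk hasCompactSupport_kerK kerK_eq_zero hs.le fun z hz => by
        rw [neg_one_mul, ← sub_eq_add_neg]
        refine (abs_W'_sub_le (h.bound z (closedBall_subset_closedBall (by linarith) hz))
          hwC).trans ?_
        exact mul_le_mul_of_nonneg_left (hA h hu huc hs hs1 hz) (by positivity)
    simp only [abs_of_nonneg (kerK_nonneg _), integral_kerK, one_mul] at h1
    linarith

lemma hasDerivAt_W' (t : ℝ) : HasDerivAt W' (3 * t ^ 2 - 1) t := by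
  refine ((hasDerivAt_pow 3 t).fun_sub (hasDerivAt_id t)).congr_deriv ?_
  norm_num

lemma exists_abs_pd_chem_avg_le (C : ℝ) : ∃ A, 0 ≤ A ∧ ∀ {s : ℝ} {u : E 3 → ℝ} {x : E 3},
    GoodAt C s u x → ContDiff ℝ 2 u → HasCompactSupport u → 0 < s → s ≤ 1 →
    ∀ i, |pd i (chem (avg kerK s u)) x| ≤ A * s := by
  obtain ⟨A, hA0, hA⟩ := exists_abs_sub_avg_center_le C
  set B : Fin 3 → ℝ := fun i => Real.sqrt (∫ y, pd i kerK y ^ 2)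
    + (∫ y, |pd i kerK y|) * (3 * |C| * A ^ 2) with hB
  have hI0 : ∀ i, 0 ≤ ∫ y, |pd i kerK y| := fun i => integral_nonneg fun _ => abs_nonneg _
  have hB0 : ∀ i, 0 ≤ B i := fun i => by have := hI0 i; positivity
  refine ⟨∑ i, B i, Finset.sum_nonneg fun i _ => hB0 i,
    fun {s u x} h hu huc hs hs1 i => ?_⟩
  have hk1 : ContDiff ℝ 1 kerK := contDiff_kerK.of_le (by norm_num)
  have hk := continuous_pd_kerK i
  have hkc := hasCompactSupport_pd i hasCompactSupport_kerK
  have hk0 := pd_eq_zero_of_unit kerK_eq_zero i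
  have hwC := h.abs_avg_kerK_le hs hs1
  have hC : 0 ≤ C := (abs_nonneg _).trans hwC
  have hw := contDiff_avg_kerK hu.continuous hs
  set c := avg kerK s u x with hc
  have hcu := continuous_chem hu
  have hcW : Continuous fun y => W' (u y) := continuous_W'.comp hu.continuous
  have hcR : Continuous fun y => (-W' c + (3 * c ^ 2 - 1) * c) + (-(3 * c ^ 2 - 1)) * u y :=
    continuous_const.add (continuous_const.mul hu.continuous)
  have e : pd i (chem (avg kerK s u)) x = s⁻¹ * (avg (pd i kerK) s (chem u) x
      + avg (pd i kerK) s (fun y => W' (u y) +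
        ((-W' c + (3 * c ^ 2 - 1) * c) + (-(3 * c ^ 2 - 1)) * u y)) x) := by
    have e1 : pd i (chem (avg kerK s u)) x = pd i (lap (avg kerK s u)) x
        - pd i (fun y => W' (avg kerK s u y)) x := by
      refine pd_sub i ?_ ?_
      · rw [lap_avg_kerK_eq hu hs]
        exact (contDiff_avg_kerK (continuous_lap hu) hs).differentiable (by norm_num) x
      · exact (hasDerivAt_W' _).differentiableAt.comp x (hw.differentiable (by norm_num) x)
    rw [e1, lap_avg_kerK_eq hu hs, pd_avg hk1 hasCompactSupport_kerK (continuous_lap hu) hs,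
      pd_comp_eq hasDerivAt_W' (hw.of_le (by norm_num)),
      pd_avg hk1 hasCompactSupport_kerK hu.continuous hs,
      lap_eq_chem_add, avg_add hk hkc hcu hcW, avg_add hk hkc hcW hcR,
      avg_add hk hkc continuous_const (continuous_const.fun_mul hu.continuous), avg_const,
      integral_pd_eq_zero hk1 hasCompactSupport_kerK, avg_const_mul, ← hc]
    ring
  have h1 : |avg (pd i kerK) s (chem u) x| ≤ Real.sqrt (∫ y, pd i kerK y ^ 2) * s ^ 2 := by
    refine (h.abs_avg_chem_le hu hs hk hk0 (by simp) hs hs1).trans ?_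
    rw [mul_div_assoc]
    exact mul_le_mul_of_nonneg_left (pow_four_div_le hs hs1 le_rfl) (Real.sqrt_nonneg _)
  have h2 := abs_avg_le (F := fun y => W' (u y) +
      ((-W' c + (3 * c ^ 2 - 1) * c) + (-(3 * c ^ 2 - 1)) * u y)) (x := x)
      (S := 3 * |C| * (A * s) ^ 2) hk hkc hk0 hs.le fun z hz => by
    have hz1 := h.bound z (closedBall_subset_closedBall (by linarith) hz)
    have hz2 := hA h hu huc hs hs1 hz
    rw [W', W', show u z ^ 3 - u z + (-(c ^ 3 - c) + (3 * c ^ 2 - 1) * c + -(3 * c ^ 2 - 1) * u z)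
      = (u z + 2 * c) * (u z - c) ^ 2 by ring, abs_mul, abs_pow]
    refine mul_le_mul ?_ (pow_le_pow_left₀ (abs_nonneg _) hz2 2) (by positivity) (by positivity)
    refine (abs_add_le _ _).trans ?_
    rw [abs_mul, abs_two, abs_of_nonneg hC]
    linarith
  rw [e, abs_mul, abs_of_pos (inv_pos.2 hs), inv_mul_le_iff₀ hs]
  refine (abs_add_le _ _).trans ((add_le_add h1 h2).trans ?_)
  have h3 : B i ≤ ∑ i, B i := Finset.single_le_sum (fun i _ => hB0 i) (Finset.mem_univ i)
  have h4 := mul_le_mul_of_nonneg_right h3 (sq_nonneg s)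
  simp only [hB] at h4
  nlinarith

end goodAt

lemma contDiff_W' {n : WithTop ℕ∞} : ContDiff ℝ n W' := (contDiff_id.pow 3).sub contDiff_id

lemma contDiff_W {n : WithTop ℕ∞} : ContDiff ℝ n W :=
  (((contDiff_id.pow 2).sub contDiff_const).pow 2).div_const 4

lemma W_nonneg (t : ℝ) : 0 ≤ W t := by unfold W; positivity

lemma hasDerivAt_W (t : ℝ) : HasDerivAt W (W' t) t := by
  have h : HasDerivAt (fun t : ℝ => t ^ 2 - 1) (2 * t) t := by
    simpa using (hasDerivAt_pow 2 t).sub_const 1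
  refine ((h.pow 2).div_const 4).congr_deriv ?_
  simp [W']; ring

lemma lap_neg (w : E 3 → ℝ) (hw : ContDiff ℝ 2 w) (x : E 3) : lap (fun y => -w y) x = -lap w x := by
  have := lap_const_mul hw (-1) x
  simpa using this

/-- A subsolution of the Allen-Cahn equation exceeds one only slightly far from the boundary. -/
lemma le_one_add_of_subsolution {w : E 3 → ℝ} (hw : ContDiff ℝ 2 w) {C A s : ℝ} (hC : 0 ≤ C)
    (hA : 0 ≤ A) (hs : 0 < s) (hs1 : s ≤ 1) {x₀ : E 3}
    (hb : ∀ x ∈ closedBall x₀ s⁻¹, w x ≤ C)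
    (hl : ∀ x ∈ closedBall x₀ s⁻¹, W' (w x) - A * s ≤ lap w x) :
    w x₀ ≤ 1 + (A + 6 * C) * s := by
  have hn2 : ContDiff ℝ 2 fun y : E 3 => ‖y - x₀‖ ^ 2 := contDiff_norm_sub_sq x₀
  have hp2 : ContDiff ℝ 2 fun y : E 3 => C * s ^ 2 * ‖y - x₀‖ ^ 2 := contDiff_const.mul hn2
  have main := le_of_interior_test (φ := fun y => w y - C * s ^ 2 * ‖y - x₀‖ ^ 2) (x₀ := x₀)
    (L := s⁻¹) (B := 1 + (A + 6 * C) * s) (hw.sub hp2) (fun x hx => ?_) (fun x hx _ hlap => ?_)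
  · have := main x₀ (mem_closedBall_self (by positivity))
    simpa using this
  · have hbx := hb x (mem_closedBall.2 hx.le)
    rw [dist_eq_norm] at hx
    have : C * s ^ 2 * ‖x - x₀‖ ^ 2 = C := by
      rw [hx]; field_simp
    have h0 : 0 ≤ (A + 6 * C) * s := by positivity
    simp only [this]
    linarith
  · rw [lap_sub hw hp2, lap_const_mul hn2, lap_norm_sub_sq] at hlap
    have h1 := hl x (mem_closedBall.2 hx.le)
    have h0 : 0 ≤ C * s ^ 2 * ‖x - x₀‖ ^ 2 := by positivity
    have hAs : 0 ≤ A * s := by positivity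
    have hCs : 0 ≤ C * s := by positivity
    have hss : C * s ^ 2 ≤ C * s := by nlinarith
    by_contra hB
    rw [not_le] at hB
    have hwx : 1 + (A + 6 * C) * s < w x := by linarith
    have hw1 : 1 < w x := by nlinarith
    rw [W'] at h1
    have : 2 * (w x - 1) ≤ w x ^ 3 - w x := by
      nlinarith [mul_nonneg (by linarith : 0 ≤ w x - 1) (by linarith : 0 ≤ w x - 1),
        mul_nonneg (mul_nonneg (by linarith : 0 ≤ w x - 1) (by linarith : 0 ≤ w x - 1))
          (by linarith : 0 ≤ w x)]
    nlinarith

section bochner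

variable {w : E 3 → ℝ}

lemma lap_pd (hw : ContDiff ℝ 3 w) (j : Fin 3) (x : E 3) : lap (pd j w) x = pd j (lap w) x := by
  have hw2 : ContDiff ℝ 2 w := hw.of_le (by norm_num)
  rw [lap_eq (contDiff_two_pd j hw), show lap w = fun x => ∑ i, pd i (pd i w) x from
    funext (lap_eq hw2), pd_sum j fun i _ => (contDiff_one_pd i (contDiff_two_pd i hw)).differentiable
      (by norm_num) x]
  refine Finset.sum_congr rfl fun i _ => ?_
  rw [show pd i (pd j w) = pd j (pd i w) from funext (pd_comm hw2 i j),
    pd_comm (contDiff_two_pd i hw)]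

lemma contDiff_lap (hw : ContDiff ℝ 3 w) : ContDiff ℝ 1 (lap w) := by
  rw [show lap w = fun x => ∑ i, pd i (pd i w) x from funext (lap_eq (hw.of_le (by norm_num)))]
  exact ContDiff.sum fun i _ => contDiff_one_pd i (contDiff_two_pd i hw)

lemma pd_lap_eq (hw : ContDiff ℝ 3 w) (j : Fin 3) (x : E 3) :
    pd j (lap w) x = pd j (chem w) x + (3 * w x ^ 2 - 1) * pd j w x := by
  have hw1 : ContDiff ℝ 1 w := hw.of_le (by norm_num)
  have hW : ContDiff ℝ 1 fun y => W' (w y) := contDiff_W'.comp hw1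
  have h1 : pd j (chem w) x = pd j (lap w) x - pd j (fun y => W' (w y)) x :=
    pd_sub j ((contDiff_lap hw).differentiable (by norm_num) x)
      (hW.differentiable (by norm_num) x)
  rw [h1, pd_comp_eq hasDerivAt_W' hw1]
  ring

/-- The discrepancy density. -/
def discr (w : E 3 → ℝ) (x : E 3) : ℝ := gradSq w x / 2 - W (w x)

lemma contDiff_gradSq (hw : ContDiff ℝ 3 w) : ContDiff ℝ 2 (gradSq w) :=
  ContDiff.sum fun i _ => (contDiff_two_pd i hw).pow 2

lemma contDiff_discr (hw : ContDiff ℝ 3 w) : ContDiff ℝ 2 (discr w) :=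
  ((contDiff_gradSq hw).div_const 2).sub (contDiff_W.comp (hw.of_le (by norm_num)))

lemma pd_gradSq (hw : ContDiff ℝ 2 w) (i : Fin 3) (x : E 3) :
    pd i (gradSq w) x = 2 * ∑ j, pd j w x * pd i (pd j w) x := by
  have hd : ∀ j, DifferentiableAt ℝ (pd j w) x := fun j =>
    (contDiff_one_pd j hw).differentiable (by norm_num) x
  have h := pd_sum (s := Finset.univ) (f := fun j (y : E 3) => pd j w y ^ 2) (x := x) i
    fun j _ => (hd j).pow 2
  rw [show gradSq w = fun y => ∑ j, pd j w y ^ 2 from rfl, h, Finset.mul_sum]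
  refine Finset.sum_congr rfl fun j _ => ?_
  rw [pd_comp (φ := fun t => t ^ 2) (φ' := 2 * pd j w x) i
    (by simpa using hasDerivAt_pow 2 (pd j w x)) (hd j)]
  ring

lemma pd_discr (hw : ContDiff ℝ 2 w) (i : Fin 3) (x : E 3) :
    pd i (discr w) x = ∑ j, pd j w x * pd i (pd j w) x - W' (w x) * pd i w x := by
  have hg : DifferentiableAt ℝ (gradSq w) x :=
    (ContDiff.sum fun i _ => (contDiff_one_pd i hw).pow 2 : ContDiff ℝ 1 (gradSq w)).differentiable
      (by norm_num) x
  have hw1 : ContDiff ℝ 1 w := hw.of_le (by norm_num)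
  have hW : ContDiff ℝ 1 fun y => W (w y) := contDiff_W.comp hw1
  have e : discr w = fun y => (1 / 2) * gradSq w y - W (w y) := by
    ext y; simp only [discr]; ring
  rw [e, pd_sub i (hg.const_mul _) (hW.differentiable (by norm_num) x), pd_const_mul i _ hg,
    pd_gradSq hw, pd_comp_eq hasDerivAt_W hw1]
  ring

/-- A Bochner identity for the discrepancy. -/
lemma lap_discr (hw : ContDiff ℝ 3 w) (x : E 3) :
    lap (discr w) x = ∑ i, ∑ j, pd i (pd j w) x ^ 2 + ∑ j, pd j w x * pd j (chem w) x
      - W' (w x) * (W' (w x) + chem w x) := by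
  have hw2 : ContDiff ℝ 2 w := hw.of_le (by norm_num)
  have e : discr w = fun y => (1 / 2) * gradSq w y - W (w y) := by
    ext y; simp only [discr]; ring
  have hW : ContDiff ℝ 2 fun y => W (w y) := contDiff_W.comp hw2
  have hg := contDiff_gradSq hw
  have hgl : lap (gradSq w) x = ∑ j, (2 * ∑ i, pd i (pd j w) x ^ 2
      + 2 * pd j w x * lap (pd j w) x) := by
    rw [lap_eq hg]
    have h1 : ∀ i, pd i (pd i (gradSq w)) x
        = ∑ j, 2 * (pd i (pd j w) x ^ 2 + pd j w x * pd i (pd i (pd j w)) x) := by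
      intro i
      have hd : ∀ j, DifferentiableAt ℝ (pd j w) x := fun j =>
        (contDiff_one_pd j hw2).differentiable (by norm_num) x
      have hdd : ∀ j, DifferentiableAt ℝ (pd i (pd j w)) x := fun j =>
        (contDiff_one_pd i (contDiff_two_pd j hw)).differentiable (by norm_num) x
      rw [show pd i (gradSq w) = fun y => 2 * ∑ j, pd j w y * pd i (pd j w) y from
        funext (pd_gradSq hw2 i), pd_const_mul i _
          (DifferentiableAt.fun_sum fun j _ => (hd j).fun_mul (hdd j)),
        pd_sum i fun j _ => (hd j).fun_mul (hdd j), Finset.mul_sum]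
      refine Finset.sum_congr rfl fun j _ => ?_
      rw [pd_mul i (hd j) (hdd j)]
      ring
    simp only [h1]
    rw [Finset.sum_comm]
    refine Finset.sum_congr rfl fun j _ => ?_
    rw [lap_eq (contDiff_two_pd j hw), Finset.mul_sum, Finset.mul_sum, ← Finset.sum_add_distrib]
    refine Finset.sum_congr rfl fun i _ => ?_
    ring
  have hl : lap w x = W' (w x) + chem w x := by simp [chem]
  rw [e, lap_sub (contDiff_const.mul hg) hW, lap_const_mul hg, hgl,
    lap_comp hasDerivAt_W hasDerivAt_W' contDiff_W hw2, hl]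
  simp only [lap_pd hw, pd_lap_eq hw, gradSq, Fin.sum_univ_three]
  ring

end bochner

lemma hessian_sq_lower_bound {v e : Fin 3 → ℝ} {H : Fin 3 → Fin 3 → ℝ} {b B D l : ℝ}
    (hH : ∀ i, ∑ j, v j * H i j = b * v i + e i) (hl : 0 < l) (hN : l ^ 2 / 2 ≤ ∑ i, v i ^ 2)
    (hD : 0 ≤ D) (he : ∑ i, e i ^ 2 ≤ D ^ 2) (hb : |b| ≤ B) :
    b ^ 2 - 4 * B * D / l ≤ ∑ i, ∑ j, H i j ^ 2 := by
  set N := ∑ i, v i ^ 2 with hNdef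
  have hN0 : 0 < N := lt_of_lt_of_le (by positivity) hN
  have h1 : ∑ i, (b * v i + e i) ^ 2 ≤ N * ∑ i, ∑ j, H i j ^ 2 := by
    rw [Finset.mul_sum]
    refine Finset.sum_le_sum fun i _ => ?_
    rw [← hH i]
    exact Finset.sum_mul_sq_le_sq_mul_sq _ _ _
  have h2 : ∑ i, (b * v i + e i) ^ 2 = b ^ 2 * N + 2 * b * ∑ i, v i * e i + ∑ i, e i ^ 2 := by
    simp only [hNdef, Fin.sum_univ_three]; ring
  have h3 : |∑ i, v i * e i| ≤ N * (2 * D / l) := by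
    refine abs_le_of_sq_le_sq ?_ (by positivity)
    calc (∑ i, v i * e i) ^ 2 ≤ N * ∑ i, e i ^ 2 := Finset.sum_mul_sq_le_sq_mul_sq _ _ _
      _ ≤ N * D ^ 2 := by gcongr
      _ ≤ N * (N * 2 / l ^ 2 * D ^ 2) := by
        refine mul_le_mul_of_nonneg_left ?_ hN0.le
        refine le_mul_of_one_le_left (sq_nonneg _) ?_
        rw [le_div_iff₀ (by positivity)]; linarith
      _ ≤ (N * (2 * D / l)) ^ 2 := by
        rw [show (N * (2 * D / l)) ^ 2 = N * (N * 4 / l ^ 2 * D ^ 2) by field_simp; ring]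
        gcongr
        norm_num
  have h4 : -(B * (N * (2 * D / l))) ≤ b * ∑ i, v i * e i := by
    have : |b * ∑ i, v i * e i| ≤ B * (N * (2 * D / l)) := by
      rw [abs_mul]
      exact mul_le_mul hb h3 (abs_nonneg _) ((abs_nonneg _).trans hb)
    exact (abs_le.1 this).1
  have h5 : 0 ≤ ∑ i, e i ^ 2 := Finset.sum_nonneg fun _ _ => sq_nonneg _
  have h6 : N * (b ^ 2 - 4 * B * D / l) ≤ N * ∑ i, ∑ j, H i j ^ 2 := by
    refine le_trans ?_ (h2 ▸ h1)
    have : N * (b ^ 2 - 4 * B * D / l) = b ^ 2 * N - 2 * (B * (N * (2 * D / l))) := by ring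
    rw [this]; linarith
  exact le_of_mul_le_mul_left h6 hN0

lemma chem_neg {w : E 3 → ℝ} (hw : ContDiff ℝ 2 w) (x : E 3) :
    chem (fun y => -w y) x = -chem w x := by
  simp only [chem, lap_neg w hw, W']; ring

lemma abs_le_one_add_of_chem {w : E 3 → ℝ} (hw : ContDiff ℝ 2 w) {C A s : ℝ} (hC : 0 ≤ C)
    (hA : 0 ≤ A) (hs : 0 < s) (hs1 : s ≤ 1) {x₀ : E 3}
    (hb : ∀ x ∈ closedBall x₀ s⁻¹, |w x| ≤ C)
    (hf : ∀ x ∈ closedBall x₀ s⁻¹, |chem w x| ≤ A * s) :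
    |w x₀| ≤ 1 + (A + 6 * C) * s := by
  have h1 := le_one_add_of_subsolution hw hC hA hs hs1 (fun x hx => (abs_le.1 (hb x hx)).2)
    fun x hx => by have := (abs_le.1 (hf x hx)).1; simp only [chem] at this; linarith
  have h2 := le_one_add_of_subsolution (w := fun y => -w y) hw.neg hC hA hs hs1
    (fun x hx => by have := (abs_le.1 (hb x hx)).1; linarith)
    fun x hx => by
      have := (abs_le.1 (hf x hx)).2
      have e := chem_neg hw x
      simp only [chem] at this e
      linarith
  exact abs_le.2 ⟨by linarith, h1⟩

lemma abs_W'_sub_linear_le {C l t : ℝ} (hC : 1 ≤ C) (hl : 0 < l) (hl1 : l ≤ 1) (ht : |t| ≤ C) :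
    |W' t - l ^ 2 * t / (2 * C ^ 2)| ≤ C ^ 3 + C + 1 := by
  have hC2 : 0 < 2 * C ^ 2 := by positivity
  have h1 : |W' t| ≤ C ^ 3 + C := by
    rw [W']
    calc |t ^ 3 - t| ≤ |t ^ 3| + |t| := abs_sub _ _
      _ = |t| ^ 3 + |t| := by rw [abs_pow]
      _ ≤ _ := by gcongr
  have h2 : |l ^ 2 * t / (2 * C ^ 2)| ≤ 1 := by
    rw [abs_div, abs_mul, abs_of_pos (by positivity : 0 < l ^ 2), abs_of_pos hC2, div_le_one hC2]
    have : l ^ 2 ≤ 1 := pow_le_one₀ hl.le hl1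
    nlinarith [abs_nonneg t]
  exact (abs_sub _ _).trans (by linarith)

set_option maxHeartbeats 800000 in
/-- The algebraic core of the maximum principle argument for the discrepancy. -/
lemma modica_algebra {C A M B B1 B2 K s l t g f' N X vg : ℝ} (hC : 1 ≤ C) (hA : 0 ≤ A) (hM : 0 ≤ M)
    (hB1 : 0 ≤ B1) (hB : B = C ^ 3 + C + 1) (hB2 : B2 = (2 + B1) * B1)
    (hK : K = 8 * B * M + 3 * A ^ 2 + B * A + B2 + 6 * M) (hs : 0 < s) (hs1 : s ≤ 1)
    (hl : 0 < l) (hl1 : l ≤ 1) (hsl : 8 * C ^ 2 * (K + 1) * s = l ^ 5)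
    (ht : |t| ≤ C) (ht1 : |t| ≤ 1 + B1 * s) (hg : |g| ≤ A * s) (hN : l ^ 2 / 2 ≤ N)
    (hvg : -(3 * A ^ 2 * s) ≤ vg)
    (hX : (W' t - l ^ 2 * t / (2 * C ^ 2)) ^ 2 - 4 * B * (2 * M * s) / l ≤ X)
    (hf' : f' = l ^ 2 / (2 * C ^ 2) * N + l ^ 2 * t / (2 * C ^ 2) * (W' t + g) - 6 * M * s ^ 2)
    (hmain : X + vg - W' t * (W' t + g) + f' ≤ 0) : False := by
  set G := l ^ 2 * t / (2 * C ^ 2) with hG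
  have hC2 : 0 < 2 * C ^ 2 := by positivity
  have hBpos : 0 ≤ B := by rw [hB]; positivity
  have hB2pos : 0 ≤ B2 := by rw [hB2]; positivity
  have hKpos : 0 ≤ K := by rw [hK]; positivity
  -- the product of the two first order terms
  have hGW : G * W' t ≤ B2 * s := by
    have e : G * W' t = (l ^ 2 / (2 * C ^ 2)) * (t ^ 2 * (t ^ 2 - 1)) := by
      rw [hG, W']; ring
    rcases le_or_gt (t ^ 2) 1 with h | h
    · have : G * W' t ≤ 0 := by
        rw [e]
        exact mul_nonpos_of_nonneg_of_nonpos (by positivity)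
          (mul_nonpos_of_nonneg_of_nonpos (by positivity) (by linarith))
      exact this.trans (by positivity)
    · have h2 : t ^ 2 - 1 ≤ B2 * s := by
        have : t ^ 2 ≤ (1 + B1 * s) ^ 2 := by
          rw [← sq_abs t]; gcongr
        rw [hB2]
        nlinarith [mul_nonneg (mul_nonneg hB1 hB1) (mul_nonneg hs.le (sub_nonneg.2 hs1))]
      have h3 : (l ^ 2 / (2 * C ^ 2)) * t ^ 2 ≤ 1 := by
        have : t ^ 2 ≤ C ^ 2 := by rw [← sq_abs t]; gcongr
        rw [div_mul_eq_mul_div, div_le_one hC2]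
        have : l ^ 2 ≤ 1 := pow_le_one₀ hl.le hl1
        nlinarith [sq_nonneg t, sq_nonneg C]
      rw [e, ← mul_assoc]
      calc _ ≤ 1 * (t ^ 2 - 1) := by gcongr
        _ ≤ _ := by linarith
  have hWt : |W' t - G| ≤ B := hB ▸ abs_W'_sub_linear_le hC hl hl1 ht
  have hlast : -(B * (A * s)) ≤ -((W' t - G) * g) := by
    have : |(W' t - G) * g| ≤ B * (A * s) := by
      rw [abs_mul]; exact mul_le_mul hWt hg (abs_nonneg _) hBpos
    linarith [(abs_le.1 this).2]
  have hNl : l ^ 4 / (4 * C ^ 2) ≤ l ^ 2 / (2 * C ^ 2) * N := by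
    calc l ^ 4 / (4 * C ^ 2) = l ^ 2 / (2 * C ^ 2) * (l ^ 2 / 2) := by field_simp; ring
      _ ≤ _ := by gcongr
  have hMs : 6 * M * s ^ 2 ≤ 6 * M * s := by
    gcongr; nlinarith
  have hll : ∀ z : ℝ, 0 ≤ z → z * s ≤ z * s / l := fun z hz => by
    rw [le_div_iff₀ hl]
    exact mul_le_of_le_one_right (by positivity) hl1
  have key : l ^ 4 / (4 * C ^ 2) ≤ K * s / l := by
    have e1 : K * s / l = 4 * B * (2 * M * s) / l + (3 * A ^ 2 + B * A + B2 + 6 * M) * s / l := by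
      rw [hK]; ring
    have e2 := hll (3 * A ^ 2 + B * A + B2 + 6 * M) (by positivity)
    have e3 : 0 ≤ G ^ 2 := sq_nonneg G
    have e4 : (W' t - G) ^ 2 - W' t * (W' t + g) + G * (W' t + g)
        = G ^ 2 - G * W' t - (W' t - G) * g := by ring
    have e5 : (3 * A ^ 2 + B * A + B2 + 6 * M) * s
        = 3 * A ^ 2 * s + B * (A * s) + B2 * s + 6 * M * s := by ring
    rw [e5] at e2
    rw [e1, e5]
    rw [hf'] at hmain
    generalize (W' t - G) ^ 2 = z1 at *
    generalize W' t * (W' t + g) = z2 at *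
    generalize G * (W' t + g) = z3 at *
    generalize (W' t - G) * g = z4 at *
    generalize G * W' t = z5 at *
    generalize G ^ 2 = z6 at *
    generalize 4 * B * (2 * M * s) / l = z7 at *
    generalize l ^ 2 / (2 * C ^ 2) * N = z8 at *
    generalize l ^ 4 / (4 * C ^ 2) = z9 at *
    generalize B * (A * s) = z10 at *
    generalize 3 * A ^ 2 * s = z11 at *
    generalize B2 * s = z12 at *
    linarith only [hmain, hX, hvg, hNl, hMs, hlast, hGW, e2, e3, e4]
  have : K * s / l < l ^ 4 / (4 * C ^ 2) := by
    rw [div_lt_div_iff₀ hl (by positivity)]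
    have e : l ^ 4 * l = 8 * C ^ 2 * (K + 1) * s := by rw [hsl]; ring
    rw [e]
    have : 0 < C ^ 2 * s := by positivity
    nlinarith
  linarith

set_option maxHeartbeats 600000 in
/-- An approximate form of Modica's inequality. -/
lemma exists_modica {C A : ℝ} (hC : 1 ≤ C) (hA : 0 ≤ A) :
    ∃ θ : ℝ, 0 < θ ∧ θ ≤ 1 ∧ ∀ l : ℝ, 0 < l → l ≤ 1 → ∀ s : ℝ, s = θ * l ^ 5 →
    ∀ w : E 3 → ℝ, ContDiff ℝ 3 w → ∀ x₀ : E 3,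
    (∀ x ∈ closedBall x₀ (2 * s⁻¹), |w x| ≤ C ∧ |chem w x| ≤ A * s ∧
      ∀ i, |pd i w x| ≤ A ∧ |pd i (chem w) x| ≤ A * s) →
    discr w x₀ ≤ l ^ 2 := by
  set M := 2 * A ^ 2 with hM
  set B := C ^ 3 + C + 1 with hB
  set B1 := A + 6 * C with hB1
  set B2 := (2 + B1) * B1 with hB2
  set K := 8 * B * M + 3 * A ^ 2 + B * A + B2 + 6 * M with hK
  have hMp : 0 ≤ M := by positivity
  have hBp : 0 ≤ B := by positivity
  have hB1p : 0 ≤ B1 := by positivity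
  have hB2p : 0 ≤ B2 := by positivity
  have hKp : 0 ≤ K := by positivity
  refine ⟨1 / (8 * C ^ 2 * (K + 1)), by positivity, ?_, ?_⟩
  · rw [div_le_one (by positivity)]
    nlinarith [sq_nonneg C]
  intro l hl hl1 s hsdef w hw x₀ hyp
  have hs : 0 < s := by rw [hsdef]; positivity
  have hsl : 8 * C ^ 2 * (K + 1) * s = l ^ 5 := by rw [hsdef]; field_simp
  have hs1 : s ≤ 1 := by
    have h5 : l ^ 5 ≤ 1 := pow_le_one₀ hl.le hl1
    have : 1 ≤ 8 * C ^ 2 * (K + 1) := by nlinarith [sq_nonneg C]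
    nlinarith
  have hw2 : ContDiff ℝ 2 w := hw.of_le (by norm_num)
  have hsub : closedBall x₀ s⁻¹ ⊆ closedBall x₀ (2 * s⁻¹) :=
    closedBall_subset_closedBall (by linarith [inv_pos.2 hs])
  have hone : ∀ x ∈ closedBall x₀ s⁻¹, |w x| ≤ 1 + B1 * s := by
    intro x hx
    have hsub2 : closedBall x s⁻¹ ⊆ closedBall x₀ (2 * s⁻¹) :=
      closedBall_subset_closedBall' (by linarith [mem_closedBall.1 hx])
    exact abs_le_one_add_of_chem hw2 (by linarith) hA hs hs1 (fun y hy => (hyp y (hsub2 hy)).1)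
      fun y hy => (hyp y (hsub2 hy)).2.1
  set G : ℝ → ℝ := fun t => l ^ 2 * (1 / 2 - t ^ 2 / (4 * C ^ 2)) with hG
  set G1 : ℝ → ℝ := fun t => -(l ^ 2 * t / (2 * C ^ 2)) with hG1
  have hGd : ∀ t, HasDerivAt G (G1 t) t := fun t => by
    refine ((((hasDerivAt_pow 2 t).div_const (4 * C ^ 2)).const_sub (1 / 2)).const_mul
      (l ^ 2)).congr_deriv ?_
    simp only [hG1]; field_simp; norm_num; ring
  have hG1d : ∀ t, HasDerivAt G1 (-(l ^ 2 / (2 * C ^ 2))) t := fun t => by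
    refine ((((hasDerivAt_id t).const_mul (l ^ 2)).div_const (2 * C ^ 2)).neg).congr_deriv ?_
    simp
  have hGc : ContDiff ℝ 2 G :=
    contDiff_const.mul (contDiff_const.sub ((contDiff_id.pow 2).div_const _))
  have hGw : ContDiff ℝ 2 fun y => G (w y) := hGc.comp hw2
  have hn2 : ContDiff ℝ 2 fun y : E 3 => ‖y - x₀‖ ^ 2 := contDiff_norm_sub_sq x₀
  have hp2 : ContDiff ℝ 2 fun y : E 3 => M * s ^ 2 * ‖y - x₀‖ ^ 2 := contDiff_const.mul hn2
  have hdis := contDiff_discr hw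
  have hGlow : ∀ t, |t| ≤ C → l ^ 2 / 4 ≤ G t := fun t ht => by
    have : t ^ 2 ≤ C ^ 2 := by rw [← sq_abs t]; gcongr
    have h2 : t ^ 2 / (4 * C ^ 2) ≤ 1 / 4 := by
      rw [div_le_div_iff₀ (by positivity) (by norm_num)]; linarith
    simp only [hG]
    nlinarith [sq_nonneg l]
  have hgrad : ∀ x ∈ closedBall x₀ s⁻¹, gradSq w x ≤ 3 * A ^ 2 := fun x hx => by
    have h : ∀ i, pd i w x ^ 2 ≤ A ^ 2 := fun i => by
      rw [← sq_abs]; gcongr; exact ((hyp x (hsub hx)).2.2 i).1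
    simp only [gradSq, Fin.sum_univ_three]
    linarith [h 0, h 1, h 2]
  have main := le_of_interior_test
    (φ := fun y => (discr w y - G (w y)) - M * s ^ 2 * ‖y - x₀‖ ^ 2) (x₀ := x₀) (L := s⁻¹) (B := 0)
    ((hdis.sub hGw).sub hp2) (fun x hx => ?_) (fun x hx hpd hlap => ?_)
  · have h := main x₀ (mem_closedBall_self (by positivity))
    have h2 : G (w x₀) ≤ l ^ 2 := by
      have : 0 ≤ w x₀ ^ 2 / (4 * C ^ 2) := by positivity
      simp only [hG]; nlinarith [sq_nonneg l]
    simp at h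
    linarith
  · have hmem := mem_closedBall.2 hx.le
    have hbx := (hyp x (hsub hmem)).1
    have e : M * s ^ 2 * ‖x - x₀‖ ^ 2 = M := by
      rw [← dist_eq_norm, hx]; field_simp
    have h1 := hGlow _ hbx
    have h2 := hgrad x hmem
    have h3 := W_nonneg (w x)
    have : 0 ≤ l ^ 2 := sq_nonneg l
    simp only [discr]
    rw [e]
    linarith
  · by_contra hpos
    rw [not_le] at hpos
    have hmem := mem_closedBall.2 hx.le
    obtain ⟨hbx, hfx, hpx⟩ := hyp x (hsub hmem)
    have hdG : ContDiff ℝ 2 fun y => discr w y - G (w y) := hdis.sub hGw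
    rw [lap_sub hdG hp2, lap_sub hdis hGw, lap_const_mul hn2, lap_norm_sub_sq,
      lap_comp hGd hG1d hGc hw2, lap_discr hw, show lap w x = W' (w x) + chem w x by
        simp [chem]] at hlap
    have hpd' : ∀ i, ∑ j, pd j w x * pd i (pd j w) x
        = (W' (w x) - l ^ 2 * w x / (2 * C ^ 2)) * pd i w x + 2 * M * s ^ 2 * (x - x₀) i := by
      intro i
      have h := hpd i
      have hdd : ∀ {f : E 3 → ℝ}, ContDiff ℝ 2 f → DifferentiableAt ℝ f x := fun hf =>
        hf.differentiable (by norm_num) x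
      rw [pd_sub i (hdd hdG) (hdd hp2), pd_sub i (hdd hdis) (hdd hGw), pd_const_mul i _ (hdd hn2),
        pd_norm_sub_sq, pd_comp_eq hGd (hw.of_le (by norm_num)), pd_discr hw2] at h
      simp only [hG1] at h
      have e : (x - x₀) i = x i - x₀ i := rfl
      simp only [e] at h ⊢
      linarith
    have hN : l ^ 2 / 2 ≤ gradSq w x := by
      have h1 := hGlow _ hbx
      have h2 : 0 ≤ M * s ^ 2 * ‖x - x₀‖ ^ 2 := by positivity
      have h3 := W_nonneg (w x)
      simp only [discr] at hpos
      linarith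
    have he : ∑ i, (2 * M * s ^ 2 * (x - x₀) i) ^ 2 ≤ (2 * M * s) ^ 2 := by
      have e1 : ∑ i, (2 * M * s ^ 2 * (x - x₀) i) ^ 2 = (2 * M * s ^ 2) ^ 2 * ‖x - x₀‖ ^ 2 := by
        rw [norm_sq_eq_sum, Finset.mul_sum]
        exact Finset.sum_congr rfl fun i _ => by ring
      have e2 : ‖x - x₀‖ ≤ s⁻¹ := by rw [← dist_eq_norm]; exact hx.le
      rw [e1]
      calc (2 * M * s ^ 2) ^ 2 * ‖x - x₀‖ ^ 2 ≤ (2 * M * s ^ 2) ^ 2 * s⁻¹ ^ 2 := by gcongr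
        _ = _ := by field_simp
    have hvg : -(3 * A ^ 2 * s) ≤ ∑ j, pd j w x * pd j (chem w) x := by
      have h : ∀ j, -(A * (A * s)) ≤ pd j w x * pd j (chem w) x := fun j => by
        have : |pd j w x * pd j (chem w) x| ≤ A * (A * s) := by
          rw [abs_mul]; exact mul_le_mul (hpx j).1 (hpx j).2 (abs_nonneg _) hA
        exact (abs_le.1 this).1
      rw [Fin.sum_univ_three]
      linarith [h 0, h 1, h 2]
    have hX := hessian_sq_lower_bound (v := fun j => pd j w x) (H := fun i j => pd i (pd j w) x)
      hpd' hl hN (by positivity) he (abs_W'_sub_linear_le hC hl hl1 hbx)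
    refine modica_algebra hC hA hMp hB1p hB hB2 hK hs hs1 hl hl1 hsl hbx (hone x hmem) hfx hN hvg
      hX rfl ?_
    simp only [hG1] at hlap
    linarith

/-- The approximate Modica inequality for mollifications of functions with small chemical
potential. -/
lemma exists_discr_avg_le {C : ℝ} (hC : 1 ≤ C) :
    ∃ θ : ℝ, 0 < θ ∧ θ ≤ 1 ∧ ∀ l : ℝ, 0 < l → l ≤ 1 → ∀ s : ℝ, s = θ * l ^ 5 →
    ∀ u : E 3 → ℝ, ContDiff ℝ 2 u → HasCompactSupport u → ∀ x₀ : E 3,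
    (∀ x ∈ closedBall x₀ (2 * s⁻¹), GoodAt C s u x) → discr (avg kerK s u) x₀ ≤ l ^ 2 := by
  obtain ⟨A1, hA1, h1⟩ := exists_abs_pd_avg_le C
  obtain ⟨A2, hA2, h2⟩ := exists_abs_chem_avg_le C
  obtain ⟨A3, hA3, h3⟩ := exists_abs_pd_chem_avg_le C
  obtain ⟨θ, hθ, hθ1, h⟩ := exists_modica (A := A1 + A2 + A3) hC (by positivity)
  refine ⟨θ, hθ, hθ1, fun l hl hl1 s hs u hu huc x₀ hg => h l hl hl1 s hs _ ?_ x₀ ?_⟩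
  · exact contDiff_avg_kerK hu.continuous (by rw [hs]; positivity)
  intro x hx
  have hs0 : 0 < s := by rw [hs]; positivity
  have hs1 : s ≤ 1 := by
    rw [hs]; exact mul_le_one₀ hθ1 (by positivity) (pow_le_one₀ hl.le hl1)
  have hgx := hg x hx
  refine ⟨hgx.abs_avg_kerK_le hs0 hs1, (h2 hgx hu huc hs0 hs1).trans ?_, fun i =>
    ⟨(h1 hgx hu huc hs0 hs1 (by simp) i).trans ?_, (h3 hgx hu huc hs0 hs1 i).trans ?_⟩⟩
  · gcongr; linarith
  · linarith
  · gcongr; linarith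

lemma setIntegral_swap_of_continuous {X Y : Type*} [TopologicalSpace X] [TopologicalSpace Y]
    [MeasurableSpace X] [MeasurableSpace Y] [BorelSpace X] [BorelSpace Y] [T2Space X] [T2Space Y]
    [SecondCountableTopology X] [SecondCountableTopology Y]
    {μ : Measure X} {ν : Measure Y} [SFinite μ] [SFinite ν] [IsFiniteMeasureOnCompacts μ]
    [IsFiniteMeasureOnCompacts ν] {F : X → Y → ℝ}
    (hF : Continuous (Function.uncurry F)) {K : Set X} {L : Set Y} (hK : IsCompact K)
    (hL : IsCompact L) :
    ∫ x in K, ∫ y in L, F x y ∂ν ∂μ = ∫ y in L, ∫ x in K, F x y ∂μ ∂ν := by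
  refine integral_integral_swap ?_
  rw [Measure.prod_restrict]
  obtain ⟨C, hC⟩ := (hK.prod hL).exists_bound_of_continuousOn hF.continuousOn
  refine IntegrableOn.of_bound ?_ hF.aestronglyMeasurable C ?_
  · rw [Measure.prod_prod]
    exact ENNReal.mul_lt_top hK.measure_lt_top hL.measure_lt_top
  · exact (ae_restrict_iff' (hK.prod hL).measurableSet).2 (Eventually.of_forall fun p hp => hC p hp)

lemma continuous_avg {κ F : E 3 → ℝ} (hκ : Continuous κ) (hκ1 : ∀ y, 1 < ‖y‖ → κ y = 0)
    (hF : Continuous F) : Continuous fun p : ℝ × E 3 => avg κ p.1 F p.2 := by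
  have e : (fun p : ℝ × E 3 => avg κ p.1 F p.2)
      = fun p : ℝ × E 3 => ∫ y in closedBall (0 : E 3) 1, κ y * F (p.2 - p.1 • y) := by
    ext p
    rw [avg, setIntegral_eq_integral_of_forall_compl_eq_zero]
    intro y hy
    rw [hκ1 y (by simpa using hy), zero_mul]
  rw [e]
  exact continuous_parametric_integral_of_continuous
    (f := fun (p : ℝ × E 3) y => κ y * F (p.2 - p.1 • y))
    ((hκ.comp continuous_snd).mul (hF.comp (by fun_prop))) (isCompact_closedBall 0 1)

lemma continuous_avg_scale {κ F : E 3 → ℝ} (hκ : Continuous κ) (hκ1 : ∀ y, 1 < ‖y‖ → κ y = 0)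
    (hF : Continuous F) (x : E 3) : Continuous fun t : ℝ => avg κ t F x := by
  have h : Continuous fun t : ℝ => (t, x) := by fun_prop
  exact Continuous.comp (g := fun p : ℝ × E 3 => avg κ p.1 F p.2) (continuous_avg hκ hκ1 hF) h

lemma setIntegral_closedBall_comp_sub {G : E 3 → ℝ} (x z : E 3) (r : ℝ) :
    ∫ y in closedBall x r, G (y - z) = ∫ y in closedBall (x - z) r, G y := by
  have h := (measurePreserving_sub_right (volume : Measure (E 3)) z).setIntegral_preimage_emb
    (MeasurableEquiv.subRight z).measurableEmbedding G (closedBall (x - z) r)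
  rw [← h]
  congr 2
  ext y; simp [dist_eq_norm]

lemma setIntegral_avg_sq_le {κ F : E 3 → ℝ} (hκ : Continuous κ) (hκ1 : ∀ y, 1 < ‖y‖ → κ y = 0)
    (hF : Continuous F) {t : ℝ} (ht : 0 ≤ t) (ht1 : t ≤ 1) (x : E 3) (r : ℝ) :
    ∫ z in closedBall x r, avg κ t F z ^ 2
      ≤ (∫ y, κ y ^ 2) * volume.real (closedBall (0 : E 3) 1) * ∫ z in closedBall x (r + 1), F z ^ 2 := by
  have hc : Continuous (Function.uncurry fun (z y : E 3) => F (z - t • y) ^ 2) :=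
    (hF.comp (by fun_prop)).pow 2
  have hB := isCompact_closedBall (0 : E 3) 1
  have hr := isCompact_closedBall x r
  have hκ0 : 0 ≤ ∫ y, κ y ^ 2 := integral_nonneg fun _ => sq_nonneg _
  have hcav : Continuous fun z => avg κ t F z :=
    (continuous_avg hκ hκ1 hF).comp (by fun_prop : Continuous fun z : E 3 => (t, z))
  have hcp : Continuous fun z : E 3 => ∫ y in closedBall (0 : E 3) 1, F (z - t • y) ^ 2 :=
    continuous_parametric_integral_of_continuous hc hB
  calc ∫ z in closedBall x r, avg κ t F z ^ 2
      ≤ ∫ z in closedBall x r, (∫ y, κ y ^ 2) * ∫ y in closedBall (0 : E 3) 1, F (z - t • y) ^ 2 :=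
        setIntegral_mono ((hcav.pow 2).continuousOn.integrableOn_compact hr)
          ((hcp.const_mul _).continuousOn.integrableOn_compact hr)
          fun z => avg_sq_le_unit hκ hκ1 hF t z
    _ = (∫ y, κ y ^ 2) * ∫ y in closedBall (0 : E 3) 1, ∫ z in closedBall x r, F (z - t • y) ^ 2 := by
        rw [integral_const_mul, setIntegral_swap_of_continuous hc hr hB]
    _ ≤ (∫ y, κ y ^ 2) * ∫ _ in closedBall (0 : E 3) 1, ∫ z in closedBall x (r + 1), F z ^ 2 := by
        refine mul_le_mul_of_nonneg_left ?_ hκ0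
        have hc' : Continuous (Function.uncurry fun (y z : E 3) => F (z - t • y) ^ 2) :=
          (hF.comp (by fun_prop)).pow 2
        refine setIntegral_mono_on ((continuous_parametric_integral_of_continuous
          hc' hr).continuousOn.integrableOn_compact hB)
          (continuous_const.continuousOn.integrableOn_compact hB) hB.measurableSet fun y hy => ?_
        rw [setIntegral_closedBall_comp_sub (G := fun z => F z ^ 2)]
        refine setIntegral_closedBall_mono (hF.pow 2) (fun _ => sq_nonneg _) ?_
        have : ‖t • y‖ ≤ 1 := by
          rw [norm_smul, Real.norm_eq_abs, abs_of_nonneg ht]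
          exact mul_le_one₀ ht1 (norm_nonneg _) (by simpa using hy)
        rw [dist_eq_norm, sub_sub_cancel_left, norm_neg]
        linarith
    _ = _ := by
        rw [setIntegral_const, smul_eq_mul]; ring

lemma pd_avg_sub_sq_le {u : E 3 → ℝ} (hu : ContDiff ℝ 2 u) (huc : HasCompactSupport u) {s : ℝ}
    (hs : 0 < s) (i : Fin 3) (x : E 3) :
    (pd i u x - pd i (avg kerK s u) x) ^ 2
      ≤ s * ∫ t in Icc 0 s, avg (pd i kerQ) t (lap u) x ^ 2 := by
  have hg := continuous_avg_scale (continuous_pd_kerQ i) (pd_eq_zero_of_unit kerQ_eq_zero i)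
    (continuous_lap hu) x
  have hk := continuous_avg_scale contDiff_kerK.continuous kerK_eq_zero
    (continuous_pd i (hu.of_le (by norm_num))) x
  have hintg : ∫ t in (0 : ℝ)..s, avg (pd i kerQ) t (lap u) x
      = avg kerK s (pd i u) x - avg kerK 0 (pd i u) x :=
    intervalIntegral.integral_eq_sub_of_hasDerivAt_of_le (f := fun t => avg kerK t (pd i u) x)
      (f' := fun t => avg (pd i kerQ) t (lap u) x) hs.le hk.continuousOn
      (fun t ht => hasDerivAt_avg_kerK_pd hu huc (ne_of_gt ht.1) x i) (hg.intervalIntegrable _ _)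
  rw [avg_kerK_zero, ← pd_avg_right (contDiff_kerK.of_le (by norm_num)) hasCompactSupport_kerK
    (hu.of_le (by norm_num)) hs, intervalIntegral.integral_of_le hs.le,
    ← integral_Icc_eq_integral_Ioc] at hintg
  have hI := isCompact_Icc (a := (0 : ℝ)) (b := s)
  have h := cauchy_schwarz_integral (μ := volume.restrict (Icc 0 s)) (a := fun _ : ℝ => (1 : ℝ))
    (b := fun t => avg (pd i kerQ) t (lap u) x)
    (continuous_const.continuousOn.integrableOn_compact hI)
    ((hg.pow 2).continuousOn.integrableOn_compact hI)
    ((continuous_const.mul hg).continuousOn.integrableOn_compact hI)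
  simp only [one_mul, one_pow, hintg, setIntegral_const, smul_eq_mul, mul_one] at h
  rw [Real.volume_real_Icc_of_le hs.le, sub_zero] at h
  linarith [sq_abs (pd i u x - pd i (avg kerK s u) x), h,
    (by ring : (pd i u x - pd i (avg kerK s u) x) ^ 2 = (pd i (avg kerK s u) x - pd i u x) ^ 2)]

/-- Mollification at scale `s` changes the gradient by at most `s` in mean square. -/
lemma exists_integral_pd_sub_avg_sq_le : ∃ A : ℝ, 0 ≤ A ∧ ∀ u : E 3 → ℝ, ContDiff ℝ 2 u →
    HasCompactSupport u → ∀ s : ℝ, 0 < s → s ≤ 1 → ∀ (x : E 3) (r : ℝ),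
    ∫ z in closedBall x r, ∑ i, (pd i u z - pd i (avg kerK s u) z) ^ 2
      ≤ A * s ^ 2 * ∫ z in closedBall x (r + 1), lap u z ^ 2 := by
  set a : Fin 3 → ℝ := fun i => (∫ y, pd i kerQ y ^ 2) * volume.real (closedBall (0 : E 3) 1) with ha
  have ha0 : ∀ i, 0 ≤ a i := fun i =>
    mul_nonneg (integral_nonneg fun _ => sq_nonneg _) measureReal_nonneg
  refine ⟨∑ i, a i, Finset.sum_nonneg fun i _ => ha0 i, fun u hu huc s hs hs1 x r => ?_⟩
  have hr := isCompact_closedBall x r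
  have hI := isCompact_Icc (a := (0 : ℝ)) (b := s)
  have hd : ∀ i, Continuous fun z => (pd i u z - pd i (avg kerK s u) z) ^ 2 := fun i =>
    ((continuous_pd i (hu.of_le (by norm_num))).sub (continuous_pd i
      ((contDiff_avg_kerK hu.continuous hs).of_le (by norm_num)))).pow 2
  rw [integral_finsetSum _ fun i _ => (hd i).continuousOn.integrableOn_compact hr, Finset.sum_mul,
    Finset.sum_mul]
  refine Finset.sum_le_sum fun i _ => ?_
  have hcg : Continuous (Function.uncurry fun (z : E 3) (t : ℝ) => avg (pd i kerQ) t (lap u) z ^ 2) :=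
    ((continuous_avg (continuous_pd_kerQ i) (pd_eq_zero_of_unit kerQ_eq_zero i)
      (continuous_lap hu)).comp continuous_swap).pow 2
  have hcg' : Continuous (Function.uncurry fun (t : ℝ) (z : E 3) => avg (pd i kerQ) t (lap u) z ^ 2) :=
    (continuous_avg (continuous_pd_kerQ i) (pd_eq_zero_of_unit kerQ_eq_zero i)
      (continuous_lap hu)).pow 2
  calc ∫ z in closedBall x r, (pd i u z - pd i (avg kerK s u) z) ^ 2
      ≤ ∫ z in closedBall x r, s * ∫ t in Icc 0 s, avg (pd i kerQ) t (lap u) z ^ 2 :=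
        setIntegral_mono ((hd i).continuousOn.integrableOn_compact hr)
          (((continuous_parametric_integral_of_continuous hcg hI).const_mul
            s).continuousOn.integrableOn_compact hr)
          fun z => pd_avg_sub_sq_le hu huc hs i z
    _ = s * ∫ t in Icc 0 s, ∫ z in closedBall x r, avg (pd i kerQ) t (lap u) z ^ 2 := by
        rw [integral_const_mul, setIntegral_swap_of_continuous hcg hr hI]
    _ ≤ s * ∫ _ in Icc 0 s, a i * ∫ z in closedBall x (r + 1), lap u z ^ 2 := by
        refine mul_le_mul_of_nonneg_left ?_ hs.le
        refine setIntegral_mono_on ((continuous_parametric_integral_of_continuous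
          hcg' hr).continuousOn.integrableOn_compact hI)
          (continuous_const.continuousOn.integrableOn_compact hI) hI.measurableSet fun t ht => ?_
        exact setIntegral_avg_sq_le (continuous_pd_kerQ i) (pd_eq_zero_of_unit kerQ_eq_zero i)
          (continuous_lap hu) ht.1 (ht.2.trans hs1) x r
    _ = _ := by
        rw [setIntegral_const, smul_eq_mul, Real.volume_real_Icc_of_le hs.le]; ring

/-- A fixed smooth bump, equal to one on the unit ball and supported in the ball of radius two. -/
def unitBump : ContDiffBump (0 : E 3) := ⟨1, 2, one_pos, one_lt_two⟩

/-- A smooth cutoff between the balls of radius `R` and `2 * R` about `y`. -/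
def cut (y : E 3) (R : ℝ) (x : E 3) : ℝ := unitBump (R⁻¹ • (x - y))

section cutoff

variable {y x : E 3} {R : ℝ}

lemma contDiff_cut {n : ℕ∞} (y : E 3) (R : ℝ) : ContDiff ℝ n (cut y R) :=
  unitBump.contDiff.comp (by fun_prop)

lemma cut_nonneg (y : E 3) (R : ℝ) (x : E 3) : 0 ≤ cut y R x := unitBump.nonneg

lemma cut_le_one (y : E 3) (R : ℝ) (x : E 3) : cut y R x ≤ 1 := unitBump.le_one

lemma cut_eq_one (hR : 0 < R) (hx : x ∈ closedBall y R) : cut y R x = 1 := by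
  refine unitBump.one_of_mem_closedBall ?_
  rw [mem_closedBall, dist_eq_norm] at hx
  rw [mem_closedBall, dist_zero_right, norm_smul, norm_inv, Real.norm_eq_abs, abs_of_pos hR]
  change R⁻¹ * ‖x - y‖ ≤ 1
  rw [inv_mul_le_one₀ hR]
  exact hx

lemma cut_eq_zero (hR : 0 < R) (hx : 2 * R ≤ dist x y) : cut y R x = 0 := by
  refine unitBump.zero_of_le_dist ?_
  rw [dist_zero_right, norm_smul, norm_inv, Real.norm_eq_abs, abs_of_pos hR, ← dist_eq_norm]
  change 2 ≤ R⁻¹ * dist x y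
  rw [le_inv_mul_iff₀ hR]
  linarith

lemma cut_eq_zero_of_notMem (hR : 0 < R) (hx : x ∉ closedBall y (2 * R)) : cut y R x = 0 :=
  cut_eq_zero hR (by rw [mem_closedBall, not_le] at hx; exact hx.le)

lemma hasCompactSupport_cut (hR : 0 < R) : HasCompactSupport (cut y R) :=
  HasCompactSupport.intro (isCompact_closedBall y (2 * R)) fun _ hx => cut_eq_zero_of_notMem hR hx

lemma pd_cut_eq_zero_of_lt (hR : 0 < R) (hx : dist x y < R) (i : Fin 3) : pd i (cut y R) x = 0 := by
  have : cut y R =ᶠ[nhds x] fun _ => (1 : ℝ) := by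
    filter_upwards [isOpen_ball.mem_nhds (mem_ball.2 hx)] with z hz
    exact cut_eq_one hR (ball_subset_closedBall hz)
  rw [pd, this.fderiv_eq]; simp

lemma pd_cut_eq_zero_of_notMem (hR : 0 < R) (hx : x ∉ closedBall y (2 * R)) (i : Fin 3) :
    pd i (cut y R) x = 0 := by
  have : cut y R =ᶠ[nhds x] fun _ => (0 : ℝ) := by
    filter_upwards [isClosed_closedBall.isOpen_compl.mem_nhds hx] with z hz
    exact cut_eq_zero_of_notMem hR hz
  rw [pd, this.fderiv_eq]; simp

lemma exists_abs_pd_cut_le : ∃ c : ℝ, 0 ≤ c ∧ ∀ (y : E 3) (R : ℝ), 0 < R → ∀ i x,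
    |pd i (cut y R) x| ≤ c / R := by
  have hb1 : ContDiff ℝ 1 (unitBump : E 3 → ℝ) := unitBump.contDiff
  have hbc : HasCompactSupport (unitBump : E 3 → ℝ) := unitBump.hasCompactSupport
  choose c hc0 hc using fun i =>
    exists_abs_le_of_hasCompactSupport (continuous_pd i hb1) (hasCompactSupport_pd i hbc)
  refine ⟨∑ i, c i, Finset.sum_nonneg fun i _ => hc0 i, fun y R hR i x => ?_⟩
  have e : cut y R = fun x => unitBump (-(R⁻¹ • y) + R⁻¹ • x) := by
    ext x; rw [cut]; congr 1; rw [smul_sub]; abel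
  rw [e, pd_comp_affine i _ _ _ (hb1.differentiable (by norm_num) _), abs_mul, abs_of_pos (inv_pos.2 hR),
    mul_comm, div_eq_mul_inv]
  gcongr
  exact (hc i _).trans (Finset.single_le_sum (f := c) (fun i _ => hc0 i) (Finset.mem_univ i))

lemma exists_gradSq_cut_le : ∃ c : ℝ, 0 ≤ c ∧ ∀ (y : E 3) (R : ℝ), 0 < R → ∀ x,
    gradSq (cut y R) x ≤ c / R ^ 2 := by
  obtain ⟨c, hc0, hc⟩ := exists_abs_pd_cut_le
  refine ⟨3 * c ^ 2, by positivity, fun y R hR x => ?_⟩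
  have h : ∀ i, pd i (cut y R) x ^ 2 ≤ c ^ 2 / R ^ 2 := fun i => by
    rw [← sq_abs, ← div_pow]
    exact pow_le_pow_left₀ (abs_nonneg _) (hc y R hR i x) 2
  simp only [gradSq, Fin.sum_univ_three]
  have e : 3 * c ^ 2 / R ^ 2 = c ^ 2 / R ^ 2 + c ^ 2 / R ^ 2 + c ^ 2 / R ^ 2 := by ring
  linarith [h 0, h 1, h 2]

lemma gradSq_cut_eq_zero_of_notMem (hR : 0 < R) (hx : x ∉ closedBall y (2 * R)) :
    gradSq (cut y R) x = 0 := by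
  simp [gradSq, pd_cut_eq_zero_of_notMem hR hx]

end cutoff

lemma abs_sum_mul_pd_sq_le (χ u : E 3 → ℝ) (x : E 3) :
    (∑ i, pd i χ x * pd i u x) ^ 2 ≤ gradSq χ x * gradSq u x :=
  Finset.sum_mul_sq_le_sq_mul_sq _ _ _

/-- Testing the Laplacian of `u` with a function of `u`, localised by a cutoff. -/
lemma integral_test_comp {u χ : E 3 → ℝ} {h h' : ℝ → ℝ} (hu : ContDiff ℝ 2 u) (hχ : ContDiff ℝ 2 χ)
    (hχc : HasCompactSupport χ) (hh : ∀ t, HasDerivAt h (h' t) t) (hhc : ContDiff ℝ 1 h) :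
    Integrable (fun x => χ x ^ 2 * h' (u x) * gradSq u x + χ x ^ 2 * h (u x) * lap u x
      + 2 * χ x * h (u x) * ∑ i, pd i χ x * pd i u x) ∧
    ∫ x, (χ x ^ 2 * h' (u x) * gradSq u x + χ x ^ 2 * h (u x) * lap u x
      + 2 * χ x * h (u x) * ∑ i, pd i χ x * pd i u x) = 0 := by
  have hu1 : ContDiff ℝ 1 u := hu.of_le (by norm_num)
  have hχ1 : ContDiff ℝ 1 χ := hχ.of_le (by norm_num)
  have hhu : ContDiff ℝ 1 fun x => h (u x) := hhc.comp hu1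
  have hφ : ContDiff ℝ 1 fun x => χ x ^ 2 * h (u x) := (hχ1.pow 2).mul hhu
  have hφc : HasCompactSupport fun x => χ x ^ 2 * h (u x) :=
    HasCompactSupport.intro hχc fun x hx => by simp [image_eq_zero_of_notMem_tsupport hx]
  have hp : ∀ i x, pd i (fun x => χ x ^ 2 * h (u x)) x
      = 2 * χ x * pd i χ x * h (u x) + χ x ^ 2 * (h' (u x) * pd i u x) := fun i x => by
    have hd2 : DifferentiableAt ℝ (fun x => χ x ^ 2) x := (hχ1.pow 2).differentiable (by norm_num) x
    rw [pd_mul i hd2 (hhu.differentiable (by norm_num) x), pd_comp_eq hh hu1,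
      pd_comp (φ := fun t => t ^ 2) (φ' := 2 * χ x) i (by simpa using hasDerivAt_pow 2 (χ x))
        (hχ1.differentiable (by norm_num) x)]
  have hf1 : ∀ i, Integrable fun x => pd i (fun x => χ x ^ 2 * h (u x)) x * pd i u x := fun i =>
    ((continuous_pd i hφ).mul (continuous_pd i hu1)).integrable_of_hasCompactSupport
      (hasCompactSupport_pd i hφc).mul_right
  have hf2 : ∀ i, Integrable fun x => χ x ^ 2 * h (u x) * pd i (pd i u) x := fun i =>
    (hφ.continuous.mul (continuous_pd i (contDiff_one_pd i hu))).integrable_of_hasCompactSupport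
      hφc.mul_right
  have e : (fun x => χ x ^ 2 * h' (u x) * gradSq u x + χ x ^ 2 * h (u x) * lap u x
      + 2 * χ x * h (u x) * ∑ i, pd i χ x * pd i u x)
      = fun x => ∑ i, (pd i (fun x => χ x ^ 2 * h (u x)) x * pd i u x
        + χ x ^ 2 * h (u x) * pd i (pd i u) x) := by
    ext x
    simp only [hp, lap_eq hu, gradSq, Fin.sum_univ_three]
    ring
  rw [e]
  refine ⟨integrable_finsetSum _ fun i _ => (hf1 i).fun_add (hf2 i), ?_⟩
  rw [integral_finsetSum _ fun i _ => (hf1 i).fun_add (hf2 i)]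
  refine Finset.sum_eq_zero fun i _ => ?_
  rw [integral_add (hf1 i) (hf2 i), integral_pd_mul hφ (contDiff_one_pd i hu) hφc]
  ring

/-- A convex truncation used to localise near the wells. -/
def soft (z : ℝ) : ℝ := (z + Real.sqrt (z ^ 2 + 4) - 2) / 2

def soft' (z : ℝ) : ℝ := (1 + z / Real.sqrt (z ^ 2 + 4)) / 2

lemma contDiff_soft : ContDiff ℝ 1 soft := by
  have h : ContDiff ℝ 1 fun z : ℝ => Real.sqrt (z ^ 2 + 4) :=
    ((contDiff_id.pow 2).add contDiff_const).sqrt fun z => by positivity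
  exact ((contDiff_id.add h).sub contDiff_const).div_const 2

lemma hasDerivAt_soft (z : ℝ) : HasDerivAt soft (soft' z) z := by
  have h1 : HasDerivAt (fun z : ℝ => z ^ 2 + 4) (2 * z) z := by
    simpa using (hasDerivAt_pow 2 z).add_const 4
  have h2 := h1.sqrt (by positivity)
  refine (((hasDerivAt_id z).add h2).sub_const 2 |>.div_const 2).congr_deriv ?_
  simp only [soft']
  have : 0 < Real.sqrt (z ^ 2 + 4) := Real.sqrt_pos.2 (by positivity)
  field_simp

lemma abs_lt_sqrt_sq_add (z : ℝ) : |z| < Real.sqrt (z ^ 2 + 4) :=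
  Real.lt_sqrt_of_sq_lt (by rw [sq_abs]; linarith)

lemma soft'_nonneg (z : ℝ) : 0 ≤ soft' z := by
  have h := abs_lt_sqrt_sq_add z
  have h0 : 0 < Real.sqrt (z ^ 2 + 4) := (abs_nonneg z).trans_lt h
  have : -1 ≤ z / Real.sqrt (z ^ 2 + 4) := by
    rw [le_div_iff₀ h0]; linarith [neg_abs_le z]
  unfold soft'; linarith

lemma neg_one_le_soft (z : ℝ) : -1 ≤ soft z := by
  have h := abs_lt_sqrt_sq_add z
  unfold soft; linarith [neg_abs_le z]

lemma soft_sq_le (z : ℝ) : soft z ^ 2 ≤ z * soft z := by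
  have h : Real.sqrt (z ^ 2 + 4) ^ 2 = z ^ 2 + 4 := Real.sq_sqrt (by positivity)
  have h2 : 2 ≤ Real.sqrt (z ^ 2 + 4) := Real.le_sqrt_of_sq_le (by nlinarith [sq_nonneg z])
  unfold soft; nlinarith

lemma soft'_ge {z : ℝ} (hz : -1 ≤ z) : 1 / 4 ≤ soft' z := by
  have h := abs_lt_sqrt_sq_add z
  have h0 : 0 < Real.sqrt (z ^ 2 + 4) := (abs_nonneg z).trans_lt h
  have h2 : 2 ≤ Real.sqrt (z ^ 2 + 4) := Real.le_sqrt_of_sq_le (by nlinarith [sq_nonneg z])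
  have : -(1 / 2) ≤ z / Real.sqrt (z ^ 2 + 4) := by
    rw [le_div_iff₀ h0]; linarith
  unfold soft'; linarith

/-- The test nonlinearity. -/
def wellTest (m t : ℝ) : ℝ := t * (m * soft ((t ^ 2 - 1) / m))

def wellTest' (m t : ℝ) : ℝ := m * soft ((t ^ 2 - 1) / m) + 2 * t ^ 2 * soft' ((t ^ 2 - 1) / m)

lemma contDiff_wellTest (m : ℝ) : ContDiff ℝ 1 (wellTest m) :=
  contDiff_id.mul (contDiff_const.mul (contDiff_soft.comp
    (((contDiff_id.pow 2).sub contDiff_const).div_const m)))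

lemma hasDerivAt_wellTest {m : ℝ} (hm : 0 < m) (t : ℝ) :
    HasDerivAt (wellTest m) (wellTest' m t) t := by
  have h1 : HasDerivAt (fun t : ℝ => (t ^ 2 - 1) / m) (2 * t / m) t := by
    simpa using ((hasDerivAt_pow 2 t).sub_const 1).div_const m
  have h2 := ((hasDerivAt_soft _).comp t h1).const_mul m
  refine ((hasDerivAt_id t).mul h2).congr_deriv ?_
  simp only [wellTest', id]
  simp only [Function.comp_apply]
  field_simp

lemma wellTest_sq_le {m : ℝ} (hm : 0 < m) (t : ℝ) :
    wellTest m t ^ 2 ≤ wellTest m t * W' t := by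
  have h := soft_sq_le ((t ^ 2 - 1) / m)
  have e1 : wellTest m t ^ 2 = (t * m) ^ 2 * soft ((t ^ 2 - 1) / m) ^ 2 := by
    unfold wellTest; ring
  have e2 : wellTest m t * W' t
      = (t * m) ^ 2 * ((t ^ 2 - 1) / m * soft ((t ^ 2 - 1) / m)) := by
    unfold wellTest W'; field_simp
  rw [e1, e2]
  gcongr

lemma wellTest'_add_nonneg {m : ℝ} (hm : 0 < m) (t : ℝ) : 0 ≤ wellTest' m t + m := by
  have h1 := neg_one_le_soft ((t ^ 2 - 1) / m)
  have h2 := soft'_nonneg ((t ^ 2 - 1) / m)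
  have : 0 ≤ 2 * t ^ 2 * soft' ((t ^ 2 - 1) / m) := by positivity
  unfold wellTest'; nlinarith

lemma one_le_wellTest' {m t : ℝ} (hm : 0 < m) (hm1 : m ≤ 1 / 10) (ht : 1 - m ≤ t ^ 2) :
    1 ≤ 4 * (wellTest' m t + m) := by
  have hz : -1 ≤ (t ^ 2 - 1) / m := by rw [le_div_iff₀ hm]; linarith
  have h1 := neg_one_le_soft ((t ^ 2 - 1) / m)
  have h2 := soft'_ge hz
  unfold wellTest'
  nlinarith

lemma integral_wellTest_le {u χ : E 3 → ℝ} {m : ℝ} (hm : 0 < m) (hu : ContDiff ℝ 2 u)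
    (hχ : ContDiff ℝ 2 χ) (hχc : HasCompactSupport χ) :
    ∫ x, χ x ^ 2 * wellTest' m (u x) * gradSq u x
      ≤ ∫ x, (χ x ^ 2 * chem u x ^ 2 + 2 * (gradSq χ x * gradSq u x)) := by
  obtain ⟨hI, h0⟩ := integral_test_comp hu hχ hχc (hasDerivAt_wellTest hm) (contDiff_wellTest m)
  have hu1 : ContDiff ℝ 1 u := hu.of_le (by norm_num)
  have hχ1 : ContDiff ℝ 1 χ := hχ.of_le (by norm_num)
  have hw' : Continuous (wellTest' m) := by
    have : wellTest' m = deriv (wellTest m) := funext fun t => (hasDerivAt_wellTest hm t).deriv.symm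
    rw [this]
    exact (contDiff_wellTest m).continuous_deriv le_rfl
  have hc1 : Continuous fun x => χ x ^ 2 * wellTest' m (u x) * gradSq u x :=
    ((hχ.continuous.pow 2).mul (hw'.comp hu.continuous)).mul (continuous_gradSq hu1)
  have hc2 : Continuous fun x => χ x ^ 2 * chem u x ^ 2 + 2 * (gradSq χ x * gradSq u x) :=
    ((hχ.continuous.pow 2).mul ((continuous_chem hu).pow 2)).add
      (continuous_const.mul ((continuous_gradSq hχ1).mul (continuous_gradSq hu1)))
  have hz : ∀ x ∉ tsupport χ, χ x = 0 ∧ gradSq χ x = 0 := fun x hx => by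
    refine ⟨image_eq_zero_of_notMem_tsupport hx, ?_⟩
    have : ∀ i, pd i χ x = 0 := fun i => by
      rw [pd, fderiv_of_notMem_tsupport ℝ hx]; simp
    simp [gradSq, this]
  have hi1 : Integrable fun x => χ x ^ 2 * wellTest' m (u x) * gradSq u x :=
    hc1.integrable_of_hasCompactSupport (HasCompactSupport.intro hχc fun x hx => by
      simp [(hz x hx).1])
  have hi2 : Integrable fun x => χ x ^ 2 * chem u x ^ 2 + 2 * (gradSq χ x * gradSq u x) :=
    hc2.integrable_of_hasCompactSupport (HasCompactSupport.intro hχc fun x hx => by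
      simp [(hz x hx).1, (hz x hx).2])
  rw [← sub_nonpos, ← integral_sub hi1 hi2, ← h0]
  refine integral_mono (hi1.sub hi2) hI fun x => ?_
  have e : lap u x = W' (u x) + chem u x := by simp [chem]
  have h1 := mul_le_mul_of_nonneg_left (wellTest_sq_le hm (u x)) (sq_nonneg (χ x))
  have h2 := abs_sum_mul_pd_sq_le χ u x
  simp only [e]
  generalize ∑ i, pd i χ x * pd i u x = S at *
  generalize wellTest m (u x) = k at *
  nlinarith [sq_nonneg (χ x * k / 2 + χ x * chem u x), sq_nonneg (χ x * k + 2 * S),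
    sq_nonneg (χ x * k)]

/-- A Caccioppoli inequality. -/
lemma exists_integral_gradSq_le {C : ℝ} (hC : 1 ≤ C) : ∃ A : ℝ, 0 ≤ A ∧ ∀ u : E 3 → ℝ,
    ContDiff ℝ 2 u → ∀ (y : E 3) (L : ℝ), 1 ≤ L → (∀ x ∈ closedBall y (2 * L), |u x| ≤ C) →
    ∫ z in closedBall y (2 * L), chem u z ^ 2 ≤ 1 →
    ∫ z in closedBall y L, gradSq u z ≤ A * L ^ 3 := by
  obtain ⟨c, hc0, hc⟩ := exists_gradSq_cut_le
  set D := C * (C ^ 3 + C) + C ^ 2 + 2 * C ^ 2 * c with hD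
  have hD0 : 0 ≤ D := by positivity
  set b := volume.real (closedBall (0 : E 3) 1) with hb
  refine ⟨2 * (D * (8 * b) + 1), by positivity, fun u hu y L hL hbd hf => ?_⟩
  have hL0 : 0 < L := by linarith
  set χ := cut y L with hχdef
  have hχ : ContDiff ℝ 2 χ := contDiff_cut (n := 2) y L
  have hχc : HasCompactSupport χ := hasCompactSupport_cut hL0
  have hu1 : ContDiff ℝ 1 u := hu.of_le (by norm_num)
  obtain ⟨hI, h0⟩ := integral_test_comp hu hχ hχc (h := fun t => t) (h' := fun _ => 1)
    (fun t => hasDerivAt_id t) contDiff_id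
  have hz : ∀ x ∉ closedBall y (2 * L), χ x = 0 := fun x hx => cut_eq_zero_of_notMem hL0 hx
  have hK := isCompact_closedBall y (2 * L)
  rw [← setIntegral_eq_integral_of_forall_compl_eq_zero (s := closedBall y (2 * L))
    fun x hx => by simp [hz x hx]] at h0
  have hi1 : IntegrableOn (fun x => χ x ^ 2 * gradSq u x) (closedBall y (2 * L)) :=
    ((hχ.continuous.pow 2).mul (continuous_gradSq hu1)).continuousOn.integrableOn_compact hK
  have hi2 : IntegrableOn (fun x => D + chem u x ^ 2) (closedBall y (2 * L)) :=
    (continuous_const.fun_add ((continuous_chem hu).fun_pow 2)).continuousOn.integrableOn_compact hK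
  have hpt : ∫ x in closedBall y (2 * L), (1 / 2 * (χ x ^ 2 * gradSq u x) - (D + chem u x ^ 2))
      ≤ 0 := by
    rw [← h0]
    refine setIntegral_mono_on ((hi1.const_mul (1 / 2)).sub hi2) hI.integrableOn hK.measurableSet
      fun x hx => ?_
    have h1 := hbd x hx
    have h2 := abs_W'_le h1
    have h3 := abs_sum_mul_pd_sq_le χ u x
    have h4 : gradSq χ x ≤ c := (hc y L hL0 x).trans (div_le_self hc0 (one_le_pow₀ hL))
    have h5 := cut_nonneg y L x
    have h6 := cut_le_one y L x
    rw [← hχdef] at h5 h6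
    have e : lap u x = W' (u x) + chem u x := by simp [chem]
    have hg0 := gradSq_nonneg u x
    have hS : 2 * χ x * u x * ∑ i, pd i χ x * pd i u x
        ≥ -(1 / 2 * (χ x ^ 2 * gradSq u x)) - 2 * C ^ 2 * c := by
      set S := ∑ i, pd i χ x * pd i u x with hSdef
      have hu2 : u x ^ 2 ≤ C ^ 2 := by rw [← sq_abs (u x)]; gcongr
      have hS1 : |χ x * S| ≤ Real.sqrt (χ x ^ 2 * gradSq u x) * Real.sqrt c := by
        rw [← Real.sqrt_mul (by positivity)]
        refine Real.abs_le_sqrt ?_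
        calc (χ x * S) ^ 2 = χ x ^ 2 * S ^ 2 := by ring
          _ ≤ χ x ^ 2 * (c * gradSq u x) := by gcongr; exact h3.trans (by gcongr)
          _ = _ := by ring
      have ha := Real.sq_sqrt (by positivity : 0 ≤ χ x ^ 2 * gradSq u x)
      have hb := Real.sq_sqrt hc0
      generalize Real.sqrt (χ x ^ 2 * gradSq u x) = p at *
      generalize Real.sqrt c = r at *
      have hS2 : |u x * (χ x * S)| ≤ C * (|p * r|) := by
        rw [abs_mul]
        exact mul_le_mul h1 (hS1.trans (le_abs_self _)) (abs_nonneg _) (by linarith)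
      have hpr : C * |p * r| ≤ p ^ 2 / 4 + C ^ 2 * r ^ 2 := by
        have : (C * |p * r|) = |p| * (C * |r|) := by rw [abs_mul]; ring
        rw [this]
        nlinarith [sq_nonneg (|p| / 2 - C * |r|), sq_abs p, sq_abs r]
      have := (abs_le.1 hS2).1
      nlinarith
    have hlap : χ x ^ 2 * u x * lap u x ≥ -(C * (C ^ 3 + C) + C ^ 2 + chem u x ^ 2) := by
      have hm : |u x * lap u x| ≤ C * (C ^ 3 + C) + C ^ 2 + chem u x ^ 2 := by
        rw [e, mul_add]
        refine (abs_add_le _ _).trans ?_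
        rw [abs_mul, abs_mul]
        have k1 : |u x| * |W' (u x)| ≤ C * (C ^ 3 + C) :=
          mul_le_mul h1 h2 (abs_nonneg _) (by linarith)
        have k2 : |u x| * |chem u x| ≤ C ^ 2 + chem u x ^ 2 := by
          rw [← sq_abs (chem u x)]
          have k3 : |u x| * |chem u x| ≤ C * |chem u x| :=
            mul_le_mul_of_nonneg_right h1 (abs_nonneg _)
          nlinarith [sq_nonneg (C - |chem u x|), sq_nonneg (C + |chem u x|)]
        linarith
      have hsq : χ x ^ 2 ≤ 1 := pow_le_one₀ h5 h6
      have hm2 : |χ x ^ 2 * (u x * lap u x)| ≤ C * (C ^ 3 + C) + C ^ 2 + chem u x ^ 2 := by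
        rw [abs_mul, abs_of_nonneg (sq_nonneg (χ x))]
        exact (mul_le_of_le_one_left (abs_nonneg _) hsq).trans hm
      have := (abs_le.1 hm2).1
      rw [mul_assoc]
      exact this
    simp only [hD, mul_one]
    linarith
  rw [integral_sub (hi1.const_mul (1 / 2)) hi2, integral_const_mul,
    integral_add (continuous_const.continuousOn.integrableOn_compact hK)
      (((continuous_chem hu).fun_pow 2).continuousOn.integrableOn_compact hK),
    setIntegral_const, smul_eq_mul, Measure.addHaar_real_closedBall' volume y (by positivity)] at hpt
  have hlow : ∫ z in closedBall y L, gradSq u z ≤ ∫ x in closedBall y (2 * L), χ x ^ 2 * gradSq u x := by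
    have hcg := continuous_gradSq hu1
    calc ∫ z in closedBall y L, gradSq u z = ∫ z in closedBall y L, χ z ^ 2 * gradSq u z := by
          refine setIntegral_congr_fun measurableSet_closedBall fun z hz => ?_
          simp only [hχdef, cut_eq_one hL0 hz]; ring
      _ ≤ _ := setIntegral_closedBall_mono ((hχ.continuous.pow 2).mul hcg)
          (fun z => mul_nonneg (sq_nonneg _) (gradSq_nonneg u z)) (by simp; linarith)
  have hfr : Module.finrank ℝ (E 3) = 3 := by simp
  rw [hfr, ← hb] at hpt
  have hL3 : 1 ≤ L ^ 3 := one_le_pow₀ hL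
  nlinarith

/-- The unit-scale diffuse area density. -/
def en (u : E 3 → ℝ) (x : E 3) : ℝ := gradSq u x / 2 + W (u x)

lemma en_nonneg (u : E 3 → ℝ) (x : E 3) : 0 ≤ en u x := by
  have h1 := gradSq_nonneg u x
  have h2 := W_nonneg (u x)
  rw [en]; positivity

lemma gradSq_le_en (u : E 3 → ℝ) (x : E 3) : gradSq u x ≤ 2 * en u x := by
  have h2 := W_nonneg (u x)
  rw [en]; linarith

lemma W_le_en (u : E 3 → ℝ) (x : E 3) : W (u x) ≤ en u x := by
  have h2 := gradSq_nonneg u x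
  rw [en]; linarith

lemma continuous_W_comp {u : E 3 → ℝ} (hu : Continuous u) : Continuous fun x => W (u x) :=
  (contDiff_W (n := 0)).continuous.comp hu

lemma continuous_en {u : E 3 → ℝ} (hu : ContDiff ℝ 1 u) : Continuous (en u) :=
  ((continuous_gradSq hu).div_const 2).add (continuous_W_comp hu.continuous)

lemma abs_W_sub_le {C a b : ℝ} (ha : |a| ≤ C) (hb : |b| ≤ C) :
    |W a - W b| ≤ (C ^ 3 + C) * |a - b| := by
  have hC : 0 ≤ C := (abs_nonneg _).trans ha
  have ha2 : a ^ 2 ≤ C ^ 2 := sq_le_sq' (abs_le.1 ha).1 (abs_le.1 ha).2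
  have hb2 : b ^ 2 ≤ C ^ 2 := sq_le_sq' (abs_le.1 hb).1 (abs_le.1 hb).2
  have e : W a - W b = (a + b) * (a ^ 2 + b ^ 2 - 2) / 4 * (a - b) := by simp only [W]; ring
  rw [e, abs_mul]
  refine mul_le_mul_of_nonneg_right ?_ (abs_nonneg _)
  rw [abs_div, abs_mul, abs_of_pos (by norm_num : (0 : ℝ) < 4)]
  have h1 : |a + b| ≤ 2 * C := (abs_add_le _ _).trans (by linarith)
  have h2 : |a ^ 2 + b ^ 2 - 2| ≤ 2 * C ^ 2 + 2 :=
    abs_le.2 ⟨by nlinarith [sq_nonneg a, sq_nonneg b, sq_nonneg C], by linarith⟩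
  have := mul_le_mul h1 h2 (abs_nonneg _) (by positivity)
  rw [div_le_iff₀ (by norm_num)]
  linarith [(by ring : 2 * C * (2 * C ^ 2 + 2) = (C ^ 3 + C) * 4)]

lemma gradSq_le_of_sub {q : ℝ} (hq : 0 < q) (hq1 : q ≤ 1) (u w : E 3 → ℝ) (x : E 3) :
    gradSq u x ≤ (1 + q) * gradSq w x + 2 / q * ∑ i, (pd i u x - pd i w x) ^ 2 := by
  simp only [gradSq, Finset.mul_sum, ← Finset.sum_add_distrib]
  refine Finset.sum_le_sum fun i _ => ?_
  set a := pd i u x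
  set b := pd i w x
  have h : 2 / q * (a - b) ^ 2 = (2 * (a - b) ^ 2) / q := by ring
  rw [h, ← sub_le_iff_le_add', le_div_iff₀ hq]
  nlinarith [sq_nonneg (q * b - (a - b)), sq_nonneg (a - b), mul_nonneg (sub_nonneg.2 hq1) (sq_nonneg (a - b))]

lemma exists_discr_le_of_goodAt {C : ℝ} (hC : 1 ≤ C) : ∃ θ B : ℝ, 0 < θ ∧ θ ≤ 1 ∧ 1 ≤ B ∧
    ∀ q : ℝ, 0 < q → q ≤ 1 / 10 → ∀ s, s = θ * q ^ 10 → ∀ u : E 3 → ℝ, ContDiff ℝ 2 u →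
    HasCompactSupport u → ∀ x, (∀ z ∈ closedBall x (2 * s⁻¹), GoodAt C s u z) →
    discr u x ≤ B * q * W (u x) + B / q * ∑ i, (pd i u x - pd i (avg kerK s u) x) ^ 2
      + 2 * ((wellTest' q (u x) + q) * gradSq u x) := by
  obtain ⟨θ, hθ, hθ1, hd⟩ := exists_discr_avg_le hC
  obtain ⟨A, hA0, hA⟩ := exists_abs_sub_avg_le C
  set M := (C ^ 3 + C) * A + 1 with hM
  have hM1 : 1 ≤ M := by
    have : 0 ≤ (C ^ 3 + C) * A := by positivity
    linarith
  refine ⟨θ, 1 + 8 * M, hθ, hθ1, by linarith, fun q hq hq1 s hs u hu huc x hg => ?_⟩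
  have hq0 : q ≤ 1 := by linarith
  have hs0 : 0 < s := by rw [hs]; positivity
  have hsq : s ≤ q ^ 10 := by rw [hs]; exact mul_le_of_le_one_left (by positivity) hθ1
  have hs1 : s ≤ 1 := hsq.trans (pow_le_one₀ hq.le hq0)
  have hgx : GoodAt C s u x := hg x (mem_closedBall_self (by positivity))
  have hdw := hd (q ^ 2) (by positivity) (pow_le_one₀ hq.le hq0) s (by rw [hs]; ring) u hu huc x hg
  have hux := hA hgx hu huc hs0 hs1 (by simp : dist x x ≤ 1)
  have hw := hgx.abs_avg_kerK_le hs0 hs1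
  have hub := hgx.bound x (mem_closedBall_self (by norm_num))
  set w := avg kerK s u with hwdef
  set D := ∑ i, (pd i u x - pd i w x) ^ 2 with hD
  have hD0 : 0 ≤ D := Finset.sum_nonneg fun i _ => sq_nonneg _
  have hW0 := W_nonneg (u x)
  have hG0 := gradSq_nonneg u x
  have hDq : 0 ≤ D / q := by positivity
  have hdd : (1 + 8 * M) / q * D = (1 + 8 * M) * (D / q) := by ring
  rw [hdd]
  have hwt := wellTest'_add_nonneg hq (u x)
  rcases le_or_gt (1 - q) (u x ^ 2) with h | h
  · have h4 := one_le_wellTest' hq hq1 h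
    have h5 := mul_le_mul_of_nonneg_right h4 hG0
    have h6 : 0 ≤ (1 + 8 * M) * q * W (u x) := by positivity
    have h7 : 0 ≤ (1 + 8 * M) * (D / q) := by positivity
    simp only [discr]
    linarith
  · have hWq : q ^ 2 ≤ 4 * W (u x) := by
      have : q ^ 2 ≤ (1 - u x ^ 2) ^ 2 := pow_le_pow_left₀ hq.le (by linarith) 2
      rw [W]; linarith
    have hgrad := gradSq_le_of_sub hq hq0 u w x
    rw [← hD, (by ring : 2 / q * D = 2 * (D / q))] at hgrad
    have hWs := (le_abs_self _).trans (abs_W_sub_le hw hub)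
    rw [abs_sub_comm] at hWs
    have hs2 : s ^ 2 ≤ q ^ 4 := by
      calc s ^ 2 ≤ (q ^ 10) ^ 2 := pow_le_pow_left₀ hs0.le hsq 2
        _ = q ^ 20 := by ring
        _ ≤ q ^ 4 := pow_le_pow_of_le_one hq.le hq0 (by norm_num)
    have hWw : W (w x) ≤ W (u x) + (C ^ 3 + C) * A * q ^ 4 := by
      have k1 : (C ^ 3 + C) * |u x - w x| ≤ (C ^ 3 + C) * (A * q ^ 4) :=
        mul_le_mul_of_nonneg_left (hux.trans (mul_le_mul_of_nonneg_left hs2 hA0)) (by positivity)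
      linarith [(by ring : (C ^ 3 + C) * (A * q ^ 4) = (C ^ 3 + C) * A * q ^ 4)]
    have hw2 : gradSq w x / 2 ≤ W (u x) + M * q ^ 4 := by
      have k0 : gradSq w x / 2 - W (w x) ≤ (q ^ 2) ^ 2 := hdw
      have k1 : M * q ^ 4 = (C ^ 3 + C) * A * q ^ 4 + q ^ 4 := by rw [hM]; ring
      linarith [(by ring : (q ^ 2) ^ 2 = q ^ 4)]
    have hq4 : M * q ^ 4 ≤ 4 * M * q * W (u x) := by
      have k1 : q ^ 4 ≤ q ^ 3 := pow_le_pow_of_le_one hq.le hq0 (by norm_num)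
      have k2 : q * q ^ 2 ≤ q * (4 * W (u x)) := mul_le_mul_of_nonneg_left hWq hq.le
      have k3 := mul_le_mul_of_nonneg_left (k1.trans (by linarith : q ^ 3 ≤ q * (4 * W (u x))))
        (by linarith : 0 ≤ M)
      linarith
    have h6 : 0 ≤ 8 * M * (D / q) := by positivity
    have h7 : 0 ≤ 2 * ((wellTest' q (u x) + q) * gradSq u x) := by positivity
    have h8 : (1 + q) * (gradSq w x / 2) ≤ (1 + q) * (W (u x) + M * q ^ 4) :=
      mul_le_mul_of_nonneg_left hw2 (by linarith)
    have h9 : (1 + q) * (M * q ^ 4) ≤ 2 * (4 * M * q * W (u x)) :=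
      mul_le_mul (by linarith) hq4 (by positivity) (by norm_num)
    simp only [discr]
    linarith

lemma exists_bad_weight {C : ℝ} (hC : 1 ≤ C) : ∃ A : ℝ, 0 ≤ A ∧ ∀ u : E 3 → ℝ, ContDiff ℝ 2 u →
    ∀ s ρ : ℝ, 0 < s → s ≤ 1 → 8 / s ≤ ρ → (∀ x ∈ closedBall (0 : E 3) (5 * ρ), |u x| ≤ C) →
    ∫ x in closedBall (0 : E 3) (8 * ρ), chem u x ^ 2 ≤ 1 →
    ∃ b : E 3 → ℝ, Continuous b ∧ (∀ x, 0 ≤ b x) ∧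
      (∀ x ∈ closedBall (0 : E 3) ρ, (∀ z ∈ closedBall x (2 * s⁻¹), GoodAt C s u z) ∨ 1 ≤ b x) ∧
      ∫ x in closedBall (0 : E 3) ρ, b x * gradSq u x
        ≤ A * s⁻¹ ^ 11 * ∫ x in closedBall (0 : E 3) (8 * ρ), chem u x ^ 2 := by
  obtain ⟨A, hA0, hA⟩ := exists_integral_gradSq_le hC
  refine ⟨A * 512, by positivity, fun u hu s ρ hs hs1 hρ hub hδ => ?_⟩
  have hi1 : 1 ≤ s⁻¹ := (one_le_inv₀ hs).2 hs1
  rw [div_eq_mul_inv] at hρ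
  set L := 2 * s⁻¹ + 2 with hL
  have hL0 : 0 < L := by positivity
  have hLs : L ≤ 4 * s⁻¹ := by linarith
  have hcf : Continuous fun y => chem u y ^ 2 := (continuous_chem hu).pow 2
  have hcg := continuous_gradSq (hu.of_le (by norm_num : (1 : WithTop ℕ∞) ≤ 2))
  have hK2 := isCompact_closedBall (0 : E 3) (2 * ρ)
  have hK := isCompact_closedBall (0 : E 3) ρ
  have hcc : Continuous (Function.uncurry fun x y : E 3 => cut y L x * chem u y ^ 2) := by
    refine Continuous.fun_mul ?_ (hcf.comp continuous_snd)
    exact unitBump.continuous.comp ((continuous_fst.sub continuous_snd).const_smul L⁻¹)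
  have hcb := continuous_parametric_integral_of_continuous hcc hK2 (μ := volume)
  refine ⟨fun x => s⁻¹ ^ 8 * ∫ y in closedBall (0 : E 3) (2 * ρ), cut y L x * chem u y ^ 2,
    hcb.const_mul _, fun x => mul_nonneg (by positivity) (integral_nonneg fun y =>
      mul_nonneg (cut_nonneg _ _ _) (sq_nonneg _)), fun x hx => ?_, ?_⟩
  · by_cases hg : ∀ z ∈ closedBall x (2 * s⁻¹), GoodAt C s u z
    · exact Or.inl hg
    right
    push Not at hg
    obtain ⟨z, hz, hng⟩ := hg
    rw [mem_closedBall, dist_zero_right] at hx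
    rw [mem_closedBall] at hz
    have hlt : (s ^ 4) ^ 2 < ∫ y in closedBall z 2, chem u y ^ 2 := by
      by_contra hcon
      refine hng ⟨fun y hy => hub y ?_, not_lt.1 hcon⟩
      rw [mem_closedBall] at hy ⊢
      have h1 := dist_triangle y z 0
      have h2 := dist_triangle z x 0
      rw [dist_zero_right x] at h2
      linarith
    have hle : ∫ y in closedBall z 2, chem u y ^ 2
        ≤ ∫ y in closedBall (0 : E 3) (2 * ρ), cut y L x * chem u y ^ 2 := by
      calc ∫ y in closedBall z 2, chem u y ^ 2
          = ∫ y in closedBall z 2, cut y L x * chem u y ^ 2 := by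
            refine setIntegral_congr_fun measurableSet_closedBall fun y hy => ?_
            have : cut y L x = 1 := by
              refine cut_eq_one hL0 ?_
              rw [mem_closedBall] at hy ⊢
              have := dist_triangle x z y
              rw [dist_comm x z, dist_comm z y] at this
              linarith
            simp only [this, one_mul]
        _ ≤ _ := by
            refine setIntegral_closedBall_mono (hcc.comp (Continuous.prodMk_right x))
              (fun y => mul_nonneg (cut_nonneg _ _ _) (sq_nonneg _)) ?_
            have h2 := dist_triangle z x 0
            rw [dist_zero_right x] at h2
            linarith
    have h8 : s⁻¹ ^ 8 * (s ^ 4) ^ 2 = 1 := by field_simp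
    rw [← h8]
    exact mul_le_mul_of_nonneg_left (hlt.le.trans hle) (by positivity)
  · have hsw : ∫ x in closedBall (0 : E 3) ρ, (s⁻¹ ^ 8 * ∫ y in closedBall (0 : E 3) (2 * ρ),
          cut y L x * chem u y ^ 2) * gradSq u x
        = s⁻¹ ^ 8 * ∫ y in closedBall (0 : E 3) (2 * ρ), ∫ x in closedBall (0 : E 3) ρ,
          cut y L x * chem u y ^ 2 * gradSq u x := by
      rw [← setIntegral_swap_of_continuous (F := fun x y : E 3 => cut y L x * chem u y ^ 2 * gradSq u x)
        (hcc.fun_mul (hcg.comp continuous_fst)) hK hK2, ← integral_const_mul]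
      refine setIntegral_congr_fun measurableSet_closedBall fun x _ => ?_
      simp only [integral_mul_const]; ring
    rw [hsw]
    have hin : ∀ y ∈ closedBall (0 : E 3) (2 * ρ), ∫ x in closedBall (0 : E 3) ρ,
        cut y L x * chem u y ^ 2 * gradSq u x ≤ chem u y ^ 2 * (A * (2 * L) ^ 3) := by
      intro y hy
      rw [mem_closedBall] at hy
      have e : ∀ x, cut y L x * chem u y ^ 2 * gradSq u x = chem u y ^ 2 * (cut y L x * gradSq u x) :=
        fun x => by ring
      simp only [e]
      rw [integral_const_mul]
      refine mul_le_mul_of_nonneg_left ?_ (sq_nonneg _)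
      have hcx : Continuous fun x => cut y L x * gradSq u x :=
        (contDiff_cut (n := 0) y L).continuous.fun_mul hcg
      have hc0 : ∀ x, 0 ≤ cut y L x * gradSq u x := fun x =>
        mul_nonneg (cut_nonneg _ _ _) (gradSq_nonneg _ _)
      have hci : Integrable fun x => cut y L x * gradSq u x :=
        hcx.integrable_of_hasCompactSupport ((hasCompactSupport_cut hL0).mul_right)
      calc ∫ x in closedBall (0 : E 3) ρ, cut y L x * gradSq u x
          ≤ ∫ x, cut y L x * gradSq u x :=
            setIntegral_le_integral hci (Eventually.of_forall hc0)
        _ = ∫ x in closedBall y (2 * L), cut y L x * gradSq u x := by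
            rw [setIntegral_eq_integral_of_forall_compl_eq_zero]
            intro x hx
            rw [cut_eq_zero_of_notMem hL0 hx, zero_mul]
        _ ≤ ∫ x in closedBall y (2 * L), gradSq u x := by
            refine setIntegral_mono hci.integrableOn
              (hcg.continuousOn.integrableOn_compact (isCompact_closedBall _ _)) fun x => ?_
            exact mul_le_of_le_one_left (gradSq_nonneg _ _) (cut_le_one _ _ _)
        _ ≤ A * (2 * L) ^ 3 := by
            refine hA u hu y (2 * L) (by linarith) (fun x hx => hub x ?_) ?_
            · rw [mem_closedBall] at hx ⊢
              have := dist_triangle x y 0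
              linarith
            · exact (setIntegral_closedBall_mono hcf (fun _ => sq_nonneg _) (by linarith)).trans hδ
    have hin2 : ∫ y in closedBall (0 : E 3) (2 * ρ), ∫ x in closedBall (0 : E 3) ρ,
        cut y L x * chem u y ^ 2 * gradSq u x
        ≤ ∫ y in closedBall (0 : E 3) (2 * ρ), chem u y ^ 2 * (A * (2 * L) ^ 3) := by
      have hc3 : Continuous (Function.uncurry fun y x : E 3 => cut y L x * chem u y ^ 2 * gradSq u x) :=
        (hcc.comp continuous_swap).fun_mul (hcg.comp continuous_snd)
      exact setIntegral_mono_on ((continuous_parametric_integral_of_continuous hc3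
        hK).continuousOn.integrableOn_compact hK2)
        ((hcf.mul_const _).continuousOn.integrableOn_compact hK2) hK2.measurableSet hin
    rw [integral_mul_const] at hin2
    have hδ2 : ∫ y in closedBall (0 : E 3) (2 * ρ), chem u y ^ 2
        ≤ ∫ y in closedBall (0 : E 3) (8 * ρ), chem u y ^ 2 :=
      setIntegral_closedBall_mono hcf (fun _ => sq_nonneg _) (by rw [dist_self]; linarith)
    have hL3 : (2 * L) ^ 3 ≤ 512 * s⁻¹ ^ 3 := by
      calc (2 * L) ^ 3 ≤ (2 * (4 * s⁻¹)) ^ 3 := pow_le_pow_left₀ (by positivity) (by linarith) 3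
        _ = _ := by ring
    have hδ0 : 0 ≤ ∫ y in closedBall (0 : E 3) (8 * ρ), chem u y ^ 2 :=
      integral_nonneg fun _ => sq_nonneg _
    calc _ ≤ s⁻¹ ^ 8 * ((∫ y in closedBall (0 : E 3) (8 * ρ), chem u y ^ 2)
            * (A * (512 * s⁻¹ ^ 3))) := by
          refine mul_le_mul_of_nonneg_left (hin2.trans (mul_le_mul hδ2 ?_ (by positivity) hδ0))
            (by positivity)
          exact mul_le_mul_of_nonneg_left hL3 hA0
      _ = _ := by ring

lemma lap_sq_le {C : ℝ} {u : E 3 → ℝ} {x : E 3} (h : |u x| ≤ C) :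
    lap u x ^ 2 ≤ 8 * C ^ 2 * W (u x) + 2 * chem u x ^ 2 := by
  have e : lap u x = chem u x + W' (u x) := by simp [chem]
  have h2 : u x ^ 2 ≤ C ^ 2 := sq_le_sq' (abs_le.1 h).1 (abs_le.1 h).2
  have h3 : W' (u x) ^ 2 = 4 * u x ^ 2 * W (u x) := by simp only [W', W]; ring
  have h4 := mul_le_mul_of_nonneg_right h2 (W_nonneg (u x))
  rw [e]
  nlinarith [sq_nonneg (chem u x - W' (u x))]

lemma exists_integral_wellTest_le : ∃ A : ℝ, 0 ≤ A ∧ ∀ u : E 3 → ℝ, ContDiff ℝ 2 u →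
    ∀ q ρ : ℝ, 0 < q → q ≤ 1 → 1 ≤ q * ρ →
    ∫ x in closedBall (0 : E 3) ρ, (wellTest' q (u x) + q) * gradSq u x
      ≤ A * q * (∫ x in closedBall (0 : E 3) (2 * ρ), en u x)
        + ∫ x in closedBall (0 : E 3) (2 * ρ), chem u x ^ 2 := by
  obtain ⟨c, hc0, hc⟩ := exists_gradSq_cut_le
  refine ⟨4 * c + 2, by positivity, fun u hu q ρ hq hq1 hqρ => ?_⟩
  have hρ1 : 1 ≤ ρ := by nlinarith
  have hρ : 0 < ρ := by linarith
  have hu1 : ContDiff ℝ 1 u := hu.of_le (by norm_num)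
  set χ := cut (0 : E 3) ρ with hχd
  have hχ : ContDiff ℝ 2 χ := contDiff_cut (n := 2) 0 ρ
  have hχc : HasCompactSupport χ := hasCompactSupport_cut hρ
  have hcg := continuous_gradSq hu1
  have hcχ := continuous_gradSq (hχ.of_le (by norm_num : (1 : WithTop ℕ∞) ≤ 2))
  have hcf : Continuous fun y => chem u y ^ 2 := (continuous_chem hu).pow 2
  have hcw : Continuous fun x => wellTest' q (u x) := by
    have : wellTest' q = deriv (wellTest q) := funext fun t => (hasDerivAt_wellTest hq t).deriv.symm
    rw [this]
    exact ((contDiff_wellTest q).continuous_deriv le_rfl).comp hu.continuous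
  have hχ2 : Continuous fun x => χ x ^ 2 := hχ.continuous.pow 2
  have hχ2c : HasCompactSupport fun x => χ x ^ 2 := hχc.comp_left (g := fun t => t ^ 2) (by simp)
  have hK := isCompact_closedBall (0 : E 3) (2 * ρ)
  have hen := (continuous_en hu1).continuousOn.integrableOn_compact hK (μ := volume)
  have hi1 : Integrable fun x => χ x ^ 2 * wellTest' q (u x) * gradSq u x :=
    ((hχ2.fun_mul hcw).fun_mul hcg).integrable_of_hasCompactSupport (hχ2c.mul_right.mul_right)
  have hi2 : Integrable fun x => χ x ^ 2 * gradSq u x :=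
    (hχ2.fun_mul hcg).integrable_of_hasCompactSupport hχ2c.mul_right
  have hsum : ∀ x, χ x ^ 2 * ((wellTest' q (u x) + q) * gradSq u x)
      = χ x ^ 2 * wellTest' q (u x) * gradSq u x + q * (χ x ^ 2 * gradSq u x) := fun x => by ring
  have h1 : ∫ x in closedBall (0 : E 3) ρ, (wellTest' q (u x) + q) * gradSq u x
      ≤ (∫ x, χ x ^ 2 * wellTest' q (u x) * gradSq u x) + q * ∫ x, χ x ^ 2 * gradSq u x := by
    rw [← integral_const_mul, ← integral_add hi1 (hi2.const_mul q)]
    simp only [← hsum]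
    calc _ = ∫ x in closedBall (0 : E 3) ρ, χ x ^ 2 * ((wellTest' q (u x) + q) * gradSq u x) := by
          refine setIntegral_congr_fun measurableSet_closedBall fun x hx => ?_
          simp only [hχd, cut_eq_one hρ hx, one_pow, one_mul]
      _ ≤ _ := by
          refine setIntegral_le_integral ?_ (Eventually.of_forall fun x => ?_)
          · simp only [hsum]
            exact hi1.fun_add (hi2.const_mul q)
          · exact mul_nonneg (sq_nonneg _)
              (mul_nonneg (wellTest'_add_nonneg hq _) (gradSq_nonneg _ _))
  have hb : ∀ x, χ x ^ 2 ≤ 1 := fun x => pow_le_one₀ (cut_nonneg _ _ _) (cut_le_one _ _ _)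
  have h2 : ∫ x, χ x ^ 2 * gradSq u x ≤ 2 * ∫ x in closedBall (0 : E 3) (2 * ρ), en u x := by
    rw [← setIntegral_eq_integral_of_forall_compl_eq_zero (s := closedBall (0 : E 3) (2 * ρ))
      fun x hx => by simp [hχd, cut_eq_zero_of_notMem hρ hx], ← integral_const_mul]
    refine setIntegral_mono hi2.integrableOn (hen.const_mul 2) fun x => ?_
    exact (mul_le_of_le_one_left (gradSq_nonneg u x) (hb x)).trans (gradSq_le_en u x)
  have h3 : ∫ x, (χ x ^ 2 * chem u x ^ 2 + 2 * (gradSq χ x * gradSq u x))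
      ≤ (∫ x in closedBall (0 : E 3) (2 * ρ), chem u x ^ 2)
        + 4 * c * q * ∫ x in closedBall (0 : E 3) (2 * ρ), en u x := by
    have hfi := hcf.continuousOn.integrableOn_compact hK (μ := volume)
    rw [← setIntegral_eq_integral_of_forall_compl_eq_zero (s := closedBall (0 : E 3) (2 * ρ))
      fun x hx => by simp [hχd, cut_eq_zero_of_notMem hρ hx, gradSq_cut_eq_zero_of_notMem hρ hx],
      ← integral_const_mul, ← integral_add hfi (hen.const_mul _)]
    refine setIntegral_mono (((hχ2.fun_mul hcf).fun_add ((hcχ.fun_mul hcg).const_mul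
      2)).continuousOn.integrableOn_compact hK) (hfi.add (hen.const_mul _)) fun x => ?_
    have k1 : χ x ^ 2 * chem u x ^ 2 ≤ chem u x ^ 2 := mul_le_of_le_one_left (sq_nonneg _) (hb x)
    have k2 : c / ρ ^ 2 ≤ c * q := by
      rw [div_le_iff₀ (by positivity)]
      have : 1 ≤ q * ρ ^ 2 := by nlinarith
      nlinarith
    have k3 : gradSq χ x * gradSq u x ≤ c * q * (2 * en u x) :=
      mul_le_mul ((hc 0 ρ hρ x).trans k2) (gradSq_le_en u x) (gradSq_nonneg _ _) (by positivity)
    simp only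
    linarith
  have h4 := integral_wellTest_le hq hu hχ hχc
  have h5 := mul_le_mul_of_nonneg_left h2 hq.le
  linarith

lemma continuous_discr {u : E 3 → ℝ} (hu : ContDiff ℝ 1 u) : Continuous (discr u) :=
  ((continuous_gradSq hu).div_const 2).sub (continuous_W_comp hu.continuous)

/-- The positive part of the discrepancy is small relative to the energy and the chemical
potential, on all sufficiently large balls. -/
lemma exists_integral_discr_pos_le : ∃ C K : ℝ, 1 ≤ C ∧ 1 ≤ K ∧ ∀ q : ℝ, 0 < q → q ≤ 1 / 10 →
    ∀ ρ : ℝ, K * q⁻¹ ^ 111 ≤ ρ → ∀ u : E 3 → ℝ, ContDiff ℝ 2 u → HasCompactSupport u →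
    ∫ x in closedBall (0 : E 3) (8 * ρ), chem u x ^ 2 ≤ 1 →
    ∫ x in closedBall (0 : E 3) ρ, max (discr u x) 0
      ≤ C * q * ((∫ x in closedBall (0 : E 3) (8 * ρ), en u x)
        + ρ * ∫ x in closedBall (0 : E 3) (8 * ρ), chem u x ^ 2) := by
  obtain ⟨C₀, hC₀, hsup⟩ := exists_sup_bound
  have hC1 : 1 ≤ C₀ := by linarith
  obtain ⟨θ, B, hθ, hθ1, hB, hgood⟩ := exists_discr_le_of_goodAt hC1
  obtain ⟨A₁, hA₁, hbad⟩ := exists_bad_weight hC1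
  obtain ⟨A₂, hA₂, hwell⟩ := exists_integral_wellTest_le
  obtain ⟨A₃, hA₃, hgrad⟩ := exists_integral_pd_sub_avg_sq_le
  have hθi : 1 ≤ θ⁻¹ := (one_le_inv₀ hθ).2 hθ1
  refine ⟨B + B * A₃ * (8 * C₀ ^ 2 + 2) + 2 * (A₂ + 1) + A₁ * θ⁻¹ ^ 11, 8 * θ⁻¹, ?_, by linarith,
    fun q hq hq1 ρ hρ u hu huc hδ => ?_⟩
  · have : 0 ≤ B * A₃ * (8 * C₀ ^ 2 + 2) + 2 * (A₂ + 1) + A₁ * θ⁻¹ ^ 11 := by positivity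
    linarith
  have hq0 : q ≤ 1 := by linarith
  have hqi : 1 ≤ q⁻¹ := (one_le_inv₀ hq).2 hq0
  set s := θ * q ^ 10 with hs
  have hs0 : 0 < s := by positivity
  have hsq : s ≤ q ^ 10 := mul_le_of_le_one_left (by positivity) hθ1
  have hs1 : s ≤ 1 := hsq.trans (pow_le_one₀ hq.le hq0)
  have hρ111 : q⁻¹ ^ 111 ≤ ρ := by
    refine le_trans ?_ hρ
    exact le_mul_of_one_le_left (by positivity) (by linarith)
  have hρ1 : 1 ≤ ρ := (one_le_pow₀ hqi).trans hρ111
  have hsρ : 8 / s ≤ ρ := by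
    refine le_trans ?_ hρ
    rw [hs, div_eq_mul_inv, mul_inv, ← mul_assoc, ← inv_pow]
    exact mul_le_mul_of_nonneg_left (pow_le_pow_right₀ hqi (by norm_num)) (by positivity)
  have hqρ110 : q⁻¹ ^ 110 ≤ q * ρ := by
    have := mul_le_mul_of_nonneg_left hρ111 hq.le
    refine le_trans (le_of_eq ?_) this
    rw [pow_succ' q⁻¹ 110, ← mul_assoc, mul_inv_cancel₀ hq.ne', one_mul]
  have hqρ : 1 ≤ q * ρ := (one_le_pow₀ hqi).trans hqρ110
  have hu1 : ContDiff ℝ 1 u := hu.of_le (by norm_num)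
  have hcf : Continuous fun y => chem u y ^ 2 := (continuous_chem hu).pow 2
  have hce := continuous_en hu1
  have hcg := continuous_gradSq hu1
  set δ := ∫ x in closedBall (0 : E 3) (8 * ρ), chem u x ^ 2 with hδd
  set En := ∫ x in closedBall (0 : E 3) (8 * ρ), en u x with hEn
  have hδ0 : 0 ≤ δ := integral_nonneg fun _ => sq_nonneg _
  have hE0 : 0 ≤ En := integral_nonneg fun _ => en_nonneg _ _
  have hfm : ∀ x r, dist x 0 + r ≤ 8 * ρ → ∫ z in closedBall x r, chem u z ^ 2 ≤ δ := fun x r h =>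
    setIntegral_closedBall_mono hcf (fun _ => sq_nonneg _) h
  have hem : ∀ x r, dist x 0 + r ≤ 8 * ρ → ∫ z in closedBall x r, en u z ≤ En := fun x r h =>
    setIntegral_closedBall_mono hce (fun _ => en_nonneg _ _) h
  have hub : ∀ x ∈ closedBall (0 : E 3) (5 * ρ), |u x| ≤ C₀ := fun x hx =>
    hsup u hu huc x ((hfm x 2 (by rw [mem_closedBall] at hx; linarith)).trans hδ)
  obtain ⟨b, hbc, hb0, hbx, hbI⟩ := hbad u hu s ρ hs0 hs1 hsρ hub hδ
  set w := avg kerK s u with hw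
  have hcD : Continuous fun x => ∑ i, (pd i u x - pd i w x) ^ 2 :=
    continuous_finsetSum _ fun i _ => ((continuous_pd i hu1).sub (continuous_pd i
      ((contDiff_avg_kerK hu.continuous hs0).of_le (by norm_num)))).pow 2
  have hcw : Continuous fun x => (wellTest' q (u x) + q) * gradSq u x := by
    have : wellTest' q = deriv (wellTest q) := funext fun t => (hasDerivAt_wellTest hq t).deriv.symm
    rw [this]
    exact ((((contDiff_wellTest q).continuous_deriv le_rfl).comp hu.continuous).add
      continuous_const).mul hcg
  have hK := isCompact_closedBall (0 : E 3) ρ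
  have hintg : ∀ {f : E 3 → ℝ}, Continuous f → IntegrableOn f (closedBall (0 : E 3) ρ) := fun hf =>
    hf.continuousOn.integrableOn_compact hK
  have hpt : ∫ x in closedBall (0 : E 3) ρ, max (discr u x) 0 ≤ ∫ x in closedBall (0 : E 3) ρ,
      (B * q * en u x + B / q * ∑ i, (pd i u x - pd i w x) ^ 2
        + 2 * ((wellTest' q (u x) + q) * gradSq u x) + b x * gradSq u x) := by
    refine setIntegral_mono_on (hintg ((continuous_discr hu1).max continuous_const))
      (hintg ((((hce.const_mul _).add (hcD.const_mul _)).add (hcw.const_mul _)).add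
        (hbc.mul hcg))) hK.measurableSet fun x hx => ?_
    have k1 : B * q * W (u x) ≤ B * q * en u x :=
      mul_le_mul_of_nonneg_left (W_le_en u x) (by positivity)
    have k2 : 0 ≤ B * q * W (u x) := mul_nonneg (by positivity) (W_nonneg _)
    have k3 : 0 ≤ B / q * ∑ i, (pd i u x - pd i w x) ^ 2 :=
      mul_nonneg (by positivity) (Finset.sum_nonneg fun _ _ => sq_nonneg _)
    have k4 : 0 ≤ (wellTest' q (u x) + q) * gradSq u x :=
      mul_nonneg (wellTest'_add_nonneg hq _) (gradSq_nonneg _ _)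
    have k5 : 0 ≤ b x * gradSq u x := mul_nonneg (hb0 x) (gradSq_nonneg _ _)
    refine max_le ?_ (by linarith)
    rcases hbx x hx with hg | hg
    · have := hgood q hq hq1 s rfl u hu huc x hg
      linarith
    · have k6 := mul_le_mul_of_nonneg_right hg (gradSq_nonneg u x)
      have k7 := W_nonneg (u x)
      have k8 := gradSq_nonneg u x
      simp only [discr]
      linarith
  rw [integral_add (hintg (((hce.const_mul _).fun_add (hcD.const_mul _)).fun_add (hcw.const_mul _)))
      (hintg (hbc.fun_mul hcg)),
    integral_add (hintg ((hce.const_mul _).fun_add (hcD.const_mul _))) (hintg (hcw.const_mul _)),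
    integral_add (hintg (hce.const_mul _)) (hintg (hcD.const_mul _)), integral_const_mul,
    integral_const_mul, integral_const_mul] at hpt
  have hδρ : δ ≤ q * ρ * δ := le_mul_of_one_le_left hδ0 hqρ
  have t1 : B * q * ∫ x in closedBall (0 : E 3) ρ, en u x ≤ B * q * En :=
    mul_le_mul_of_nonneg_left (hem 0 ρ (by rw [dist_self]; linarith)) (by positivity)
  have t2 : ∫ x in closedBall (0 : E 3) (ρ + 1), lap u x ^ 2 ≤ 8 * C₀ ^ 2 * En + 2 * δ := by
    have hK' := isCompact_closedBall (0 : E 3) (ρ + 1)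
    have i1 := (hce.const_mul (8 * C₀ ^ 2)).continuousOn.integrableOn_compact hK' (μ := volume)
    have i2 := (hcf.const_mul 2).continuousOn.integrableOn_compact hK' (μ := volume)
    calc _ ≤ ∫ x in closedBall (0 : E 3) (ρ + 1), (8 * C₀ ^ 2 * en u x + 2 * chem u x ^ 2) := by
          refine setIntegral_mono_on (((continuous_lap hu).pow 2).continuousOn.integrableOn_compact
            hK') (i1.fun_add i2) hK'.measurableSet fun x hx => ?_
          refine (lap_sq_le (hub x (closedBall_subset_closedBall (by linarith) hx))).trans ?_
          have := mul_le_mul_of_nonneg_left (W_le_en u x) (by positivity : 0 ≤ 8 * C₀ ^ 2)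
          linarith
      _ ≤ _ := by
          rw [integral_add i1 i2, integral_const_mul, integral_const_mul]
          have e1 := hem 0 (ρ + 1) (by rw [dist_self]; linarith)
          have e2 := hfm 0 (ρ + 1) (by rw [dist_self]; linarith)
          have e3 := mul_le_mul_of_nonneg_left e1 (by positivity : 0 ≤ 8 * C₀ ^ 2)
          linarith
  have hsq2 : s ^ 2 ≤ q ^ 2 := by
    refine pow_le_pow_left₀ hs0.le (hsq.trans ?_) 2
    exact pow_le_of_le_one hq.le hq0 (by norm_num)
  have t3 : B / q * ∫ x in closedBall (0 : E 3) ρ, ∑ i, (pd i u x - pd i w x) ^ 2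
      ≤ B * A₃ * (8 * C₀ ^ 2 + 2) * (q * (En + ρ * δ)) := by
    calc _ ≤ B / q * (A₃ * q ^ 2 * (8 * C₀ ^ 2 * En + 2 * δ)) := by
          refine mul_le_mul_of_nonneg_left ?_ (by positivity)
          refine (hgrad u hu huc s hs0 hs1 0 ρ).trans ?_
          exact mul_le_mul (mul_le_mul_of_nonneg_left hsq2 hA₃) t2
            (integral_nonneg fun _ => sq_nonneg _) (by positivity)
      _ = B * A₃ * (q * (8 * C₀ ^ 2 * En + 2 * δ)) := by field_simp
      _ ≤ B * A₃ * (q * ((8 * C₀ ^ 2 + 2) * (En + ρ * δ))) := by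
          refine mul_le_mul_of_nonneg_left (mul_le_mul_of_nonneg_left ?_ hq.le) (by positivity)
          have : δ ≤ ρ * δ := le_mul_of_one_le_left hδ0 hρ1
          have h0 : 0 ≤ C₀ ^ 2 * (ρ * δ) := by positivity
          nlinarith
      _ = _ := by ring
  have t4 : ∫ x in closedBall (0 : E 3) ρ, (wellTest' q (u x) + q) * gradSq u x
      ≤ (A₂ + 1) * (q * (En + ρ * δ)) := by
    refine (hwell u hu q ρ hq hq0 hqρ).trans ?_
    have e1 := hem 0 (2 * ρ) (by rw [dist_self]; linarith)
    have e2 := hfm 0 (2 * ρ) (by rw [dist_self]; linarith)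
    have e3 := mul_le_mul_of_nonneg_left e1 (by positivity : 0 ≤ A₂ * q)
    have e4 : 0 ≤ A₂ * (q * (ρ * δ)) := by positivity
    have e5 : 0 ≤ q * En := by positivity
    nlinarith
  have t5 : ∫ x in closedBall (0 : E 3) ρ, b x * gradSq u x
      ≤ A₁ * θ⁻¹ ^ 11 * (q * (En + ρ * δ)) := by
    refine hbI.trans ?_
    have e1 : s⁻¹ ^ 11 = θ⁻¹ ^ 11 * q⁻¹ ^ 110 := by
      rw [hs, mul_inv, mul_pow, ← inv_pow, ← pow_mul]
    have e2 : q⁻¹ ^ 110 * δ ≤ q * (En + ρ * δ) := by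
      have := mul_le_mul_of_nonneg_right hqρ110 hδ0
      have h0 : 0 ≤ q * En := by positivity
      linarith
    have e3 := mul_le_mul_of_nonneg_left e2 (by positivity : 0 ≤ A₁ * θ⁻¹ ^ 11)
    rw [e1]
    linarith
  have t6 : B * q * En ≤ B * (q * (En + ρ * δ)) := by
    have : 0 ≤ B * (q * (ρ * δ)) := by positivity
    linarith
  linarith

/-- The stress tensor of the diffuse area energy at unit scale. -/
def stress (u : E 3 → ℝ) (i j : Fin 3) (x : E 3) : ℝ :=
  (if i = j then 1 else 0) * en u x - pd i u x * pd j u x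

section stress

variable {u : E 3 → ℝ}

lemma contDiff_en (hu : ContDiff ℝ 2 u) : ContDiff ℝ 1 (en u) :=
  ((ContDiff.sum fun i _ => (contDiff_one_pd i hu).pow 2).div_const 2).add
    ((contDiff_W (n := 1)).comp (hu.of_le (by norm_num)))

lemma pd_en (hu : ContDiff ℝ 2 u) (i : Fin 3) (x : E 3) :
    pd i (en u) x = ∑ j, pd j u x * pd i (pd j u) x + W' (u x) * pd i u x := by
  have hu1 : ContDiff ℝ 1 u := hu.of_le (by norm_num)
  have hg : ContDiff ℝ 1 (gradSq u) := ContDiff.sum fun i _ => (contDiff_one_pd i hu).pow 2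
  have hW : ContDiff ℝ 1 fun x => W (u x) := (contDiff_W (n := 1)).comp hu1
  have e : en u = fun x => 1 / 2 * gradSq u x + W (u x) := funext fun x => by rw [en]; ring
  rw [e, pd_add i ((hg.differentiable (by norm_num) x).const_mul _) (hW.differentiable (by norm_num) x),
    pd_const_mul i _ (hg.differentiable (by norm_num) x), pd_gradSq hu, pd_comp_eq hasDerivAt_W hu1]
  ring

lemma contDiff_stress (hu : ContDiff ℝ 2 u) (i j : Fin 3) : ContDiff ℝ 1 (stress u i j) :=
  (contDiff_const.mul (contDiff_en hu)).sub ((contDiff_one_pd i hu).mul (contDiff_one_pd j hu))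

lemma sum_pd_stress (hu : ContDiff ℝ 2 u) (i : Fin 3) (x : E 3) :
    ∑ j, pd j (stress u i j) x = -(chem u x * pd i u x) := by
  have hp : ∀ j, DifferentiableAt ℝ (pd j u) x := fun j =>
    (contDiff_one_pd j hu).differentiable (by norm_num) x
  have he : DifferentiableAt ℝ (en u) x := (contDiff_en hu).differentiable (by norm_num) x
  have h : ∀ j, pd j (stress u i j) x = (if i = j then pd j (en u) x else 0)
      - (pd j (pd i u) x * pd j u x + pd i u x * pd j (pd j u) x) := fun j => by
    rw [show stress u i j = fun x => (if i = j then 1 else 0) * en u x - pd i u x * pd j u x from rfl,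
      pd_sub j (he.const_mul _) ((hp i).fun_mul (hp j)), pd_const_mul j _ he, pd_mul j (hp i) (hp j)]
    split_ifs <;> ring
  simp only [h, Finset.sum_sub_distrib, Finset.sum_add_distrib, Finset.sum_ite_eq, Finset.mem_univ,
    if_true, ← Finset.mul_sum, ← lap_eq hu, pd_en hu]
  have e : ∑ j, pd j u x * pd i (pd j u) x = ∑ j, pd j (pd i u) x * pd j u x :=
    Finset.sum_congr rfl fun j _ => by rw [pd_comm hu i j, mul_comm]
  rw [e, chem]
  ring

lemma integral_stress (hu : ContDiff ℝ 2 u) {X : Fin 3 → E 3 → ℝ} (hX : ∀ i, ContDiff ℝ 1 (X i))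
    (hXc : ∀ i, HasCompactSupport (X i)) :
    ∫ x, (∑ i, ∑ j, pd j (X i) x * stress u i j x - chem u x * ∑ i, X i x * pd i u x) = 0 := by
  have e : ∀ x, ∑ i, ∑ j, pd j (X i) x * stress u i j x - chem u x * ∑ i, X i x * pd i u x
      = ∑ i, ∑ j, pd j (fun y => X i y * stress u i j y) x := fun x => by
    rw [Finset.mul_sum, ← Finset.sum_sub_distrib]
    refine Finset.sum_congr rfl fun i _ => ?_
    have h : ∀ j, pd j (fun y => X i y * stress u i j y) x
        = pd j (X i) x * stress u i j x + X i x * pd j (stress u i j) x := fun j =>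
      pd_mul j ((hX i).differentiable (by norm_num) x)
        ((contDiff_stress hu i j).differentiable (by norm_num) x)
    simp only [h, Finset.sum_add_distrib, ← Finset.mul_sum, sum_pd_stress hu]
    ring
  have hF : ∀ i j, ContDiff ℝ 1 fun y => X i y * stress u i j y := fun i j =>
    (hX i).mul (contDiff_stress hu i j)
  have hFc : ∀ i j, HasCompactSupport fun y => X i y * stress u i j y := fun i j => (hXc i).mul_right
  have hI : ∀ i j, Integrable fun x => pd j (fun y => X i y * stress u i j y) x := fun i j =>
    (continuous_pd j (hF i j)).integrable_of_hasCompactSupport (hasCompactSupport_pd j (hFc i j))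
  simp only [e]
  rw [integral_finsetSum _ fun i _ => integrable_finsetSum _ fun j _ => hI i j]
  refine Finset.sum_eq_zero fun i _ => ?_
  rw [integral_finsetSum _ fun j _ => hI i j]
  exact Finset.sum_eq_zero fun j _ => integral_pd_eq_zero (hF i j) (hFc i j) j

lemma abs_stress_le (i j : Fin 3) (x : E 3) : |stress u i j x| ≤ 3 * en u x := by
  have h1 := en_nonneg u x
  have h2 := gradSq_le_en u x
  have h3 := pd_sq_le_gradSq u i x
  have h4 := pd_sq_le_gradSq u j x
  rw [stress]
  refine abs_le.2 ⟨?_, ?_⟩ <;> split_ifs <;>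
    nlinarith [sq_nonneg (pd i u x - pd j u x), sq_nonneg (pd i u x + pd j u x)]

end stress

/-- The radial weight of the monotonicity formula. -/
def radW (ρ : ℝ) (x : E 3) : ℝ := (ρ ^ 2 + ‖x‖ ^ 2)⁻¹

section monotone

variable {ρ : ℝ}

lemma radW_pos (hρ : 0 < ρ) (x : E 3) : 0 < radW ρ x := by rw [radW]; positivity

lemma contDiff_radW (hρ : 0 < ρ) : ContDiff ℝ 1 (radW ρ) :=
  ((contDiff_const.add (contDiff_norm_sq ℝ)).inv fun x => by positivity)

lemma pd_radW (hρ : 0 < ρ) (i : Fin 3) (x : E 3) :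
    pd i (radW ρ) x = -(2 * x i * radW ρ x ^ 2) := by
  have h0 : ρ ^ 2 + ‖x‖ ^ 2 ≠ 0 := by positivity
  have hn : DifferentiableAt ℝ (fun y : E 3 => ‖y‖ ^ 2) x :=
    (contDiff_norm_sq ℝ (n := 1)).differentiable (by norm_num) x
  have h := pd_comp (φ := fun t => (ρ ^ 2 + t)⁻¹) (f := fun y : E 3 => ‖y‖ ^ 2) i
    (((hasDerivAt_id (‖x‖ ^ 2)).const_add (ρ ^ 2)).fun_inv h0) hn
  rw [pd_norm_sq] at h
  refine h.trans ?_
  simp only [radW, id]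
  field_simp

lemma pd_radial (hρ : 0 < ρ) {χ : E 3 → ℝ} (hχ : ContDiff ℝ 1 χ) (i j : Fin 3) (x : E 3) :
    pd j (fun y => χ y * (y i * radW ρ y)) x = pd j χ x * (x i * radW ρ x)
      + χ x * ((if i = j then 1 else 0) * radW ρ x - 2 * x i * x j * radW ρ x ^ 2) := by
  have h1 := (contDiff_coord i (n := 1)).differentiable (by norm_num) x
  have h2 := (contDiff_radW hρ).differentiable (by norm_num) x
  rw [pd_mul j (hχ.differentiable (by norm_num) x) (h1.fun_mul h2), pd_mul j h1 h2, pd_coord,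
    pd_radW hρ]
  by_cases h : i = j
  · subst h; simp only [if_true]; ring
  · rw [if_neg h, if_neg (Ne.symm h)]; ring

set_option maxHeartbeats 1000000 in
lemma sum_radial_stress (hρ : 0 < ρ) (u : E 3 → ℝ) (x : E 3) :
    ∑ i, ∑ j, ((if i = j then 1 else 0) * radW ρ x - 2 * x i * x j * radW ρ x ^ 2) * stress u i j x
      = 2 * ρ ^ 2 * radW ρ x ^ 2 * en u x - radW ρ x * discr u x
        + 2 * (radW ρ x * ∑ i, x i * pd i u x) ^ 2 := by
  have hg : radW ρ x * (ρ ^ 2 + ‖x‖ ^ 2) = 1 := inv_mul_cancel₀ (by positivity)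
  rw [norm_sq_eq_sum] at hg
  have hd : discr u x = gradSq u x - en u x := by simp only [discr, en]; ring
  simp only [stress, hd, gradSq, Fin.sum_univ_three] at hg ⊢
  generalize en u x = e at *
  generalize radW ρ x = g at *
  simp only [Fin.isValue, if_true, one_mul, zero_mul, zero_sub, Fin.reduceEq, if_false]
  linear_combination (-2 * g * e) * hg

lemma exists_monotonicity : ∃ A : ℝ, 0 ≤ A ∧ ∀ u : E 3 → ℝ, ContDiff ℝ 2 u → ∀ ρ R : ℝ, 0 < ρ →
    ρ ≤ R → (∫ x in closedBall (0 : E 3) ρ, en u x) / (2 * ρ ^ 2)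
      ≤ (∫ x in closedBall (0 : E 3) (2 * R), max (discr u x) 0 * radW ρ x)
        + 1 / 4 * (∫ x in closedBall (0 : E 3) (2 * R), chem u x ^ 2)
        + A / R ^ 2 * ∫ x in closedBall (0 : E 3) (2 * R), en u x := by
  obtain ⟨c, hc0, hc⟩ := exists_abs_pd_cut_le
  refine ⟨27 * c, by positivity, fun u hu ρ R hρ hρR => ?_⟩
  have hR : 0 < R := by linarith
  have hu1 : ContDiff ℝ 1 u := hu.of_le (by norm_num)
  set χ := cut (0 : E 3) R with hχd
  have hχ1 : ContDiff ℝ 1 χ := contDiff_cut (n := 1) 0 R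
  have hχc : HasCompactSupport χ := hasCompactSupport_cut hR
  have hX : ∀ i : Fin 3, ContDiff ℝ 1 fun y : E 3 => χ y * (y i * radW ρ y) := fun i =>
    hχ1.mul ((contDiff_coord i).mul (contDiff_radW hρ))
  have hXc : ∀ i : Fin 3, HasCompactSupport fun y : E 3 => χ y * (y i * radW ρ y) := fun i =>
    hχc.mul_right
  have h0 := integral_stress hu hX hXc
  set P := fun x => ∑ i, ∑ j, pd j (fun y : E 3 => χ y * (y i * radW ρ y)) x * stress u i j x
    - chem u x * ∑ i, χ x * (x i * radW ρ x) * pd i u x with hP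
  have hK := isCompact_closedBall (0 : E 3) (2 * R)
  have hintg : ∀ {f : E 3 → ℝ}, Continuous f → IntegrableOn f (closedBall (0 : E 3) (2 * R)) :=
    fun hf => hf.continuousOn.integrableOn_compact hK
  have hcP : Continuous P := by
    refine (continuous_finsetSum _ fun i _ => continuous_finsetSum _ fun j _ =>
      (continuous_pd j (hX i)).mul (contDiff_stress hu i j).continuous).sub
      ((continuous_chem hu).mul (continuous_finsetSum _ fun i _ =>
        (hX i).continuous.mul (continuous_pd i hu1)))
  have hce := continuous_en hu1
  have hcf : Continuous fun y => chem u y ^ 2 := (continuous_chem hu).pow 2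
  have hcr := (contDiff_radW hρ).continuous
  have hcm : Continuous fun x => max (discr u x) 0 * radW ρ x :=
    ((continuous_discr hu1).max continuous_const).fun_mul hcr
  have hP0 : ∫ x in closedBall (0 : E 3) (2 * R), P x = 0 := by
    rw [setIntegral_eq_integral_of_forall_compl_eq_zero, h0]
    intro x hx
    have z : χ x = 0 := cut_eq_zero_of_notMem hR hx
    have z' : ∀ j, pd j χ x = 0 := fun j => pd_cut_eq_zero_of_notMem hR hx j
    simp [hP, pd_radial hρ hχ1, z, z']
  have hpt : ∀ x, χ x * (2 * ρ ^ 2 * radW ρ x ^ 2 * en u x)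
      ≤ P x + max (discr u x) 0 * radW ρ x + 1 / 4 * chem u x ^ 2 + 27 * c / R ^ 2 * en u x := by
    intro x
    have hχ0 : 0 ≤ χ x := cut_nonneg _ _ _
    have hχ1' : χ x ≤ 1 := cut_le_one _ _ _
    have hg := radW_pos hρ x
    have he := en_nonneg u x
    set N := radW ρ x * ∑ i, x i * pd i u x with hN
    have eP : P x = ∑ i, ∑ j, pd j χ x * (x i * radW ρ x) * stress u i j x
        + χ x * (2 * ρ ^ 2 * radW ρ x ^ 2 * en u x - radW ρ x * discr u x + 2 * N ^ 2)
        - χ x * (chem u x * N) := by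
      rw [hN, ← sum_radial_stress hρ u x]
      simp only [hP, pd_radial hρ hχ1, Finset.mul_sum, ← Finset.sum_add_distrib]
      congr 1
      · refine Finset.sum_congr rfl fun i _ => Finset.sum_congr rfl fun j _ => by ring
      · refine Finset.sum_congr rfl fun i _ => by ring
    have hcut : |∑ i, ∑ j, pd j χ x * (x i * radW ρ x) * stress u i j x| ≤ 27 * c / R ^ 2 * en u x := by
      have hterm : ∀ i j, |pd j χ x * (x i * radW ρ x) * stress u i j x| ≤ 3 * c / R ^ 2 * en u x := by
        intro i j
        rcases lt_or_ge (dist x 0) R with hx | hx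
        · rw [pd_cut_eq_zero_of_lt hR hx j, zero_mul, zero_mul, abs_zero]; positivity
        rw [dist_zero_right] at hx
        have k1 : |x i * radW ρ x| ≤ 1 / R := by
          rw [abs_mul, abs_of_pos hg, radW, ← div_eq_mul_inv, div_le_div_iff₀ (by positivity) hR, one_mul]
          have k2 : |x i| ≤ ‖x‖ := PiLp.norm_apply_le x i
          nlinarith [abs_nonneg (x i), sq_nonneg ρ]
        rw [abs_mul, abs_mul]
        calc _ ≤ c / R * (1 / R) * (3 * en u x) :=
              mul_le_mul (mul_le_mul (hc 0 R hR j x) k1 (abs_nonneg _) (by positivity))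
                (abs_stress_le i j x) (abs_nonneg _) (by positivity)
          _ = _ := by field_simp
      calc _ ≤ ∑ i, ∑ j, |pd j χ x * (x i * radW ρ x) * stress u i j x| :=
            (Finset.abs_sum_le_sum_abs _ _).trans (Finset.sum_le_sum fun i _ =>
              Finset.abs_sum_le_sum_abs _ _)
        _ ≤ ∑ _ : Fin 3, ∑ _ : Fin 3, 3 * c / R ^ 2 * en u x :=
            Finset.sum_le_sum fun i _ => Finset.sum_le_sum fun j _ => hterm i j
        _ = _ := by simp; ring
    have hcut' := (abs_le.1 hcut).1
    have hm : χ x * (radW ρ x * discr u x) ≤ max (discr u x) 0 * radW ρ x := by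
      have k1 : radW ρ x * discr u x ≤ max (discr u x) 0 * radW ρ x := by
        rw [mul_comm]; exact mul_le_mul_of_nonneg_right (le_max_left _ _) hg.le
      have k2 : 0 ≤ max (discr u x) 0 * radW ρ x := mul_nonneg (le_max_right _ _) hg.le
      exact (mul_le_mul_of_nonneg_left k1 hχ0).trans (mul_le_of_le_one_left k2 hχ1')
    have hf : χ x * (chem u x * N - 2 * N ^ 2) ≤ 1 / 4 * chem u x ^ 2 := by
      have k1 : chem u x * N - 2 * N ^ 2 ≤ 1 / 4 * chem u x ^ 2 := by
        nlinarith [sq_nonneg (chem u x / 2 - N), sq_nonneg N]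
      exact (mul_le_mul_of_nonneg_left k1 hχ0).trans (mul_le_of_le_one_left (by positivity) hχ1')
    rw [eP]
    linarith
  have hcl : Continuous fun x => χ x * (2 * ρ ^ 2 * radW ρ x ^ 2 * en u x) :=
    hχ1.continuous.fun_mul ((continuous_const.mul (hcr.pow 2)).mul hce)
  have hI := setIntegral_mono (hintg hcl) (hintg (((hcP.fun_add hcm).fun_add
    (hcf.const_mul (1 / 4))).fun_add (hce.const_mul (27 * c / R ^ 2)))) hpt
  rw [integral_add (hintg ((hcP.fun_add hcm).fun_add (hcf.const_mul (1 / 4))))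
      (hintg (hce.const_mul (27 * c / R ^ 2))),
    integral_add (hintg (hcP.fun_add hcm)) (hintg (hcf.const_mul (1 / 4))),
    integral_add (hintg hcP) (hintg hcm), hP0, integral_const_mul, integral_const_mul, zero_add] at hI
  refine le_trans ?_ hI
  calc (∫ x in closedBall (0 : E 3) ρ, en u x) / (2 * ρ ^ 2)
      = ∫ x in closedBall (0 : E 3) ρ, (2 * ρ ^ 2)⁻¹ * en u x := by
        rw [integral_const_mul, div_eq_inv_mul]
    _ ≤ ∫ x in closedBall (0 : E 3) ρ, χ x * (2 * ρ ^ 2 * radW ρ x ^ 2 * en u x) := by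
        have hK' := isCompact_closedBall (0 : E 3) ρ
        refine setIntegral_mono_on ((hce.const_mul _).continuousOn.integrableOn_compact hK')
          (hcl.continuousOn.integrableOn_compact hK') hK'.measurableSet fun x hx => ?_
        rw [hχd, cut_eq_one hR (closedBall_subset_closedBall hρR hx), one_mul]
        refine mul_le_mul_of_nonneg_right ?_ (en_nonneg u x)
        have hx' : ‖x‖ ^ 2 ≤ ρ ^ 2 := by
          rw [mem_closedBall, dist_zero_right] at hx
          exact pow_le_pow_left₀ (norm_nonneg _) hx 2
        have hr : (2 * ρ ^ 2)⁻¹ ≤ radW ρ x := by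
          rw [radW]; exact inv_anti₀ (by positivity) (by linarith)
        calc (2 * ρ ^ 2)⁻¹ = 2 * ρ ^ 2 * (2 * ρ ^ 2)⁻¹ ^ 2 := by field_simp
          _ ≤ _ := mul_le_mul_of_nonneg_left (pow_le_pow_left₀ (by positivity) hr 2) (by positivity)
    _ ≤ _ := setIntegral_closedBall_mono hcl (fun x => mul_nonneg (cut_nonneg _ _ _)
        (mul_nonneg (by positivity) (en_nonneg u x))) (by rw [dist_self]; linarith)

end monotone

lemma le_of_backward_recursion {a : ℕ → ℝ} {J : ℕ} {b d δ M : ℝ} (hb : 0 ≤ b) (hM : 0 ≤ M + δ)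
    (h : ∀ i < J, a i ≤ b * (∑ j ∈ Finset.Icc i J, (1 / 2) ^ j * (a (j + 1) + δ)) + d)
    (hJ : a J ≤ M) (hJ1 : a (J + 1) ≤ M) (hbM : 2 * b * (M + δ) + d ≤ M) :
    ∀ i ≤ J + 1, a i ≤ M := by
  have key : ∀ n i, i ≤ J + 1 → J + 1 - i = n → a i ≤ M := by
    intro n
    induction n using Nat.strong_induction_on with
    | _ n ih =>
      intro i hi hn
      rcases Nat.lt_or_ge i J with hlt | hge
      · refine (h i hlt).trans (le_trans ?_ hbM)
        have h1 : ∑ j ∈ Finset.Icc i J, (1 / 2 : ℝ) ^ j * (a (j + 1) + δ)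
            ≤ ∑ j ∈ Finset.Icc i J, (1 / 2 : ℝ) ^ j * (M + δ) := by
          refine Finset.sum_le_sum fun j hj => ?_
          rw [Finset.mem_Icc] at hj
          have := ih (J + 1 - (j + 1)) (by omega) (j + 1) (by omega) rfl
          exact mul_le_mul_of_nonneg_left (by linarith) (by positivity)
        have h2 : ∑ j ∈ Finset.Icc i J, (1 / 2 : ℝ) ^ j ≤ 2 := by
          refine le_trans (Finset.sum_le_sum_of_subset_of_nonneg (t := Finset.range (J + 1)) ?_
            fun _ _ _ => by positivity) (sum_geometric_two_le (J + 1))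
          intro j hj
          rw [Finset.mem_Icc] at hj
          exact Finset.mem_range.2 (by omega)
        rw [← Finset.sum_mul] at h1
        have h3 := mul_le_mul_of_nonneg_right h2 hM
        have h4 := mul_le_mul_of_nonneg_left (h1.trans h3) hb
        linarith
      · rcases (by omega : i = J ∨ i = J + 1) with rfl | rfl
        · exact hJ
        · exact hJ1
  exact fun i hi => key _ i hi rfl

lemma radW_le_inv_sq {ρ r : ℝ} {x : E 3} (hr : 0 < r) (h : r ≤ ρ ∨ r ≤ ‖x‖) :
    radW ρ x ≤ (r ^ 2)⁻¹ := by
  rw [radW]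
  refine inv_anti₀ (by positivity) ?_
  rcases h with h | h
  · have := pow_le_pow_left₀ hr.le h 2
    nlinarith [sq_nonneg ‖x‖]
  · have := pow_le_pow_left₀ hr.le h 2
    nlinarith [sq_nonneg ρ]

lemma integral_mul_radW_le {F : E 3 → ℝ} (hF : Continuous F) (hF0 : ∀ x, 0 ≤ F x) {r₀ Λ : ℝ}
    (hr₀ : 0 < r₀) (hΛ : 1 ≤ Λ) (i m : ℕ) (him : i ≤ m) :
    ∫ x in closedBall (0 : E 3) (r₀ * Λ ^ m), F x * radW (r₀ * Λ ^ i) x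
      ≤ ∑ j ∈ Finset.Icc i m, Λ ^ 2 * ((r₀ * Λ ^ j) ^ 2)⁻¹
        * ∫ x in closedBall (0 : E 3) (r₀ * Λ ^ j), F x := by
  have hΛ0 : 0 < Λ := by linarith
  have hp : ∀ j : ℕ, 0 < r₀ * Λ ^ j := fun j => by positivity
  have hcr := (contDiff_radW (hp i)).continuous
  have hintg : ∀ {f : E 3 → ℝ} (r : ℝ), Continuous f → IntegrableOn f (closedBall (0 : E 3) r) :=
    fun r hf => hf.continuousOn.integrableOn_compact (isCompact_closedBall _ _)
  induction m, him using Nat.le_induction with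
  | base =>
    rw [Finset.Icc_self, Finset.sum_singleton, ← integral_const_mul]
    refine setIntegral_mono (hintg _ (hF.fun_mul hcr)) (hintg _ (hF.const_mul _)) fun x => ?_
    have h1 : radW (r₀ * Λ ^ i) x ≤ ((r₀ * Λ ^ i) ^ 2)⁻¹ := radW_le_inv_sq (hp i) (Or.inl le_rfl)
    have h2 : ((r₀ * Λ ^ i) ^ 2)⁻¹ ≤ Λ ^ 2 * ((r₀ * Λ ^ i) ^ 2)⁻¹ :=
      le_mul_of_one_le_left (by positivity) (one_le_pow₀ hΛ)
    have := mul_le_mul_of_nonneg_left (h1.trans h2) (hF0 x)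
    simp only
    linarith
  | succ m him ih =>
    rw [Finset.sum_Icc_succ_top (by omega)]
    have hsub : closedBall (0 : E 3) (r₀ * Λ ^ m) ⊆ closedBall (0 : E 3) (r₀ * Λ ^ (m + 1)) := by
      refine closedBall_subset_closedBall ?_
      exact mul_le_mul_of_nonneg_left (pow_le_pow_right₀ hΛ (by omega)) hr₀.le
    have hG := hintg (r₀ * Λ ^ (m + 1)) (hF.fun_mul hcr)
    have hsplit := setIntegral_union (μ := volume) (f := fun x => F x * radW (r₀ * Λ ^ i) x)
      (disjoint_sdiff_right : Disjoint (closedBall (0 : E 3) (r₀ * Λ ^ m))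
        (closedBall (0 : E 3) (r₀ * Λ ^ (m + 1)) \ closedBall (0 : E 3) (r₀ * Λ ^ m)))
      (measurableSet_closedBall.diff measurableSet_closedBall) (hG.mono_set hsub)
      (hG.mono_set sdiff_subset)
    rw [union_sdiff_cancel hsub] at hsplit
    rw [hsplit]
    refine add_le_add ih ?_
    have e : Λ ^ 2 * ((r₀ * Λ ^ (m + 1)) ^ 2)⁻¹ = ((r₀ * Λ ^ m) ^ 2)⁻¹ := by
      field_simp; ring
    rw [e, ← integral_const_mul]
    have hF' := hintg (r₀ * Λ ^ (m + 1)) (hF.const_mul ((r₀ * Λ ^ m) ^ 2)⁻¹)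
    calc _ ≤ ∫ x in closedBall (0 : E 3) (r₀ * Λ ^ (m + 1)) \ closedBall (0 : E 3) (r₀ * Λ ^ m),
          ((r₀ * Λ ^ m) ^ 2)⁻¹ * F x := by
          refine setIntegral_mono_on (hG.mono_set sdiff_subset) (hF'.mono_set sdiff_subset)
            (measurableSet_closedBall.diff measurableSet_closedBall) fun x hx => ?_
          have hx2 : r₀ * Λ ^ m ≤ ‖x‖ := by
            have := hx.2
            rw [mem_closedBall, dist_zero_right, not_le] at this
            exact this.le
          rw [mul_comm]
          exact mul_le_mul_of_nonneg_right (radW_le_inv_sq (hp m) (Or.inr hx2)) (hF0 x)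
      _ ≤ _ := setIntegral_mono_set hF' (Eventually.of_forall fun x =>
          mul_nonneg (by positivity) (hF0 x)) (LE.le.eventuallyLE sdiff_subset)

/-- Decay of the energy ratio down to a fixed unit-scale radius. -/
lemma exists_energy_decay : ∃ r₀ R₀ C : ℝ, 2 ≤ r₀ ∧ r₀ ≤ R₀ ∧ 0 ≤ C ∧ ∀ u : E 3 → ℝ, ContDiff ℝ 2 u →
    HasCompactSupport u → ∀ R, R₀ ≤ R → ∫ x in closedBall (0 : E 3) R, chem u x ^ 2 ≤ 1 →
    ∫ x in closedBall (0 : E 3) r₀, en u x ≤ C * ((∫ x in closedBall (0 : E 3) R, chem u x ^ 2)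
      + (∫ x in closedBall (0 : E 3) R, en u x) / R ^ 2) := by
  obtain ⟨C, K, hC, hK, hdis⟩ := exists_integral_discr_pos_le
  obtain ⟨A, hA, hmon⟩ := exists_monotonicity
  obtain ⟨Λ, hΛ⟩ : ∃ Λ : ℝ, Λ = 2 ^ 111 := ⟨_, rfl⟩
  have hΛ8 : 8 ≤ Λ := by rw [hΛ]; norm_num
  have hΛ1 : 1 ≤ Λ := by linarith
  have hΛ0 : 0 < Λ := by linarith
  set q₀ := (10 * C * Λ ^ 4)⁻¹ with hq₀
  have hΛ4 : 1 ≤ Λ ^ 4 := one_le_pow₀ hΛ1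
  have hCΛ : 1 ≤ C * Λ ^ 4 := one_le_mul_of_one_le_of_one_le hC hΛ4
  have hq0 : 0 < q₀ := by positivity
  have hq10 : q₀ ≤ 1 / 10 := by
    rw [hq₀, one_div]; exact inv_anti₀ (by norm_num) (by linarith)
  have hqC : C * Λ ^ 4 * q₀ = 1 / 10 := by rw [hq₀]; field_simp
  have hqi : 10 ≤ q₀⁻¹ := by rw [hq₀, inv_inv]; linarith
  set r₀ := K * q₀⁻¹ ^ 111 with hr₀
  have hr2 : 2 ≤ r₀ := by
    have h1 : q₀⁻¹ ≤ q₀⁻¹ ^ 111 := le_self_pow₀ (by linarith) (by norm_num)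
    have h2 : q₀⁻¹ ^ 111 ≤ r₀ := le_mul_of_one_le_left (by positivity) hK
    linarith
  have hr0 : 0 < r₀ := by linarith
  refine ⟨r₀, r₀ * Λ, r₀ ^ 2 * (2 + 16 * A * Λ ^ 4 + Λ ^ 4), hr2,
    le_mul_of_one_le_right hr0.le hΛ1, by positivity, fun u hu huc R hR hδ1 => ?_⟩
  have hu1 : ContDiff ℝ 1 u := hu.of_le (by norm_num)
  have hcf : Continuous fun y => chem u y ^ 2 := (continuous_chem hu).pow 2
  have hce := continuous_en hu1
  set δ := ∫ x in closedBall (0 : E 3) R, chem u x ^ 2 with hδ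
  have hδ0 : 0 ≤ δ := integral_nonneg fun _ => sq_nonneg _
  have hfm : ∀ r, r ≤ R → ∫ z in closedBall (0 : E 3) r, chem u z ^ 2 ≤ δ := fun r h =>
    setIntegral_closedBall_mono hcf (fun _ => sq_nonneg _) (by rw [dist_self]; linarith)
  set En : ℝ → ℝ := fun r => ∫ x in closedBall (0 : E 3) r, en u x with hEn
  have hem : ∀ r r', r ≤ r' → En r ≤ En r' := fun r r' h =>
    setIntegral_closedBall_mono hce (fun _ => en_nonneg _ _) (by rw [dist_self]; linarith)
  have hE0 : ∀ r, 0 ≤ En r := fun r => integral_nonneg fun _ => en_nonneg _ _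
  have hRp : 0 < R := by nlinarith
  set κ := En R / R ^ 2 with hκ
  have hκ0 : 0 ≤ κ := div_nonneg (hE0 R) (by positivity)
  have hEκ : En R = κ * R ^ 2 := by rw [hκ]; field_simp
  obtain ⟨n, hn1, hn2⟩ := exists_nat_pow_near (x := R / r₀) (y := Λ)
    (by rw [le_div_iff₀ hr0]; nlinarith) (by linarith)
  rw [le_div_iff₀ hr0] at hn1
  rw [div_lt_iff₀ hr0] at hn2
  have hn0 : n ≠ 0 := by
    rintro rfl
    rw [zero_add, pow_one] at hn2
    linarith
  obtain ⟨J, rfl⟩ := Nat.exists_eq_add_one_of_ne_zero hn0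
  set ρ : ℕ → ℝ := fun j => r₀ * Λ ^ j with hρ
  have hρ0 : ∀ j, 0 < ρ j := fun j => by positivity
  have hρ1 : ∀ j, 1 ≤ ρ j := fun j =>
    one_le_mul_of_one_le_of_one_le (by linarith) (one_le_pow₀ hΛ1)
  have hρs : ∀ j, ρ (j + 1) = Λ * ρ j := fun j => by simp only [hρ]; ring
  have hρm : ∀ i j, i ≤ j → ρ i ≤ ρ j := fun i j h =>
    mul_le_mul_of_nonneg_left (pow_le_pow_right₀ hΛ1 h) hr0.le
  have hJR : ρ (J + 1) ≤ R := by simp only [hρ]; linarith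
  have hRJ : R ≤ Λ * ρ (J + 1) := by
    rw [← hρs]; simp only [hρ]; linarith
  set a : ℕ → ℝ := fun j => En (ρ j) / ρ j ^ 2 with ha
  have ha0 : ∀ j, 0 ≤ a j := fun j => div_nonneg (hE0 _) (by positivity)
  have hEa : ∀ j, En (ρ j) = a j * ρ j ^ 2 := fun j => by
    have := hρ0 j
    simp only [ha]; field_simp
  have haJ1 : a (J + 1) ≤ Λ ^ 2 * κ := by
    simp only [ha]
    rw [div_le_iff₀ (pow_pos (hρ0 _) 2)]
    calc En (ρ (J + 1)) ≤ κ * R ^ 2 := hEκ ▸ hem _ _ hJR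
      _ ≤ κ * (Λ * ρ (J + 1)) ^ 2 :=
          mul_le_mul_of_nonneg_left (pow_le_pow_left₀ hRp.le hRJ 2) hκ0
      _ = _ := by ring
  have haJ : a J ≤ Λ ^ 4 * κ := by
    have h1 : a J ≤ Λ ^ 2 * a (J + 1) := by
      have h2 := hem _ _ (hρm J (J + 1) (by omega))
      rw [hEa J, hEa (J + 1), hρs] at h2
      have h3 : a J * ρ J ^ 2 ≤ Λ ^ 2 * a (J + 1) * ρ J ^ 2 := by linarith
      exact le_of_mul_le_mul_right h3 (pow_pos (hρ0 J) 2)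
    have := mul_le_mul_of_nonneg_left haJ1 (by positivity : 0 ≤ Λ ^ 2)
    linarith
  have hdisj : ∀ j ≤ J, Λ ^ 2 * (ρ j ^ 2)⁻¹ * ∫ x in closedBall (0 : E 3) (ρ j), max (discr u x) 0
      ≤ C * Λ ^ 4 * q₀ * ((1 / 2) ^ j * (a (j + 1) + δ)) := by
    intro j hj
    have hq : 0 < q₀ * (1 / 2 : ℝ) ^ j := by positivity
    have hq' : q₀ * (1 / 2 : ℝ) ^ j ≤ 1 / 10 :=
      (mul_le_of_le_one_right hq0.le (pow_le_one₀ (by norm_num) (by norm_num))).trans hq10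
    have hKρ : K * (q₀ * (1 / 2 : ℝ) ^ j)⁻¹ ^ 111 ≤ ρ j := by
      refine le_of_eq ?_
      simp only [hρ, hr₀]
      rw [hΛ, one_div, inv_pow 2 j, mul_inv, inv_inv ((2 : ℝ) ^ j), mul_pow, ← pow_mul, ← pow_mul, mul_comm j 111,
        mul_assoc]
    have h8 : 8 * ρ j ≤ ρ (j + 1) := by
      rw [hρs]; exact mul_le_mul_of_nonneg_right hΛ8 (hρ0 j).le
    have h8R : 8 * ρ j ≤ R := h8.trans ((hρm _ _ (by omega)).trans hJR)
    have h := hdis _ hq hq' _ hKρ u hu huc ((hfm _ h8R).trans hδ1)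
    have h9 : (∫ x in closedBall (0 : E 3) (8 * ρ j), en u x)
        + ρ j * ∫ x in closedBall (0 : E 3) (8 * ρ j), chem u x ^ 2
        ≤ Λ ^ 2 * ρ j ^ 2 * (a (j + 1) + δ) := by
      have k1 : (∫ x in closedBall (0 : E 3) (8 * ρ j), en u x) ≤ a (j + 1) * (Λ * ρ j) ^ 2 := by
        rw [← hρs, ← hEa]; exact hem _ _ h8
      have k2 : ρ j * ∫ x in closedBall (0 : E 3) (8 * ρ j), chem u x ^ 2 ≤ ρ j * δ :=
        mul_le_mul_of_nonneg_left (hfm _ h8R) (hρ0 j).le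
      have k3 : ρ j ≤ Λ ^ 2 * ρ j ^ 2 := by
        have k4 : ρ j ≤ ρ j ^ 2 := le_self_pow₀ (hρ1 j) (by norm_num)
        exact k4.trans (le_mul_of_one_le_left (by positivity) (one_le_pow₀ hΛ1))
      have k5 := mul_le_mul_of_nonneg_right k3 hδ0
      linarith
    have hρj := hρ0 j
    calc _ ≤ Λ ^ 2 * (ρ j ^ 2)⁻¹ * (C * (q₀ * (1 / 2 : ℝ) ^ j) * (Λ ^ 2 * ρ j ^ 2 * (a (j + 1) + δ))) :=
          mul_le_mul_of_nonneg_left (h.trans (mul_le_mul_of_nonneg_left h9 (by positivity)))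
            (by positivity)
      _ = _ := by field_simp
  have hcd : Continuous fun x => max (discr u x) 0 := (continuous_discr hu1).max continuous_const
  have hrec : ∀ i < J, a i ≤ 2 * (C * Λ ^ 4 * q₀) * (∑ j ∈ Finset.Icc i J,
      (1 / 2) ^ j * (a (j + 1) + δ)) + (δ / 2 + 8 * A * (Λ ^ 4 * κ)) := by
    intro i hi
    have hiJ : ρ i ≤ ρ J / 2 := by
      have h1 := hρm (i + 1) J hi
      rw [hρs] at h1
      nlinarith [hρ0 i]
    have hm := hmon u hu (ρ i) (ρ J / 2) (hρ0 i) hiJ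
    rw [mul_div_cancel₀ _ (two_ne_zero' ℝ)] at hm
    have k1 := integral_mul_radW_le hcd (fun x => le_max_right _ _) hr0 hΛ1 i J hi.le
    have k2 : ∑ j ∈ Finset.Icc i J, Λ ^ 2 * ((r₀ * Λ ^ j) ^ 2)⁻¹
        * ∫ x in closedBall (0 : E 3) (r₀ * Λ ^ j), max (discr u x) 0
        ≤ C * Λ ^ 4 * q₀ * ∑ j ∈ Finset.Icc i J, (1 / 2) ^ j * (a (j + 1) + δ) := by
      rw [Finset.mul_sum]
      exact Finset.sum_le_sum fun j hj => hdisj j (Finset.mem_Icc.1 hj).2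
    have k3 := hfm (ρ J) ((hρm _ _ (by omega)).trans hJR)
    have k4 : A / (ρ J / 2) ^ 2 * En (ρ J) = 4 * A * a J := by
      have := hρ0 J
      rw [hEa]; field_simp; ring
    have k5 : En (ρ i) / (2 * ρ i ^ 2) = a i / 2 := by
      have := hρ0 i
      rw [hEa]; field_simp
    have k6 := mul_le_mul_of_nonneg_left haJ (by positivity : 0 ≤ 4 * A)
    change En (ρ i) / (2 * ρ i ^ 2) ≤ _ + _ + A / (ρ J / 2) ^ 2 * En (ρ J) at hm
    rw [k4, k5] at hm
    have k7 := k1.trans k2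
    change ∫ x in closedBall (0 : E 3) (ρ J), max (discr u x) 0 * radW (ρ i) x ≤ _ at k7
    linarith
  set M := 2 * δ + 16 * A * (Λ ^ 4 * κ) + Λ ^ 4 * κ with hM
  have hAκ : 0 ≤ A * (Λ ^ 4 * κ) := by positivity
  have hΛκ : 0 ≤ Λ ^ 4 * κ := by positivity
  have hfin := le_of_backward_recursion (M := M) (by positivity) (by linarith) hrec (by linarith)
    (by
      have : Λ ^ 2 * κ ≤ Λ ^ 4 * κ :=
        mul_le_mul_of_nonneg_right (pow_le_pow_right₀ hΛ1 (by norm_num)) hκ0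
      linarith) (by rw [hqC]; linarith) 0 (by omega)
  have hρz : ρ 0 = r₀ := by simp [hρ]
  have h1 := hEa 0
  rw [hρz] at h1
  change En r₀ ≤ _
  rw [h1]
  have h2 := mul_le_mul_of_nonneg_right hfin (by positivity : 0 ≤ r₀ ^ 2)
  refine h2.trans ?_
  have h3 : M ≤ (2 + 16 * A * Λ ^ 4 + Λ ^ 4) * (δ + κ) := by
    have : 0 ≤ A * (Λ ^ 4 * δ) := by positivity
    have : 0 ≤ Λ ^ 4 * δ := by positivity
    linarith
  have h4 := mul_le_mul_of_nonneg_right h3 (by positivity : 0 ≤ r₀ ^ 2)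
  linarith

lemma sq_abs_sub_one_le_W (t : ℝ) : (|t| - 1) ^ 2 / 4 ≤ W t := by
  have h : W t = (|t| - 1) ^ 2 * (|t| + 1) ^ 2 / 4 := by
    rw [W, ← sq_abs t]; ring
  rw [h]
  have h1 : 1 ≤ (|t| + 1) ^ 2 := one_le_pow₀ (by linarith [abs_nonneg t])
  have := le_mul_of_one_le_right (sq_nonneg (|t| - 1)) h1
  linarith

/-- Clearing-out: a small Willmore energy and a small scaled area energy in a large ball force
the values near its centre to be close to `±1`. -/
lemma exists_clearing_out {τ : ℝ} (hτ : 0 < τ) : ∃ δ R₀ : ℝ, 0 < δ ∧ 0 < R₀ ∧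
    ∀ u : E 3 → ℝ, ContDiff ℝ 2 u → HasCompactSupport u → ∀ R, R₀ ≤ R →
    ∫ x in closedBall (0 : E 3) R, chem u x ^ 2 ≤ δ →
    ∫ x in closedBall (0 : E 3) R, en u x ≤ δ * R ^ 2 → |(|u 0| - 1)| < τ := by
  obtain ⟨C₀, hC₀, hsup⟩ := exists_sup_bound
  obtain ⟨A, hA0, hA⟩ := exists_abs_sub_avg_center_le C₀
  obtain ⟨r₀, R₀, C, hr₀, hrR, hC, hdecay⟩ := exists_energy_decay
  have hD : 0 ≤ (C₀ ^ 3 + C₀) * (2 * A) := by positivity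
  set s : ℝ := min 1 (τ ^ 2 / 8 / ((C₀ ^ 3 + C₀) * (2 * A) + 1)) with hs
  have hs0 : 0 < s := by positivity
  have hs1 : s ≤ 1 := min_le_left _ _
  have hsD : (C₀ ^ 3 + C₀) * (2 * A) * s ≤ τ ^ 2 / 8 := by
    have h1 : s * ((C₀ ^ 3 + C₀) * (2 * A) + 1) ≤ τ ^ 2 / 8 :=
      (le_div_iff₀ (by positivity)).1 (min_le_right _ _)
    nlinarith
  set V : ℝ := volume.real (closedBall (0 : E 3) s) with hV
  have hV0 : 0 < V := ENNReal.toReal_pos (measure_closedBall_pos _ _ hs0).ne'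
    measure_closedBall_lt_top.ne
  set η : ℝ := τ ^ 2 / 8 * V / (2 * C + 1) with hη
  have hη0 : 0 < η := by positivity
  refine ⟨min (min 1 ((s ^ 4) ^ 2)) η, max R₀ 4, by positivity, by positivity,
    fun u hu huc R hR hchem hen => ?_⟩
  have hR4 : 4 ≤ R := (le_max_right _ _).trans hR
  have hcc : Continuous fun x => chem u x ^ 2 := (continuous_chem hu).pow 2
  have hchem1 := hchem.trans ((min_le_left _ _).trans (min_le_left _ _))
  have hchems := hchem.trans ((min_le_left _ _).trans (min_le_right _ _))
  have hchemη := hchem.trans (min_le_right _ _)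
  have hsmall : ∫ x in closedBall (0 : E 3) r₀, en u x ≤ C * (2 * η) := by
    refine (hdecay u hu huc R ((le_max_left _ _).trans hR) hchem1).trans
      (mul_le_mul_of_nonneg_left ?_ hC)
    have : (∫ x in closedBall (0 : E 3) R, en u x) / R ^ 2 ≤ η := by
      rw [div_le_iff₀ (by positivity)]
      exact hen.trans (mul_le_mul_of_nonneg_right (min_le_right _ _) (sq_nonneg R))
    linarith
  have hgood : GoodAt C₀ s u 0 := by
    refine ⟨fun z hz => hsup u hu huc z (le_trans ?_ hchem1), le_trans ?_ hchems⟩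
    · refine setIntegral_closedBall_mono hcc (fun _ => sq_nonneg _) ?_
      rw [mem_closedBall] at hz
      linarith
    · refine setIntegral_closedBall_mono hcc (fun _ => sq_nonneg _) ?_
      rw [dist_self]
      linarith
  by_contra! hτu
  have hW0 : τ ^ 2 / 4 ≤ W (u 0) := by
    refine le_trans ?_ (sq_abs_sub_one_le_W (u 0))
    have := pow_le_pow_left₀ hτ.le hτu 2
    rw [sq_abs] at this
    linarith
  have hWy : ∀ y ∈ closedBall (0 : E 3) s, τ ^ 2 / 8 ≤ W (u y) := by
    intro y hy
    rw [mem_closedBall] at hy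
    have h1 := hA hgood hu huc hs0 hs1 hy
    have h2 := hA hgood hu huc hs0 hs1 (y := 0) (by rw [dist_self]; exact hs0.le)
    have h3 : |u 0 - u y| ≤ 2 * A * s := by
      have := abs_sub_le (u 0) (avg kerK s u 0) (u y)
      rw [abs_sub_comm (avg kerK s u 0) (u y)] at this
      linarith
    have h4 := abs_W_sub_le (hgood.bound 0 (mem_closedBall_self (by norm_num)))
      (hgood.bound y (mem_closedBall.2 (by linarith)))
    have h5 := mul_le_mul_of_nonneg_left h3 (by positivity : 0 ≤ C₀ ^ 3 + C₀)
    have h6 := le_abs_self (W (u 0) - W (u y))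
    linarith
  have hlow : τ ^ 2 / 8 * V ≤ ∫ x in closedBall (0 : E 3) s, en u x := by
    have := setIntegral_ge_of_const_le_real (μ := volume) (f := en u) (c := τ ^ 2 / 8)
      measurableSet_closedBall (measure_closedBall_lt_top (μ := volume) (x := (0 : E 3)) (r := s)).ne
      (fun y hy => (hWy y hy).trans (W_le_en u y))
      ((continuous_en (hu.of_le (by norm_num))).continuousOn.integrableOn_compact
        (isCompact_closedBall _ _))
    exact this
  have hmono : ∫ x in closedBall (0 : E 3) s, en u x ≤ ∫ x in closedBall (0 : E 3) r₀, en u x := by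
    refine setIntegral_closedBall_mono (continuous_en (hu.of_le (by norm_num))) (en_nonneg u) ?_
    rw [dist_self]
    linarith
  have hηe : η * (2 * C + 1) = τ ^ 2 / 8 * V := div_mul_cancel₀ _ (by positivity)
  nlinarith

lemma setIntegral_closedBall_comp_affine (G : E 3 → ℝ) {t : ℝ} (ht : 0 < t) (x : E 3) (R : ℝ) :
    ∫ y in closedBall (0 : E 3) R, G (x + t • y)
      = (t ^ 3)⁻¹ * ∫ z in closedBall x (t * R), G z := by
  rw [← integral_indicator measurableSet_closedBall, ← integral_indicator measurableSet_closedBall]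
  have e : (closedBall (0 : E 3) R).indicator (fun y => G (x + t • y))
      = fun y => (fun z => (closedBall x (t * R)).indicator G (x + z)) (t • y) := by
    ext y
    have : y ∈ closedBall (0 : E 3) R ↔ x + t • y ∈ closedBall x (t * R) := by
      rw [mem_closedBall, mem_closedBall, dist_zero_right, dist_self_add_left, norm_smul,
        Real.norm_eq_abs, abs_of_pos ht, mul_le_mul_iff_right₀ ht]
    by_cases h : y ∈ closedBall (0 : E 3) R
    · simp only [indicator_of_mem h, indicator_of_mem (this.1 h)]
    · simp only [indicator_of_notMem h, indicator_of_notMem (this.not.1 h)]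
  rw [e, Measure.integral_comp_smul, integral_add_left_eq_self]
  simp [abs_of_pos ht]

lemma en_comp_affine {U : E 3 → ℝ} (hU : ContDiff ℝ 2 U) {ev : ℝ} (hev : 0 < ev) (x y : E 3) :
    en (fun y => U (x + ev • y)) y = ev * areaDensity ev U (x + ev • y) := by
  have hd : Differentiable ℝ U := hU.differentiable (by norm_num)
  rw [en, areaDensity, norm_fderiv_sq]
  simp only [gradSq, pd_comp_affine _ _ _ _ (hd _), mul_pow, ← Finset.mul_sum]
  field_simp

lemma chem_comp_affine_sq {U : E 3 → ℝ} (hU : ContDiff ℝ 2 U) {ev : ℝ} (hev : 0 < ev) (x y : E 3) :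
    chem (fun y => U (x + ev • y)) y ^ 2 = ev ^ 2 * willDensity ev U (x + ev • y) := by
  have hd : Differentiable ℝ U := hU.differentiable (by norm_num)
  have hdp : ∀ i, Differentiable ℝ (pd i U) := fun i =>
    (contDiff_one_pd i hU).differentiable (by norm_num)
  have hv : ContDiff ℝ 2 fun y => U (x + ev • y) := hU.comp (by fun_prop)
  have hl : lap (fun y => U (x + ev • y)) y = ev ^ 2 * lap U (x + ev • y) := by
    rw [lap_eq hv, lap_eq hU, Finset.mul_sum]
    refine Finset.sum_congr rfl fun i _ => ?_
    rw [show pd i (fun y => U (x + ev • y)) = fun y => ev * pd i U (x + ev • y) from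
      funext fun y => pd_comp_affine i ev x y (hd _)]
    rw [pd_const_mul i ev (f := fun y => pd i U (x + ev • y))
      ((hdp i).comp (by fun_prop : Differentiable ℝ fun y : E 3 => x + ev • y) y),
      pd_comp_affine i ev x y (hdp i _)]
    ring
  rw [chem, hl, willDensity]
  field_simp

/-- The clearing-out lemma at scale `ev`. -/
lemma exists_clearing_out_scaled {τ : ℝ} (hτ : 0 < τ) : ∃ δ R₀ : ℝ, 0 < δ ∧ 0 < R₀ ∧
    ∀ U : E 3 → ℝ, ContDiff ℝ 2 U → HasCompactSupport U → ∀ (x : E 3) (ev r : ℝ), 0 < ev →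
    R₀ * ev ≤ r → ∫ z in closedBall x r, willDensity ev U z ≤ δ * ev →
    ∫ z in closedBall x r, areaDensity ev U z ≤ δ * r ^ 2 → |(|U x| - 1)| < τ := by
  obtain ⟨δ, R₀, hδ, hR₀, h⟩ := exists_clearing_out hτ
  refine ⟨δ, R₀, hδ, hR₀, fun U hU hUc x ev r hev hr hw ha => ?_⟩
  have hvc : HasCompactSupport fun y => U (x + ev • y) :=
    hUc.comp_homeomorph ((Homeomorph.smulOfNeZero ev hev.ne').trans (Homeomorph.addLeft x))
  have he : ev * (r / ev) = r := mul_div_cancel₀ r hev.ne'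
  have := h (fun y => U (x + ev • y)) (hU.comp (by fun_prop)) hvc (r / ev)
    ((le_div_iff₀ hev).2 hr) ?_ ?_
  · simpa using this
  · simp only [chem_comp_affine_sq hU hev]
    rw [integral_const_mul, setIntegral_closedBall_comp_affine _ hev, he]
    calc _ = (∫ z in closedBall x r, willDensity ev U z) / ev := by field_simp
      _ ≤ δ := (div_le_iff₀ hev).2 hw
  · simp only [en_comp_affine hU hev]
    rw [integral_const_mul, setIntegral_closedBall_comp_affine _ hev, he]
    calc _ = (∫ z in closedBall x r, areaDensity ev U z) / ev ^ 2 := by field_simp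
      _ ≤ δ * r ^ 2 / ev ^ 2 := by gcongr
      _ = δ * (r / ev) ^ 2 := by ring

lemma exists_contDiff_eventuallyEq {Ω : Set (E 3)} (hΩ : IsOpen Ω) {f : E 3 → ℝ}
    (hf : ContDiffOn ℝ 2 f Ω) {x₀ : E 3} {r R : ℝ} (hr : 0 ≤ r) (hrR : r < R)
    (hsub : closedBall x₀ R ⊆ Ω) :
    ∃ U : E 3 → ℝ, ContDiff ℝ 2 U ∧ HasCompactSupport U ∧
      ∀ y ∈ closedBall x₀ r, U =ᶠ[nhds y] f := by
  let ζ : ContDiffBump x₀ := ⟨(r + R) / 2, R, by linarith, by linarith⟩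
  refine ⟨fun y => ζ y * f y, contDiff_iff_contDiffAt.2 fun y => ?_,
    ζ.hasCompactSupport.mul_right, fun y hy => ?_⟩
  · by_cases hy : y ∈ Ω
    · exact ζ.contDiff.contDiffAt.mul (hf.contDiffAt (hΩ.mem_nhds hy))
    · have h0 : y ∉ tsupport ζ := fun h => hy (hsub (by rwa [ζ.tsupport_eq] at h))
      refine (contDiffAt_const (c := (0 : ℝ))).congr_of_eventuallyEq ?_
      filter_upwards [notMem_tsupport_iff_eventuallyEq.1 h0] with z hz
      rw [hz]
      simp
  · have hmem : ball x₀ ((r + R) / 2) ∈ nhds y := by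
      refine isOpen_ball.mem_nhds ?_
      rw [mem_closedBall] at hy
      rw [mem_ball]
      linarith
    filter_upwards [hmem] with z hz
    rw [ζ.one_of_mem_closedBall (ball_subset_closedBall hz), one_mul]

lemma setIntegral_closedBall_le_bump {Ω : Set (E 3)} {x₀ x : E 3} {r : ℝ} (φ : ContDiffBump x₀)
    (hΩ : closedBall x₀ φ.rOut ⊆ Ω) (hx : closedBall x r ⊆ closedBall x₀ φ.rIn) {F G : E 3 → ℝ}
    (hF : Continuous F) (hF0 : ∀ y, 0 ≤ F y) (hFG : ∀ y ∈ closedBall x₀ φ.rOut, G y = F y) :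
    ∫ y in closedBall x r, F y ≤ ∫ y in Ω, φ y * G y := by
  have hG : (fun y => φ y * G y) = fun y => φ y * F y := by
    ext y
    by_cases hy : y ∈ closedBall x₀ φ.rOut
    · rw [hFG y hy]
    · rw [φ.zero_of_le_dist (not_le.1 hy).le, zero_mul, zero_mul]
  have hintg : Integrable fun y => φ y * F y :=
    (φ.continuous.mul hF).integrable_of_hasCompactSupport φ.hasCompactSupport.mul_right
  rw [hG, setIntegral_eq_integral_of_forall_compl_eq_zero (s := Ω) (f := fun y => φ y * F y)]
  · calc ∫ y in closedBall x r, F y = ∫ y in closedBall x r, φ y * F y :=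
          setIntegral_congr_fun measurableSet_closedBall fun y hy => by
            rw [φ.one_of_mem_closedBall (hx hy), one_mul]
      _ ≤ _ := setIntegral_le_integral hintg
          (Eventually.of_forall fun y => mul_nonneg φ.nonneg (hF0 y))
  · intro y hy
    have h : y ∉ closedBall x₀ φ.rOut := fun h => hy (hΩ h)
    rw [φ.zero_of_le_dist (not_le.1 h).le, zero_mul]

lemma areaDensity_congr {ev : ℝ} {U f : E 3 → ℝ} {y : E 3} (h : U =ᶠ[nhds y] f) :
    areaDensity ev f y = areaDensity ev U y := by
  rw [areaDensity, areaDensity, h.fderiv_eq, h.eq_of_nhds]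

lemma willDensity_congr {ev : ℝ} {U f : E 3 → ℝ} {y : E 3} (h : U =ᶠ[nhds y] f) :
    willDensity ev f y = willDensity ev U y := by
  rw [willDensity, willDensity, lap, lap, h.fderiv.fderiv_eq, h.eq_of_nhds]

lemma continuous_areaDensity {ev : ℝ} {U : E 3 → ℝ} (hU : ContDiff ℝ 2 U) :
    Continuous (areaDensity ev U) :=
  (((hU.continuous_fderiv (by norm_num)).norm.pow 2).const_mul _).add
    ((continuous_W_comp hU.continuous).const_mul _)

lemma continuous_willDensity {ev : ℝ} {U : E 3 → ℝ} (hU : ContDiff ℝ 2 U) :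
    Continuous (willDensity ev U) :=
  (((continuous_lap hU).const_mul _).sub ((continuous_W'.comp hU.continuous).const_mul _)).pow 2

lemma areaDensity_nonneg {ev : ℝ} (hev : 0 < ev) (U : E 3 → ℝ) (y : E 3) :
    0 ≤ areaDensity ev U y := by
  have := W_nonneg (U y)
  rw [areaDensity]
  positivity

lemma c0_pos : 0 < c0 := by
  rw [c0]
  positivity

/-- A point whose mass is below `c` has a closed ball of mass below `c` around it. -/
lemma exists_measure_closedBall_lt {α : Measure (E 3)} [IsFiniteMeasure α] {x : E 3}
    {c : ENNReal} (h : α {x} < c) : ∃ r > 0, α (closedBall x r) < c := by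
  have ht : Tendsto (fun n : ℕ => α (closedBall x (1 / ((n : ℝ) + 1)))) atTop
      (nhds (α (⋂ n : ℕ, closedBall x (1 / ((n : ℝ) + 1))))) := by
    refine tendsto_measure_iInter_atTop (fun n => measurableSet_closedBall.nullMeasurableSet)
      (fun m n hmn => closedBall_subset_closedBall (Nat.one_div_le_one_div hmn))
      ⟨0, measure_ne_top _ _⟩
  have he : (⋂ n : ℕ, closedBall x (1 / ((n : ℝ) + 1))) = {x} := by
    ext y
    rw [mem_iInter, mem_singleton_iff]
    refine ⟨fun hy => ?_, fun hy n => hy ▸ mem_closedBall_self (by positivity)⟩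
    refine dist_le_zero.1 (ge_of_tendsto' tendsto_one_div_add_atTop_nhds_zero_nat fun n => hy n)
  rw [he] at ht
  obtain ⟨n, hn⟩ := (ht.eventually_lt_const h).exists
  exact ⟨_, Nat.one_div_pos_of_nat, hn⟩

lemma eventually_forall_mem_ball {Ω : Set (E 3)} (hΩo : IsOpen Ω)
    {ε : ℕ → ℝ} (hεpos : ∀ k, 0 < ε k) (hε0 : Tendsto ε atTop (nhds 0))
    {u : ℕ → E 3 → ℝ} (hu : ∀ k, ContDiffOn ℝ 2 (u k) Ω)
    {μ α : Measure (E 3)} [IsFiniteMeasure α]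
    (hμ : weakConvA Ω ε u μ) (hα : weakConvW Ω ε u α) {x₀ : E 3} {ρ τ δ R₀ : ℝ} (hρ : 0 < ρ)
    (hδ : 0 < δ)
    (hclear : ∀ U : E 3 → ℝ, ContDiff ℝ 2 U → HasCompactSupport U → ∀ (x : E 3) (ev r : ℝ),
      0 < ev → R₀ * ev ≤ r → ∫ z in closedBall x r, willDensity ev U z ≤ δ * ev →
      ∫ z in closedBall x r, areaDensity ev U z ≤ δ * r ^ 2 → |(|U x| - 1)| < τ)
    (hΩ : closedBall x₀ (4 * ρ) ⊆ Ω) (hμ0 : μ (ball x₀ (3 * ρ)) = 0)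
    (hα0 : α (closedBall x₀ (3 * ρ)) < ENNReal.ofReal (δ / c0)) :
    ∀ᶠ k in atTop, ∀ x ∈ ball x₀ ρ, |(|u k x| - 1)| < τ := by
  let φ : ContDiffBump x₀ := ⟨2 * ρ, 3 * ρ, by positivity, by linarith⟩
  let Φ : BoundedContinuousFunction (E 3) ℝ :=
    BoundedContinuousFunction.ofNormedAddCommGroup φ φ.continuous 1 fun x => by
      rw [Real.norm_eq_abs, abs_of_nonneg φ.nonneg]
      exact φ.le_one
  have hΦμ : ∫ x, Φ x ∂μ = 0 := by
    refine integral_eq_zero_of_ae ?_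
    have : ∀ᵐ x ∂μ, x ∉ ball x₀ (3 * ρ) := measure_eq_zero_iff_ae_notMem.1 hμ0
    filter_upwards [this] with x hx
    exact φ.zero_of_le_dist (not_lt.1 hx)
  have hΦα : ∫ x, Φ x ∂α < δ / c0 := by
    have hi : Integrable (fun x => φ x) α :=
      φ.continuous.integrable_of_hasCompactSupport φ.hasCompactSupport
    have h1 : ∫ x, Φ x ∂α ≤ ∫ x, (closedBall x₀ (3 * ρ)).indicator (fun _ => (1 : ℝ)) x ∂α := by
      refine integral_mono hi ((integrable_const 1).indicator measurableSet_closedBall) fun x => ?_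
      by_cases hx : x ∈ closedBall x₀ (3 * ρ)
      · rw [indicator_of_mem hx]
        exact φ.le_one
      · rw [indicator_of_notMem hx]
        exact (φ.zero_of_le_dist (not_le.1 hx).le).le
    rw [integral_indicator_const _ measurableSet_closedBall, smul_eq_mul, mul_one] at h1
    exact h1.trans_lt ((ENNReal.lt_ofReal_iff_toReal_lt (measure_ne_top _ _)).1 hα0)
  have hlimμ := hμ Φ
  rw [hΦμ] at hlimμ
  have hevμ := hlimμ.eventually_lt_const (div_pos (mul_pos hδ (pow_pos hρ 2)) c0_pos)
  have hevα := (hα Φ).eventually_lt_const hΦα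
  have hevε : ∀ᶠ k in atTop, R₀ * ε k < ρ := by
    have := hε0.const_mul R₀
    rw [mul_zero] at this
    exact this.eventually_lt_const hρ
  filter_upwards [hevμ, hevα, hevε] with k hkμ hkα hkε x hx
  obtain ⟨U, hU, hUc, hUe⟩ := exists_contDiff_eventuallyEq hΩo (hu k)
    (by positivity : 0 ≤ 3 * ρ) (by linarith : 3 * ρ < 4 * ρ) hΩ
  rw [mem_ball] at hx
  have hsubΩ : closedBall x₀ φ.rOut ⊆ Ω :=
    (closedBall_subset_closedBall (by change 3 * ρ ≤ 4 * ρ; linarith)).trans hΩ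
  have hsubx : closedBall x ρ ⊆ closedBall x₀ φ.rIn :=
    closedBall_subset_closedBall' (by change ρ + dist x x₀ ≤ 2 * ρ; linarith)
  have hε := hεpos k
  have hc := c0_pos
  have hux : U x = u k x := (hUe x (mem_closedBall.2 (by linarith))).eq_of_nhds
  rw [← hux]
  refine hclear U hU hUc x (ε k) ρ hε hkε.le ?_ ?_
  · refine (setIntegral_closedBall_le_bump φ hsubΩ hsubx (continuous_willDensity hU)
      (fun _ => sq_nonneg _) fun y hy => willDensity_congr (hUe y hy)).trans ?_
    have h : (1 / (c0 * ε k)) * ∫ y in Ω, φ y * willDensity (ε k) (u k) y < δ / c0 := hkα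
    rw [one_div_mul_eq_div, div_lt_div_iff₀ (by positivity) hc] at h
    have : (∫ y in Ω, φ y * willDensity (ε k) (u k) y) * c0 < (δ * ε k) * c0 := by linarith
    exact (lt_of_mul_lt_mul_right this hc.le).le
  · refine (setIntegral_closedBall_le_bump φ hsubΩ hsubx (continuous_areaDensity hU)
      (areaDensity_nonneg hε U) fun y hy => areaDensity_congr (hUe y hy)).trans ?_
    have h : (1 / c0) * ∫ y in Ω, φ y * areaDensity (ε k) (u k) y < δ * ρ ^ 2 / c0 := hkμ
    rw [one_div_mul_eq_div] at h
    exact ((div_lt_div_iff_of_pos_right hc).1 h).le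

theorem stmt13 (Ω : Set (E 3)) (hΩo : IsOpen Ω) (hΩb : Bornology.IsBounded Ω)
    (ε : ℕ → ℝ) (hεpos : ∀ k, 0 < ε k) (hε0 : Tendsto ε atTop (nhds 0))
    (u : ℕ → E 3 → ℝ) (hu : ∀ k, ContDiffOn ℝ 2 (u k) (closure Ω))
    (A : ℝ) (hA : ∀ k, Se (ε k) Ω (u k) + We (ε k) Ω (u k) ≤ A)
    (θ : ℝ) (hθ : 1 ≤ θ) (hbd : ∀ k, ∀ x ∈ frontier Ω, |u k x| ≤ θ)
    (μ α : Measure (E 3)) [IsFiniteMeasure μ] [IsFiniteMeasure α]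
    (hμ : weakConvA Ω ε u μ) (hα : weakConvW Ω ε u α)
    (ulim : E 3 → ℝ)
    (hL1 : Tendsto (fun k => ∫ x in Ω, |u k x - ulim x|) atTop (nhds 0))
    (Ω' : Set (E 3)) (hΩ'o : IsOpen Ω') (hsub : closure Ω' ⊆ Ω \ sptM μ)
    (hcpt : IsCompact (closure Ω'))
    (τ : ℝ) (hτ : 0 < τ) :
    ∃ cb > 0,
      (∀ x ∈ closure Ω', α {x} < ENNReal.ofReal cb) →
      ∃ K : ℕ, ∀ k ≥ K, ∀ x ∈ Ω', |(|u k x| - 1)| < τ := by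
  obtain ⟨δ, R₀, hδ, -, hclear⟩ := exists_clearing_out_scaled hτ
  refine ⟨δ / c0, div_pos hδ c0_pos, fun hatom => ?_⟩
  have key : ∀ᶠ k in atTop, ∀ x ∈ closure Ω', |(|u k x| - 1)| < τ := by
    refine hcpt.induction_on (p := fun s => ∀ᶠ k in atTop, ∀ x ∈ s, |(|u k x| - 1)| < τ) ?_ ?_ ?_ ?_
    · simp
    · exact fun s t hst ht => ht.mono fun k hk x hx => hk x (hst hx)
    · intro s t hs ht
      filter_upwards [hs, ht] with k hk1 hk2 x hx
      exact hx.elim (hk1 x) (hk2 x)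
    · intro x₀ hx₀
      obtain ⟨r₁, hr₁, hr₁Ω⟩ := nhds_basis_closedBall.mem_iff.1 (hΩo.mem_nhds (hsub hx₀).1)
      obtain ⟨r₂, hr₂, hr₂μ⟩ : ∃ r > 0, μ (ball x₀ r) = 0 := by
        have h := (hsub hx₀).2
        simp only [sptM, mem_ofPred_eq, not_forall, pos_iff_ne_zero, not_not] at h
        obtain ⟨r, hr, h⟩ := h
        exact ⟨r, hr, h⟩
      obtain ⟨r₃, hr₃, hr₃α⟩ := exists_measure_closedBall_lt (hatom x₀ hx₀)
      obtain ⟨ρ, hρ, h₁, h₂, h₃⟩ : ∃ ρ > 0, 4 * ρ ≤ r₁ ∧ 3 * ρ ≤ r₂ ∧ 3 * ρ ≤ r₃ := by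
        refine ⟨min r₁ (min r₂ r₃) / 4, by positivity, ?_, ?_, ?_⟩
        · linarith [min_le_left r₁ (min r₂ r₃)]
        · linarith [min_le_right r₁ (min r₂ r₃), min_le_left r₂ r₃]
        · linarith [min_le_right r₁ (min r₂ r₃), min_le_right r₂ r₃]
      exact ⟨ball x₀ ρ, mem_nhdsWithin_of_mem_nhds (ball_mem_nhds x₀ hρ),
        eventually_forall_mem_ball hΩo hεpos hε0 (fun k => (hu k).mono subset_closure) hμ hα hρ hδ
          hclear ((closedBall_subset_closedBall h₁).trans hr₁Ω)
          (measure_mono_null (ball_subset_ball h₂) hr₂μ)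
          ((measure_mono (closedBall_subset_closedBall h₃)).trans_lt hr₃α)⟩
  obtain ⟨K, hK⟩ := eventually_atTop.1 key
  exact ⟨K, fun k hk x hx => hK k hk x (subset_closure hx)⟩

end
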